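/- Assume MDZH holds with constant C > 4 (for every number field K ≠ ℚ, with d = [K:ℚ] and Δ the absolute value of its discriminant, ζ_K has no zero ρ = β + iγ with 0 < β < 1 satisfying both |γ| ≥ (1 + 4 log Δ)^{-1} and β ≥ 1 − ((log(d·log(3Δ)))^C·log(|γ|+2))^{-1}, and no real zero in (0,1) ∩ (1 − (log(d·log(3Δ)))^{-C}, 1)). Then there is a constant c > 0 such that for every squarefree polynomial f ∈ ℤ[x] of degree d ≥ 2, with no rational root and all coefficients of absolute value at most 2^σ (σ a positive integer), and every real x ≥ exp(c·(log(d²σ + d³))^{2+C²}), one has π_f(x) ≥ x·(1/(d·log x) − exp(−(log x)^{1/C}/(log(d²σ + d³))^C)), where π_f(x) is the number of primes p ≤ x such that the mod-p reduction of f has a root in 𝔽_p. -/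

import Mathlib

section

open scoped Classical

noncomputable section

/-- `zeta` is the (unique) analytic continuation of the Dedekind zeta function of the
number field `K`: it is analytic away from `s = 1` and agrees with the Dirichlet series
`∑_𝔞 (N𝔞)^{-s}` (sum over nonzero integral ideals) for `Re s > 1`. -/
def IsDedekindZeta (K : Type) [Field K] [NumberField K] (zeta : ℂ → ℂ) : Prop :=
  DifferentiableOn ℂ zeta {s : ℂ | s ≠ 1} ∧
    ∀ s : ℂ, 1 < s.re →
      zeta s = ∑' I : {I : Ideal (NumberField.RingOfIntegers K) // I ≠ ⊥},
        (Ideal.absNorm (I : Ideal (NumberField.RingOfIntegers K)) : ℂ) ^ (-s)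

/-- MDZH with constant `C`. -/
def MDZH (C : ℝ) : Prop :=
  ∀ (K : Type) [Field K] [NumberField K],
    1 < Module.finrank ℚ K →
    ∀ zeta : ℂ → ℂ, IsDedekindZeta K zeta →
      (∀ ρ : ℂ, zeta ρ = 0 → 0 < ρ.re → ρ.re < 1 →
        ¬ ((1 + 4 * Real.log ((NumberField.discr K).natAbs))⁻¹ ≤ |ρ.im| ∧
            1 - ((Real.log ((Module.finrank ℚ K : ℝ) *
                    Real.log (3 * ((NumberField.discr K).natAbs : ℝ)))) ^ C *
                  Real.log (|ρ.im| + 2))⁻¹ ≤ ρ.re)) ∧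
      (∀ β : ℝ, zeta (β : ℂ) = 0 → 0 < β → β < 1 →
        ¬ (1 - (Real.log ((Module.finrank ℚ K : ℝ) *
              Real.log (3 * ((NumberField.discr K).natAbs : ℝ)))) ^ (-C) < β))

/-- `piPoly f x` is the number of primes `p ≤ x` such that the reduction of `f` mod `p`
has a root in `𝔽_p`. -/
def piPoly (f : Polynomial ℤ) (x : ℝ) : ℕ :=
  ((Finset.range (⌊x⌋₊ + 1)).filter
    (fun p => p.Prime ∧ ∃ a : ZMod p, Polynomial.aeval a f = 0)).card

end

end

section

open MeasureTheory

theorem summable_pi_prod {ι : Type*} [Fintype ι] {g : ℤ → ℝ} (hg : Summable g)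
    (h0 : ∀ k, 0 ≤ g k) : Summable (fun k : ι → ℤ => ∏ i, g (k i)) := by
  classical
  refine summable_of_sum_le (c := ∏ _i : ι, ∑' k, g k) (fun k => Finset.prod_nonneg fun i _ => h0 _) ?_
  intro s
  have hs : s ⊆ Fintype.piFinset (fun i => s.image (fun k => k i)) := by
    intro k hk
    simp only [Fintype.mem_piFinset, Finset.mem_image]
    exact fun i => ⟨k, hk, rfl⟩
  refine (Finset.sum_le_sum_of_subset_of_nonneg hs
    (fun k _ _ => Finset.prod_nonneg fun i _ => h0 _)).trans ?_
  rw [← Finset.prod_univ_sum (fun i => s.image (fun k => k i)) (fun _ k => g k)]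
  exact Finset.prod_le_prod (fun i _ => Finset.sum_nonneg fun k _ => h0 _)
    (fun i _ => hg.sum_le_tsum _ (fun k _ => h0 _))

theorem summable_int_exp {c : ℝ} (hc : 0 < c) : Summable (fun k : ℤ => Real.exp (-c * (k : ℝ) ^ 2)) := by
  have h1 : Summable (fun k : ℕ => Real.exp (-c * (k : ℝ) ^ 2)) := by
    have := Real.summable_exp_nat_mul_iff.mpr (neg_lt_zero.mpr hc)
    refine Summable.of_nonneg_of_le (fun _ => (Real.exp_pos _).le) (fun k => ?_) this
    apply Real.exp_le_exp.mpr
    rcases Nat.eq_zero_or_pos k with h | h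
    · simp [h]
    · have : (1 : ℝ) ≤ k := by exact_mod_cast h
      nlinarith [mul_nonneg hc.le (mul_nonneg (Nat.cast_nonneg (α := ℝ) k) (sub_nonneg.mpr this))]
  apply Summable.of_nat_of_neg <;> simpa using h1

theorem summable_gauss_pi {ι : Type*} [Fintype ι] {c : ℝ} (hc : 0 < c) :
    Summable (fun k : ι → ℤ => Real.exp (-c * ∑ i, (k i : ℝ) ^ 2)) := by
  refine (summable_pi_prod (summable_int_exp hc) (fun _ => (Real.exp_pos _).le)).congr fun k => ?_
  rw [← Real.exp_sum, Finset.mul_sum]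

theorem gauss_lower {ι : Type*} [Fintype ι] [DecidableEq ι] {B : Matrix ι ι ℝ} (hB : B.det ≠ 0) :
    ∃ c > 0, ∀ x : ι → ℝ, c * ∑ i, x i ^ 2 ≤ ∑ i, (B.mulVec x i) ^ 2 := by
  set D := B⁻¹
  set S := ∑ i, ∑ j, D i j ^ 2
  have hS : 0 ≤ S := Finset.sum_nonneg fun i _ => Finset.sum_nonneg fun j _ => sq_nonneg _
  refine ⟨1 / (S + 1), by positivity, fun x => ?_⟩
  set y := B.mulVec x
  have hx : x = D.mulVec y := by
    simp only [D, y, Matrix.mulVec_mulVec, Matrix.nonsing_inv_mul B (isUnit_iff_ne_zero.mpr hB),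
      Matrix.one_mulVec]
  have h1 : ∑ i, x i ^ 2 ≤ S * ∑ j, y j ^ 2 := by
    rw [hx, Finset.sum_mul]
    exact Finset.sum_le_sum fun i _ => Finset.sum_mul_sq_le_sq_mul_sq _ _ _
  have h2 : 0 ≤ ∑ j, y j ^ 2 := Finset.sum_nonneg fun j _ => sq_nonneg _
  rw [one_div, inv_mul_le_iff₀ (by positivity)]
  nlinarith

noncomputable def gB {ι : Type*} [Fintype ι] (B : Matrix ι ι ℝ) (x : ι → ℝ) : ℝ :=
  Real.exp (-Real.pi * ∑ i, (B.mulVec x i) ^ 2)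

theorem gB_nonneg {ι : Type*} [Fintype ι] (B : Matrix ι ι ℝ) (x : ι → ℝ) : 0 ≤ gB B x :=
  (Real.exp_pos _).le

theorem gB_continuous {ι : Type*} [Fintype ι] (B : Matrix ι ι ℝ) : Continuous (gB B) := by
  unfold gB Matrix.mulVec dotProduct; fun_prop

theorem summable_gB {ι : Type*} [Fintype ι] [DecidableEq ι] {B : Matrix ι ι ℝ} (hB : B.det ≠ 0) :
    Summable (fun k : ι → ℤ => gB B (fun i => (k i : ℝ))) := by
  obtain ⟨c, hc, h⟩ := gauss_lower hB
  refine Summable.of_nonneg_of_le (fun _ => (Real.exp_pos _).le) (fun k => ?_)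
    (summable_gauss_pi (ι := ι) (mul_pos Real.pi_pos hc))
  apply Real.exp_le_exp.mpr
  have := mul_le_mul_of_nonneg_left (h fun i => (k i : ℝ)) Real.pi_pos.le
  linarith

theorem gB_shift {ι : Type*} [Fintype ι] [DecidableEq ι] {B : Matrix ι ι ℝ} (hB : B.det ≠ 0) :
    ∃ c > 0, ∃ c' > 0, ∀ x y : ι → ℝ, gB B (x + y) ≤
      Real.exp (c' * ∑ i, (x i) ^ 2) * Real.exp (- c * ∑ i, (y i) ^ 2) := by
  obtain ⟨c, hc, h⟩ := gauss_lower hB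
  refine ⟨Real.pi * c / 2, by positivity, Real.pi * c, by positivity, fun x y => ?_⟩
  rw [← Real.exp_add]
  apply Real.exp_le_exp.mpr
  have h1 := h (x + y)
  have h2 : ∑ i, (y i) ^ 2 / 2 - ∑ i, (x i)^2 ≤ ∑ i, ((x + y) i) ^ 2 := by
    rw [← Finset.sum_sub_distrib]
    refine Finset.sum_le_sum fun i _ => ?_
    simp only [Pi.add_apply]; nlinarith [sq_nonneg (2 * x i + y i)]
  have h3 := mul_le_mul_of_nonneg_left h2 hc.le
  have h4 := mul_le_mul_of_nonneg_left (h3.trans h1) Real.pi_pos.le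
  rw [← Finset.sum_div] at h4
  nlinarith

theorem gB_integral {ι : Type*} [Fintype ι] [DecidableEq ι] {B : Matrix ι ι ℝ} (hB : B.det ≠ 0)
    (n : ι → ℝ) : ∫ x : ι → ℝ, Complex.exp (-2 * Real.pi * Complex.I * ∑ i, n i * x i) * gB B x
      = |B.det|⁻¹ * gB (B⁻¹).transpose n := by
  set m := (B⁻¹).transpose.mulVec n
  have key : ∀ x : ι → ℝ, Complex.exp (-2 * Real.pi * Complex.I * ∑ i, n i * x i) * gB B x =
      (fun y : ι → ℝ => Complex.exp (-∑ i, (Real.pi : ℂ) * (y i : ℂ) ^ 2 +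
        ∑ i, (-2 * Real.pi * Complex.I * m i) * (y i : ℂ))) (Matrix.toLin' B x) := by
    intro x
    have h1 : ∑ i, n i * x i = ∑ i, m i * (B.mulVec x) i := by
      have : m ⬝ᵥ (B.mulVec x) = n ⬝ᵥ x := by
        simp only [m]
        rw [Matrix.mulVec_transpose, Matrix.dotProduct_mulVec, Matrix.vecMul_vecMul,
          Matrix.nonsing_inv_mul B (isUnit_iff_ne_zero.mpr hB), Matrix.vecMul_one]
      exact this.symm
    rw [h1]
    simp only [gB, Matrix.toLin'_apply]
    push_cast
    rw [← Complex.exp_add]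
    congr 1
    rw [← Finset.mul_sum, Finset.mul_sum, add_comm]
    congr 1
    · ring
    · exact Finset.sum_congr rfl fun i _ => by ring
  rw [integral_congr_ae (ae_of_all _ key)]
  have hmp := Real.map_matrix_volume_pi_eq_smul_volume_pi hB
  have he : MeasurableEmbedding (Matrix.toLin' B) :=
    ((LinearEquiv.ofIsUnitDet (f := Matrix.toLin' B) (v := Pi.basisFun ℝ ι) (v' := Pi.basisFun ℝ ι) (by
      simpa [LinearMap.toMatrix_eq_toMatrix'] using hB)).toContinuousLinearEquiv.toHomeomorph).measurableEmbedding
  refine (he.integral_map (G := ℂ) (μ := volume) (fun y : ι → ℝ => Complex.exp (-∑ i, (Real.pi : ℂ) * (y i : ℂ) ^ 2 +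
        ∑ i, (-2 * Real.pi * Complex.I * m i) * (y i : ℂ)))).symm.trans ?_
  rw [hmp, integral_smul_measure,
    GaussianFourier.integral_cexp_neg_sum_mul_add (b := fun _ => (Real.pi : ℂ)) (by simp [Real.pi_pos])]
  rw [ENNReal.toReal_ofReal (abs_nonneg _), abs_inv]
  simp only [Complex.real_smul, Complex.ofReal_inv]
  congr 1
  simp only [gB]
  rw [Finset.mul_sum, Real.exp_sum, Complex.ofReal_prod]
  refine Finset.prod_congr rfl fun i _ => ?_
  rw [div_self (by exact_mod_cast Real.pi_ne_zero), Complex.one_cpow, one_mul]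
  push_cast
  congr 1
  have := Real.pi_ne_zero
  have : (Real.pi : ℂ) ≠ 0 := by exact_mod_cast this
  field_simp
  ring_nf
  simp [m]

theorem gB_integrable {ι : Type*} [Fintype ι] [DecidableEq ι] {B : Matrix ι ι ℝ} (hB : B.det ≠ 0) :
    Integrable (gB B) := by
  by_contra h
  have h1 := gB_integral hB (0 : ι → ℝ)
  simp only [Pi.zero_apply, zero_mul, Finset.sum_const_zero, Complex.ofReal_zero, mul_zero,
    Complex.exp_zero, one_mul] at h1
  rw [integral_complex_ofReal, integral_undef h] at h1
  have h2 : |B.det|⁻¹ * gB (B⁻¹).transpose 0 = 0 := by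
    have h3 := h1.symm
    exact_mod_cast h3
  have : 0 < |B.det|⁻¹ * gB (B⁻¹).transpose 0 := mul_pos (by positivity) (Real.exp_pos _)
  exact this.ne' h2

set_option maxHeartbeats 1000000 in
theorem theta_inversion {ι : Type*} [Fintype ι] [DecidableEq ι] {B : Matrix ι ι ℝ} (hB : B.det ≠ 0) :
    ∑' k : ι → ℤ, gB B (fun i => (k i : ℝ)) =
      |B.det|⁻¹ * ∑' k : ι → ℤ, gB (B⁻¹).transpose (fun i => (k i : ℝ)) := by
  have hB' : ((B⁻¹).transpose).det ≠ 0 := by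
    rw [Matrix.det_transpose, Matrix.det_nonsing_inv]
    simpa using hB
  set q : (ι → ℝ) → UnitAddTorus ι := fun x i => (x i : UnitAddCircle) with hq
  have hqq : IsOpenQuotientMap q :=
    IsOpenQuotientMap.piMap (f := fun (_ : ι) (x : ℝ) => (x : UnitAddCircle))
      (fun i => QuotientAddGroup.isOpenQuotientMap_mk)
  set P : (ι → ℝ) → ℂ := fun x => ∑' k : ι → ℤ, (gB B (x + fun i => (k i : ℝ)) : ℂ) with hP
  have hPc : Continuous P := by
    obtain ⟨c, hc, c', hc', h⟩ := gB_shift hB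
    rw [continuous_iff_continuousAt]
    intro x0
    have hop : IsOpen {x : ι → ℝ | ∑ i, x i ^ 2 < ∑ i, x0 i ^ 2 + 1} :=
      isOpen_lt (by fun_prop) (by fun_prop)
    refine ContinuousOn.continuousAt (s := {x : ι → ℝ | ∑ i, x i ^ 2 < ∑ i, x0 i ^ 2 + 1}) ?_
      (hop.mem_nhds (by simp))
    have hsm : Summable (fun k : ι → ℤ => Real.exp (c' * (∑ i, x0 i ^ 2 + 1)) *
      Real.exp (- c * ∑ i, (k i : ℝ) ^ 2)) := (summable_gauss_pi hc).mul_left _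
    refine continuousOn_tsum (fun k => ?_) hsm ?_
    · have := gB_continuous B
      fun_prop
    · intro k x hx
      rw [Complex.norm_real, Real.norm_of_nonneg (gB_nonneg _ _)]
      refine (h x _).trans ?_
      have : ∑ i, x i ^ 2 ≤ ∑ i, x0 i ^ 2 + 1 := le_of_lt hx
      gcongr
  have hper : ∀ a b, q a = q b → P a = P b := by
    intro a b hab
    have : ∀ i, ∃ n : ℤ, a i = b i + n := by
      intro i
      have := congrFun hab i
      simp only [hq] at this
      obtain ⟨n, hn⟩ := (QuotientAddGroup.eq_iff_sub_mem.mp this)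
      exact ⟨n, by simp at hn; linarith⟩
    choose n hn using this
    simp only [hP]
    rw [← (Equiv.addLeft n).tsum_eq (fun k : ι → ℤ => (gB B (b + fun i => (k i : ℝ)) : ℂ))]
    refine tsum_congr fun k => ?_
    congr 2
    ext i
    simp [hn i, add_assoc]
  let F : C(UnitAddTorus ι, ℂ) := hqq.isQuotientMap.lift (f := ⟨q, hqq.continuous⟩) ⟨P, hPc⟩ hper
  have hF : ∀ x, F (q x) = P x := fun x =>
    DFunLike.congr_fun (hqq.isQuotientMap.lift_comp (f := ⟨q, hqq.continuous⟩) ⟨P, hPc⟩ hper) x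
  have hcoeff : ∀ n : ι → ℤ, UnitAddTorus.mFourierCoeff F n =
      ((|B.det|⁻¹ * gB (B⁻¹).transpose (fun i => (n i : ℝ)) : ℝ) : ℂ) := by
    intro n
    set h : (ι → ℝ) → ℂ := fun x => Complex.exp (-2 * Real.pi * Complex.I *
      (∑ i, (n i : ℝ) * x i : ℝ)) * gB B x with hh
    have hnorm : ∀ x, ‖h x‖ = gB B x := by
      intro x
      simp only [hh, norm_mul, Complex.norm_exp, Complex.norm_real]
      rw [Real.norm_of_nonneg (gB_nonneg _ _)]
      simp
    have hint : Integrable h := by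
      refine ((gB_integrable hB).mono' ?_ (ae_of_all _ fun x => (hnorm x).le))
      have := gB_continuous B
      exact Continuous.aestronglyMeasurable (by fun_prop)
    set Q : (ι → ℤ) → Set (ι → ℝ) := fun k => {x | ∀ i, x i ∈ Set.Ioc (k i : ℝ) (k i + 1)} with hQ
    have hQm : ∀ k, MeasurableSet (Q k) := by
      intro k
      have : Q k = Set.univ.pi (fun i => Set.Ioc (k i : ℝ) (k i + 1)) := by
        ext x; simp [hQ]
      rw [this]
      exact MeasurableSet.univ_pi fun i => measurableSet_Ioc
    have hQd : Pairwise (Function.onFun Disjoint Q) := by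
      intro k l hkl
      rw [Function.onFun, Set.disjoint_left]
      intro x hx hx'
      apply hkl
      ext i
      have h1 := hx i
      have h2 := hx' i
      have h3 : (k i : ℝ) < l i + 1 := lt_of_lt_of_le h1.1 h2.2
      have h4 : (l i : ℝ) < k i + 1 := lt_of_lt_of_le h2.1 h1.2
      norm_cast at h3 h4
      omega
    have hQu : ⋃ k, Q k = Set.univ := by
      refine Set.eq_univ_of_forall fun x => Set.mem_iUnion.mpr ⟨fun i => ⌈x i⌉ - 1, fun i => ?_⟩
      have := Int.ceil_lt_add_one (x i)
      have := Int.le_ceil (x i)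
      constructor <;> push_cast <;> linarith
    have hshift : ∀ (E : Type) [NormedAddCommGroup E] [NormedSpace ℝ E] (g : (ι → ℝ) → E) (k : ι → ℤ),
        ∫ x in Q 0, g (x + fun i => (k i : ℝ)) = ∫ x in Q k, g x := by
      intro E _ _ g k
      have hmp : MeasurePreserving (fun x : ι → ℝ => x + fun i => (k i : ℝ)) :=
        measurePreserving_add_right volume _
      have he : MeasurableEmbedding (fun x : ι → ℝ => x + fun i => (k i : ℝ)) :=
        (MeasurableEquiv.addRight (fun i => (k i : ℝ))).measurableEmbedding
      rw [← hmp.setIntegral_preimage_emb he g (Q k)]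
      congr 2
      ext x
      simp [hQ, add_comm _ (1:ℝ)]
    have hs1 : HasSum (fun k => ∫ x in Q k, h x) (∫ x, h x) := by
      have := hasSum_integral_iUnion (μ := volume) (f := h) hQm hQd hint.integrableOn
      rwa [hQu, setIntegral_univ] at this
    have hs2 : Summable (fun k : ι → ℤ => ∫ x in Q 0, ‖h (x + fun i => (k i : ℝ))‖) := by
      have := hasSum_integral_iUnion (μ := volume) (f := fun x => ‖h x‖) hQm hQd hint.norm.integrableOn
      refine this.summable.congr fun k : ι → ℤ => ?_
      exact (hshift ℝ (fun x => ‖h x‖) k).symm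
    have hs3 := hasSum_integral_of_summable_integral_norm (μ := volume.restrict (Q 0))
      (F := fun (k : ι → ℤ) x => h (x + fun i => (k i : ℝ)))
      (fun k => (hint.comp_add_right _).integrableOn) hs2
    simp_rw [hshift ℂ h] at hs3
    have h5 := hs1.unique hs3
    rw [hh, gB_integral hB] at h5
    rw [UnitAddTorus.mFourierCoeff_eq_integral F n 0]
    push_cast
    push_cast at h5
    rw [h5]
    have hQ0 : Q 0 = {x : ι → ℝ | ∀ i, x i ∈ Set.Ioc ((0 : ι → ℝ) i) ((0 : ι → ℝ) i + 1)} := by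
      simp [hQ]
    rw [← hQ0]
    refine setIntegral_congr_fun (hQm 0) fun x _ => ?_
    have : F (fun i => (x i : UnitAddCircle)) = P x := hF x
    simp only [this, hP, smul_eq_mul, ← tsum_mul_left]
    refine tsum_congr fun k => ?_
    congr 1
    simp only [UnitAddTorus.mFourier, ContinuousMap.coe_mk, fourier_coe_apply, Pi.neg_apply,
      Complex.ofReal_one, div_one]
    rw [← Complex.exp_sum, Complex.exp_eq_exp_iff_exists_int]
    refine ⟨∑ i, n i * k i, ?_⟩
    push_cast
    simp only [Pi.add_apply, Complex.ofReal_add, mul_add, Finset.sum_add_distrib, Finset.mul_sum,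
      Finset.sum_mul]
    rw [← Finset.sum_add_distrib, ← Finset.sum_add_distrib]
    exact Finset.sum_congr rfl fun i _ => by push_cast; ring
  have hs : Summable (UnitAddTorus.mFourierCoeff F) := by
    simp_rw [funext hcoeff]
    rw [Complex.summable_ofReal]
    exact (summable_gB hB').mul_left _
  have := UnitAddTorus.hasSum_mFourier_series_apply_of_summable hs (q 0)
  have h2 := this.tsum_eq
  rw [hF] at h2
  have h3 : ∀ n : ι → ℤ, UnitAddTorus.mFourier n (q 0) = 1 := by
    intro n; simp [UnitAddTorus.mFourier, hq]
  simp only [h3, hcoeff, hP, smul_eq_mul, mul_one, zero_add] at h2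
  rw [← Complex.ofReal_tsum, ← Complex.ofReal_tsum, tsum_mul_left] at h2
  exact_mod_cast h2.symm

end

section

open MeasureTheory NumberField
variable {K : Type*} [Field K] [NumberField K]

noncomputable def mkEmb (K : Type*) [Field K] [NumberField K] (x : K)
    (i : Σ w : InfinitePlace K, Fin w.mult) : ℝ :=
  Real.sqrt i.1.mult * (if (i.2 : ℕ) = 0 then (i.1.embedding x).re else (i.1.embedding x).im)

theorem sum_fin_mult (w : InfinitePlace K) (f g : ℝ)
    (h : w.IsReal → g = 0) :
    ∑ j : Fin w.mult, (if (j : ℕ) = 0 then f else g) = f + g := by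
  by_cases hw : w.IsReal
  · have : w.mult = 1 := InfinitePlace.mult_isReal ⟨w, hw⟩
    rw [Fin.sum_univ_eq_sum_range (fun j => if j = 0 then f else g), this]
    simp [h hw]
  · have : w.mult = 2 := InfinitePlace.mult_isComplex ⟨w, InfinitePlace.not_isReal_iff_isComplex.mp hw⟩
    rw [Fin.sum_univ_eq_sum_range (fun j => if j = 0 then f else g), this]
    simp [Finset.sum_range_succ]

theorem emb_im_real (w : InfinitePlace K) (hw : w.IsReal) (x : K) :
    (w.embedding x).im = 0 :=
  Complex.conj_eq_iff_im.mp
    (RingHom.congr_fun (NumberField.ComplexEmbedding.isReal_iff.mp (InfinitePlace.isReal_iff.mp hw)) x)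

theorem sum_mkEmb_sq (a : InfinitePlace K → ℝ) (x : K) :
    ∑ i : (Σ w : InfinitePlace K, Fin w.mult), a i.1 * mkEmb K x i ^ 2 =
      ∑ w : InfinitePlace K, w.mult * (a w * w x ^ 2) := by
  rw [Fintype.sum_sigma]
  refine Finset.sum_congr rfl fun w _ => ?_
  have h1 : ∀ j : Fin w.mult, a w * mkEmb K x ⟨w, j⟩ ^ 2 = if (j : ℕ) = 0 then
      a w * (w.mult * (w.embedding x).re ^ 2) else a w * (w.mult * (w.embedding x).im ^ 2) := by
    intro j
    simp only [mkEmb, mul_pow, Real.sq_sqrt (Nat.cast_nonneg (α := ℝ) w.mult)]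
    split_ifs <;> ring
  simp only [h1]
  rw [sum_fin_mult]
  · rw [← InfinitePlace.norm_embedding_eq w x, ← Complex.normSq_eq_norm_sq, Complex.normSq_apply]
    ring
  · intro hw; rw [emb_im_real w hw]; simp

noncomputable def mkSign (K : Type*) [Field K] [NumberField K]
    (i : Σ w : InfinitePlace K, Fin w.mult) : ℝ := if (i.2 : ℕ) = 0 then 1 else -1

theorem trace_eq_sum_places (x : K) :
    ((Algebra.trace ℚ K x : ℚ) : ℝ) = ∑ w : InfinitePlace K, w.mult * (w.embedding x).re := by
  classical
  have h := trace_eq_sum_embeddings (K := ℚ) (L := K) (E := ℂ) (x := x)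
  have h2 : ((Algebra.trace ℚ K x : ℚ) : ℝ) = ∑ φ : K →+* ℂ, (φ x).re := by
    have := congrArg Complex.re h
    simp only [Complex.re_sum] at this
    rw [← Equiv.sum_comp (RingHom.equivRatAlgHom K ℂ).symm (fun φ : K →+* ℂ => (φ x).re)]
    refine Eq.trans ?_ this
    simp
  rw [h2, ← Finset.sum_fiberwise (g := InfinitePlace.mk)]
  refine Finset.sum_congr rfl fun w _ => ?_
  rw [Finset.sum_congr rfl (g := fun _ => (w.embedding x).re), Finset.sum_const,
    InfinitePlace.card_filter_mk_eq, nsmul_eq_mul]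
  intro φ hφ
  simp only [Finset.mem_filter, Finset.mem_univ, true_and] at hφ
  rcases InfinitePlace.mk_eq_iff.mp ((InfinitePlace.mk_embedding w).trans hφ.symm) with h | h
  · rw [h]
  · rw [← h]; simp [ComplexEmbedding.conjugate]

theorem sum_mkEmb_mul (x y : K) :
    ∑ i : (Σ w : InfinitePlace K, Fin w.mult), mkEmb K x i * (mkSign K i * mkEmb K y i) =
      ((Algebra.trace ℚ K (x * y) : ℚ) : ℝ) := by
  rw [trace_eq_sum_places, Fintype.sum_sigma]
  refine Finset.sum_congr rfl fun w _ => ?_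
  have h1 : ∀ j : Fin w.mult, mkEmb K x ⟨w, j⟩ * (mkSign K ⟨w, j⟩ * mkEmb K y ⟨w, j⟩) =
      if (j : ℕ) = 0 then
      w.mult * ((w.embedding x).re * (w.embedding y).re) else
      -(w.mult * ((w.embedding x).im * (w.embedding y).im)) := by
    intro j
    simp only [mkEmb, mkSign]
    have := Real.mul_self_sqrt (Nat.cast_nonneg (α := ℝ) w.mult)
    split_ifs
    · linear_combination ((w.embedding x).re * (w.embedding y).re) * this
    · linear_combination (-(w.embedding x).im * (w.embedding y).im) * this
  simp only [h1]
  rw [sum_fin_mult]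
  · rw [map_mul, Complex.mul_re]
    ring
  · intro hw; rw [emb_im_real w hw]; simp

noncomputable def mkMat
    (b : (Σ w : InfinitePlace K, Fin w.mult) → K) (y : InfinitePlace K → ℝ) :
    Matrix (Σ w : InfinitePlace K, Fin w.mult) (Σ w : InfinitePlace K, Fin w.mult) ℝ :=
  Matrix.of fun i j => Real.exp (y i.1 / 2) * mkEmb K (b j) i

theorem mkEmb_sum {κ : Type*} [Fintype κ] (b : κ → K) (k : κ → ℤ) (i) :
    mkEmb K (∑ j, k j • b j) i = ∑ j, mkEmb K (b j) i * k j := by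
  simp only [mkEmb, map_sum, map_zsmul]
  split_ifs
  · rw [Complex.re_sum, Finset.mul_sum]
    refine Finset.sum_congr rfl fun j _ => ?_
    simp; ring
  · rw [Complex.im_sum, Finset.mul_sum]
    refine Finset.sum_congr rfl fun j _ => ?_
    simp; ring

noncomputable def thetaTerm (y : InfinitePlace K → ℝ) (x : K) : ℝ :=
  Real.exp (-Real.pi * ∑ w : InfinitePlace K, w.mult * (Real.exp (y w) * w x ^ 2))

theorem gB_mkMat
    (b : (Σ w : InfinitePlace K, Fin w.mult) → K) (y : InfinitePlace K → ℝ) (k : (Σ w : InfinitePlace K, Fin w.mult) → ℤ) :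
    gB (mkMat b y) (fun i => (k i : ℝ)) = thetaTerm y (∑ j, k j • b j) := by
  unfold gB thetaTerm
  rw [← sum_mkEmb_sq]
  congr 2
  refine Finset.sum_congr rfl fun i _ => ?_
  have : (mkMat b y).mulVec (fun i => (k i : ℝ)) i =
      Real.exp (y i.1 / 2) * mkEmb K (∑ j, k j • b j) i := by
    rw [mkEmb_sum, Finset.mul_sum]
    simp only [mkMat, Matrix.mulVec, dotProduct, Matrix.of_apply]
    exact Finset.sum_congr rfl fun j _ => by ring
  rw [this, mul_pow, ← Real.exp_nat_mul]
  congr 2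
  push_cast; ring

noncomputable def wS (y : InfinitePlace K → ℝ) : ℝ :=
  ∑ w : InfinitePlace K, w.mult * y w

theorem theta_basis
    (b b' : (Σ w : InfinitePlace K, Fin w.mult) → K)
    [DecidableEq (Σ w : InfinitePlace K, Fin w.mult)]
    (hb : ∀ i j, Algebra.trace ℚ K (b i * b' j) = if i = j then 1 else 0)
    (y : InfinitePlace K → ℝ) :
    0 < |((Algebra.discr ℚ b : ℚ) : ℝ)| ∧
    Summable (fun k : _ → ℤ => thetaTerm y (∑ j, k j • b j)) ∧
    ∑' k : _ → ℤ, thetaTerm y (∑ j, k j • b j) =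
      (Real.sqrt |((Algebra.discr ℚ b : ℚ) : ℝ)|)⁻¹ * Real.exp (-wS y / 2) *
      ∑' k : _ → ℤ, thetaTerm (-y) (∑ j, k j • b' j) := by
  have h1 : ∀ (c c' : (Σ w : InfinitePlace K, Fin w.mult) → K) y, (mkMat c y).transpose * (Matrix.diagonal (mkSign K) * mkMat c' (-y)) =
      Matrix.of fun i j => ((Algebra.trace ℚ K (c i * c' j) : ℚ) : ℝ) := by
    intro c c' y
    ext i j
    rw [Matrix.mul_apply]
    simp only [Matrix.diagonal_mul, mkMat, Matrix.transpose_apply, Matrix.of_apply]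
    rw [← sum_mkEmb_mul]
    refine Finset.sum_congr rfl fun l _ => ?_
    have : Real.exp (y l.1 / 2) * Real.exp ((-y) l.1 / 2) = 1 := by
      rw [← Real.exp_add]; simp [neg_div]
    linear_combination (mkEmb K (c i) l * mkSign K l * mkEmb K (c' j) l) * this
  have hone : (mkMat b y).transpose * (Matrix.diagonal (mkSign K) * mkMat b' (-y)) = 1 := by
    rw [h1]; ext i j; simp only [hb, Matrix.one_apply, Matrix.of_apply]; split_ifs <;> simp
  have hdet : (mkMat b y).det ≠ 0 := by
    intro h
    have := congrArg Matrix.det hone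
    rw [Matrix.det_mul, Matrix.det_transpose, h] at this
    simp at this
  have hinv : ((mkMat b y)⁻¹).transpose = Matrix.diagonal (mkSign K) * mkMat b' (-y) := by
    rw [Matrix.transpose_nonsing_inv]
    exact Matrix.inv_eq_right_inv hone
  have hsign : |(Matrix.diagonal (mkSign K)).det| = 1 := by
    rw [Matrix.det_diagonal, Finset.abs_prod]
    refine Finset.prod_eq_one fun i _ => ?_
    unfold mkSign; split_ifs <;> simp
  have hscale : ∀ y, (mkMat b y).det = Real.exp (wS y / 2) * (mkMat b 0).det := by
    intro y
    have : mkMat b y = Matrix.diagonal (fun i => Real.exp (y i.1 / 2)) * mkMat b 0 := by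
      ext i j; simp [mkMat, Matrix.diagonal_mul]
    rw [this, Matrix.det_mul, Matrix.det_diagonal, ← Real.exp_sum]
    congr 2
    rw [Fintype.sum_sigma]
    simp [wS, Finset.sum_div, mul_div_assoc]
  have hdisc : (mkMat b 0).det ^ 2 = |((Algebra.discr ℚ b : ℚ) : ℝ)| := by
    have h2 := congrArg (fun M => |Matrix.det M|) (h1 b b 0)
    simp only [Matrix.det_mul, Matrix.det_transpose, abs_mul, hsign, neg_zero, one_mul] at h2
    rw [abs_mul_abs_self] at h2
    rw [sq, h2, Algebra.discr_def, ← Rat.coe_castHom, RingHom.map_det]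
    congr 2
  have hd0 : (mkMat b 0).det ≠ 0 := fun h => hdet (by rw [hscale, h, mul_zero])
  refine ⟨by rw [← hdisc]; positivity, ?_, ?_⟩
  · simpa only [gB_mkMat] using summable_gB hdet
  · have := theta_inversion hdet
    simp only [gB_mkMat] at this
    rw [this, hscale, abs_mul, Real.abs_exp, ← hdisc, Real.sqrt_sq_eq_abs, mul_inv, neg_div, Real.exp_neg,
      mul_comm (Real.exp _)⁻¹]
    congr 2
    ext k
    rw [← gB_mkMat, hinv]
    unfold gB
    congr 2
    refine Finset.sum_congr rfl fun i _ => ?_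
    rw [← Matrix.mulVec_mulVec, Matrix.mulVec_diagonal, mul_pow]
    unfold mkSign; split_ifs <;> simp

end

section

open MeasureTheory NumberField nonZeroDivisors
variable {K : Type*} [Field K] [NumberField K]

noncomputable def thetaI (J : FractionalIdeal (𝓞 K)⁰ K)
    (y : InfinitePlace K → ℝ) : ℝ := ∑' x : {x : K // x ∈ J}, thetaTerm y x.1

theorem lattice_equiv {ι : Type*} [Fintype ι] (b : Module.Basis ι ℚ K)
    (J : FractionalIdeal (𝓞 K)⁰ K) (hJ : ∀ x, x ∈ Submodule.span ℤ (Set.range b) ↔ x ∈ J) :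
    ∃ e : (ι → ℤ) ≃ {x : K // x ∈ J}, ∀ k, (e k : K) = ∑ j, k j • b j := by
  have hm : ∀ k : ι → ℤ, ∑ j, k j • b j ∈ J := fun k => by
    rw [← hJ]
    exact Submodule.sum_mem _ fun j _ => Submodule.smul_mem _ _ (Submodule.subset_span ⟨j, rfl⟩)
  refine ⟨Equiv.ofBijective (fun k => ⟨∑ j, k j • b j, hm k⟩) ⟨?_, ?_⟩, fun k => rfl⟩
  · intro k l h
    have h1 := Subtype.mk_eq_mk.mp h
    have hli : LinearIndependent ℤ b := b.linearIndependent.restrict_scalars' ℤ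
    have h2 := Fintype.linearIndependent_iff.mp hli (k - l) (by
      simp only [Pi.sub_apply, sub_smul, Finset.sum_sub_distrib]; rw [h1, sub_self])
    ext i
    have := h2 i
    simp at this; omega
  · rintro ⟨x, hx⟩
    obtain ⟨c, hc⟩ := (Submodule.mem_span_range_iff_exists_fun ℤ).mp ((hJ x).mpr hx)
    exact ⟨c, Subtype.ext hc⟩

noncomputable def dualI (J : (FractionalIdeal (𝓞 K)⁰ K)ˣ) :
    (FractionalIdeal (𝓞 K)⁰ K)ˣ :=
  Units.mk0 (FractionalIdeal.dual ℤ ℚ J.1) (FractionalIdeal.dual_ne_zero ℤ ℚ J.ne_zero)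

noncomputable def covI (J : (FractionalIdeal (𝓞 K)⁰ K)ˣ) : ℝ :=
  Real.sqrt |(NumberField.discr K : ℝ)| * (FractionalIdeal.absNorm J.1 : ℚ)

theorem sigma_card (K : Type*) [Field K] [NumberField K] :
    Fintype.card (Σ w : InfinitePlace K, Fin w.mult) = Module.finrank ℚ K := by
  rw [Fintype.card_sigma]; simp [InfinitePlace.sum_mult_eq]

theorem covI_pos (J : (FractionalIdeal (𝓞 K)⁰ K)ˣ) : 0 < covI J := by
  unfold covI
  have h1 : (NumberField.discr K : ℝ) ≠ 0 := by exact_mod_cast NumberField.discr_ne_zero K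
  have h2 : 0 < FractionalIdeal.absNorm J.1 := by
    refine lt_of_le_of_ne (FractionalIdeal.absNorm_nonneg _) (Ne.symm ?_)
    rw [ne_eq, FractionalIdeal.absNorm_eq_zero_iff]; exact J.ne_zero
  have h3 : (0 : ℝ) < (FractionalIdeal.absNorm J.1 : ℚ) := by exact_mod_cast h2
  positivity

theorem theta_ideal (J : (FractionalIdeal (𝓞 K)⁰ K)ˣ)
    (y : InfinitePlace K → ℝ) :
    Summable (fun x : {x : K // x ∈ J.1} => thetaTerm y x.1) ∧
    thetaI J.1 y = (covI J)⁻¹ * Real.exp (-wS y / 2) * thetaI (dualI J).1 (-y) := by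
  classical
  have hcard : Fintype.card (Module.Free.ChooseBasisIndex ℤ J.1) = Fintype.card (Σ w : InfinitePlace K, Fin w.mult) := by
    rw [sigma_card, ← Module.finrank_eq_card_basis (basisOfFractionalIdeal K J)]
  let e0 := Fintype.equivOfCardEq hcard
  let b := (basisOfFractionalIdeal K J).reindex e0
  have hspan : ∀ x, x ∈ Submodule.span ℤ (Set.range b) ↔ x ∈ J.1 := by
    intro x
    rw [Module.Basis.range_reindex, mem_span_basisOfFractionalIdeal]; rfl
  let b' := b.traceDual
  have hspan' : ∀ x, x ∈ Submodule.span ℤ (Set.range b') ↔ x ∈ (dualI J).1 := by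
    intro x
    have := Submodule.traceDual_span_of_basis ℤ (J.1 : Submodule (𝓞 K) K) b (by
      ext x; rw [hspan]; simp)
    rw [← this, dualI, Units.val_mk0, ← FractionalIdeal.mem_coe, FractionalIdeal.coe_dual ℤ ℚ J.ne_zero]
    rfl
  obtain ⟨e, he⟩ := lattice_equiv b J.1 hspan
  obtain ⟨e', he'⟩ := lattice_equiv b' (dualI J).1 hspan'
  have hb : ∀ i j, Algebra.trace ℚ K (b i * b' j) = if i = j then 1 else 0 := by
    intro i j
    have := Module.Basis.trace_mul_traceDual b i j
    rw [this]
  obtain ⟨h0, h1, h2⟩ := theta_basis b b' hb y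
  have hdisc : |((Algebra.discr ℚ b : ℚ) : ℝ)| = (covI J) ^ 2 := by
    have hc2 : Fintype.card (Module.Free.ChooseBasisIndex ℤ (𝓞 K)) = Fintype.card (Module.Free.ChooseBasisIndex ℤ J.1) := by
      rw [hcard, sigma_card, ← Module.finrank_eq_card_chooseBasisIndex, RingOfIntegers.rank]
    let e1 := Fintype.equivOfCardEq hc2
    have hdet := det_basisOfFractionalIdeal_eq_absNorm K J e1
    have h3 : Algebra.discr ℚ b = Algebra.discr ℚ ((basisOfFractionalIdeal K J).reindex e1.symm) := by
      simp only [b, Module.Basis.coe_reindex]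
      rw [Algebra.discr_reindex, Algebra.discr_reindex]
    have h4 : Algebra.discr ℚ ((basisOfFractionalIdeal K J).reindex e1.symm) =
        ((integralBasis K).det ((basisOfFractionalIdeal K J).reindex e1.symm)) ^ 2 * NumberField.discr K := by
      rw [coe_discr, Module.Basis.det_apply, ← Algebra.discr_of_matrix_vecMul,
        Module.Basis.toMatrix_map_vecMul]
    rw [h3, h4, ← sq_abs, hdet, covI, mul_pow, Real.sq_sqrt (abs_nonneg _)]
    push_cast
    rw [abs_mul, abs_of_nonneg (sq_nonneg _), mul_comm]
  rw [hdisc, Real.sqrt_sq (covI_pos J).le] at h2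
  constructor
  · rw [← e.summable_iff]
    exact h1.congr fun k => by simp [he]
  · unfold thetaI
    rw [← e.tsum_eq, ← e'.tsum_eq]
    simpa only [he, he'] using h2

theorem dualI_eq (J : (FractionalIdeal (𝓞 K)⁰ K)ˣ) :
    dualI J = dualI 1 * J⁻¹ := by
  ext1
  simp only [dualI, Units.val_mk0, Units.val_mul, Units.val_one]
  rw [FractionalIdeal.dual_eq_mul_inv]
  simp

theorem covI_dual (J : (FractionalIdeal (𝓞 K)⁰ K)ˣ) :
    covI (dualI J) = (covI J)⁻¹ := by
  have h1 := (theta_ideal J 0).2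
  have h2 := (theta_ideal (dualI J) 0).2
  have h3 : dualI (dualI J) = J := by
    ext1; simp [dualI]
  rw [h3] at h2
  have hpos : 0 < thetaI J.1 0 := by
    refine (theta_ideal J 0).1.tsum_pos (fun x => (Real.exp_pos _).le) ⟨0, J.1.zero_mem⟩ (Real.exp_pos _)
  simp only [wS, Pi.zero_apply, mul_zero, Finset.sum_const_zero, neg_zero, zero_div, Real.exp_zero, mul_one] at h1 h2
  have c1 := covI_pos J
  have c2 := covI_pos (dualI J)
  rw [h2] at h1
  field_simp at h1 ⊢
  nlinarith

end

section

open MeasureTheory NumberField nonZeroDivisors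
open scoped ENNReal
variable {K : Type*} [Field K] [NumberField K]

theorem countable_nf (K : Type*) [Field K] [NumberField K] : Countable K :=
  (Module.finBasis ℚ K).equivFun.toEquiv.injective.countable

theorem countable_units (K : Type*) [Field K] [NumberField K] : Countable (𝓞 K)ˣ := by
  have := countable_nf K
  have h1 : Countable (𝓞 K) := (RingOfIntegers.coe_injective (K := K)).countable
  exact (Units.val_injective (α := 𝓞 K)).countable

noncomputable def uL (u : (𝓞 K)ˣ) (w : InfinitePlace K) : ℝ :=
  2 * Real.log (w ((u : 𝓞 K) : K))

theorem uL_inv (u : (𝓞 K)ˣ) : uL (u⁻¹) = - uL (K := K) u := by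
  ext w
  have h1 : (((u⁻¹ : (𝓞 K)ˣ) : 𝓞 K) : K) = (((u : 𝓞 K) : K))⁻¹ := by
    apply eq_inv_of_mul_eq_one_left
    exact_mod_cast congrArg (algebraMap (𝓞 K) K) u.inv_mul
  simp [uL, h1]

theorem sum_mult_log_unit (u : (𝓞 K)ˣ) :
    ∑ w : InfinitePlace K, (w.mult : ℝ) * Real.log (w ((u : 𝓞 K) : K)) = 0 := by
  exact NumberField.Units.sum_mult_mul_log u

theorem wS_add (y z : InfinitePlace K → ℝ) :
    wS (y + z) = wS y + wS z := by
  simp [wS, mul_add, Finset.sum_add_distrib]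

theorem wS_uL (u : (𝓞 K)ˣ) : wS (uL (K := K) u) = 0 := by
  unfold wS uL
  have := sum_mult_log_unit u
  calc _ = 2 * ∑ w : InfinitePlace K, (w.mult : ℝ) * Real.log (w ((u : 𝓞 K) : K)) := by
        rw [Finset.mul_sum]; exact Finset.sum_congr rfl fun _ _ => by ring
    _ = 0 := by rw [this, mul_zero]

theorem wS_const (t : ℝ) :
    wS (K := K) (fun _ => t) = Module.finrank ℚ K * t := by
  rw [wS, ← Finset.sum_mul, ← InfinitePlace.sum_mult_eq]; push_cast; rfl

theorem wS_continuous : Continuous (wS (K := K)) := by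
  unfold wS; fun_prop

theorem wS_neg (y : InfinitePlace K → ℝ) :
    wS (-y) = - wS y := by
  simp [wS]

def IsWt (K : Type*) [Field K] [NumberField K] (ψ : (InfinitePlace K → ℝ) → ℝ≥0∞) : Prop :=
  Measurable ψ ∧ (∀ y, ∑' u : (𝓞 K)ˣ, ψ (y + uL u) = 1) ∧ ∀ y t, ψ (y + fun _ => t) = ψ y

theorem IsWt.neg {ψ : (InfinitePlace K → ℝ) → ℝ≥0∞}
    (h : IsWt K ψ) : IsWt K (fun y => ψ (-y)) := by
  refine ⟨h.1.comp measurable_neg, fun y => ?_, fun y t => ?_⟩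
  · rw [← h.2.1 (-y), ← (Equiv.inv (𝓞 K)ˣ).tsum_eq]
    refine tsum_congr fun u => ?_
    simp [uL_inv, add_comm]
  · show ψ _ = ψ (-y)
    rw [← h.2.2 (-y) (-t)]
    congr 1; ext w; simp; ring

open NumberField.Units NumberField.Units.dirichletUnitTheorem in
theorem exists_wt (K : Type*) [Field K] [NumberField K] : ∃ ψ, IsWt K ψ := by
  classical
  set b := (basisUnitLattice K).ofZLatticeBasis ℝ _ with hb
  set D := ZSpan.fundamentalDomain b
  have hD : MeasurableSet D := ZSpan.fundamentalDomain_measurableSet b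
  set p : (InfinitePlace K → ℝ) → logSpace K := fun y w =>
    w.1.mult * (y w.1 - wS y / Module.finrank ℚ K) / 2 with hp
  have hpm : Measurable p := by
    have := (wS_continuous (K := K)).measurable
    exact measurable_pi_lambda _ fun w => by fun_prop
  have hpu : ∀ y u, p (y + uL u) = logEmbedding K (Additive.ofMul u) + p y := by
    intro y u
    ext w
    simp only [hp, wS_add, wS_uL, add_zero, Pi.add_apply, logEmbedding_component, uL]
    ring
  have hn : (Module.finrank ℚ K : ℝ) ≠ 0 := by exact_mod_cast Module.finrank_pos.ne'
  have hpt : ∀ y t, p (y + fun _ => t) = p y := by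
    intro y t
    ext w
    simp only [hp, wS_add, wS_const, Pi.add_apply]
    field_simp
    ring
  have hcard : ∀ z : logSpace K, ∑' u : (𝓞 K)ˣ, D.indicator (fun _ => (1 : ℝ≥0∞))
      (logEmbedding K (Additive.ofMul u) + z) = (Nat.card (torsion K) : ℝ≥0∞) := by
    intro z
    obtain ⟨v, hv, huniq⟩ := ZSpan.exist_unique_vadd_mem_fundamentalDomain b z
    have hspan : Submodule.span ℤ (Set.range b) = unitLattice K :=
      Module.Basis.ofZLatticeBasis_span ℝ _ _
    have hv' : (v : logSpace K) ∈ unitLattice K := hspan ▸ v.2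
    obtain ⟨u0, -, hu0⟩ := hv'
    have hu0' : logEmbedding K u0 = v := hu0
    rw [← (Equiv.mulRight (Additive.toMul u0)).tsum_eq]
    have : ∀ u : (𝓞 K)ˣ, D.indicator (fun _ => (1 : ℝ≥0∞))
        (logEmbedding K (Additive.ofMul (Equiv.mulRight (Additive.toMul u0) u)) + z) =
        (torsion K : Set (𝓞 K)ˣ).indicator (fun _ => (1 : ℝ≥0∞)) u := by
      intro u
      have h1 : logEmbedding K (Additive.ofMul (Equiv.mulRight (Additive.toMul u0) u)) =
          logEmbedding K (Additive.ofMul u) + v := by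
        rw [← hu0', ← map_add]; rfl
      rw [h1]
      by_cases hu : u ∈ torsion K
      · rw [logEmbedding_eq_zero_iff.mpr hu, zero_add, Set.indicator_of_mem (by exact hv),
          Set.indicator_of_mem hu]
      · rw [Set.indicator_of_notMem, Set.indicator_of_notMem (by exact hu)]
        intro hmem
        apply hu
        have hm : logEmbedding K (Additive.ofMul u) + v ∈ Submodule.span ℤ (Set.range b) := by
          refine add_mem ?_ v.2
          rw [hspan]
          exact ⟨Additive.ofMul u, trivial, rfl⟩
        have := huniq ⟨_, hm⟩ hmem
        have h2 := congrArg Subtype.val this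
        simp only at h2
        rw [add_eq_right] at h2
        exact logEmbedding_eq_zero_iff.mp h2
    have : Finite ↑(torsion K : Set (𝓞 K)ˣ) := inferInstanceAs (Finite (torsion K))
    rw [tsum_congr ‹_›, ← tsum_subtype, ENNReal.tsum_set_one, Set.encard, ENat.card_eq_coe_natCard]
    rfl
  have hT : (Nat.card (torsion K) : ℝ≥0∞) ≠ 0 := by
    simp [Nat.card_eq_zero]
    infer_instance
  refine ⟨fun y => (Nat.card (torsion K) : ℝ≥0∞)⁻¹ * D.indicator (fun _ => 1) (p y), ?_, ?_, ?_⟩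
  · exact ((measurable_const.indicator hD).comp hpm).const_mul _
  · intro y
    rw [ENNReal.tsum_mul_left]
    simp only [hpu]
    rw [hcard, ENNReal.inv_mul_cancel hT (ENNReal.natCast_ne_top _)]
  · intro y t
    simp only [hpt]

theorem unfold_wt {ψ : (InfinitePlace K → ℝ) → ℝ≥0∞}
    (h : IsWt K ψ) {f : (InfinitePlace K → ℝ) → ℝ≥0∞} (hf : Measurable f) :
    ∑' u : (𝓞 K)ˣ, ∫⁻ y, ψ y * f (y + uL u) = ∫⁻ y, f y := by
  have := countable_units K
  have h1 : ∀ u : (𝓞 K)ˣ, ∫⁻ y, ψ y * f (y + uL u) = ∫⁻ y, ψ (y + uL u⁻¹) * f y := by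
    intro u
    rw [← lintegral_add_right_eq_self _ (uL u⁻¹)]
    refine lintegral_congr fun y => ?_
    rw [uL_inv]; simp
  rw [tsum_congr h1]
  refine ((Equiv.inv (𝓞 K)ˣ).tsum_eq (fun u => ∫⁻ y, ψ (y + uL u) * f y)).trans ?_
  rw [← lintegral_tsum]
  · refine lintegral_congr fun y => ?_
    rw [ENNReal.tsum_mul_right, h.2.1, one_mul]
  · intro u
    exact ((h.1.comp (measurable_add_const _)).mul hf).aemeasurable

theorem mellin_one {A τ : ℝ} (hA : 0 < A) (hτ : 0 < τ) :
    Integrable (fun y : ℝ => Real.exp (-(A * Real.exp y)) * Real.exp (τ * y)) ∧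
    ∫ y : ℝ, Real.exp (-(A * Real.exp y)) * Real.exp (τ * y) = A ^ (-τ) * Real.Gamma τ := by
  have h0 := Real.integral_rpow_mul_exp_neg_mul_Ioi hτ hA
  have himg : Real.exp '' Set.univ = Set.Ioi 0 := by rw [Set.image_univ, Real.range_exp]
  have hpt : ∀ y : ℝ, |Real.exp y| • (Real.exp y ^ (τ - 1) * Real.exp (-(A * Real.exp y))) =
      Real.exp (-(A * Real.exp y)) * Real.exp (τ * y) := by
    intro y
    rw [abs_of_pos (Real.exp_pos y), smul_eq_mul, ← Real.exp_mul, ← mul_assoc, ← Real.exp_add, mul_comm]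
    congr 2; ring
  have h1 := integral_image_eq_integral_abs_deriv_smul MeasurableSet.univ
    (fun x _ => (Real.hasDerivAt_exp x).hasDerivWithinAt) Real.exp_injective.injOn
    (fun t : ℝ => t ^ (τ - 1) * Real.exp (-(A * t)))
  rw [himg, h0, setIntegral_univ] at h1
  simp only [hpt] at h1
  have h2 : A ^ (-τ) * Real.Gamma τ = ∫ y : ℝ, Real.exp (-(A * Real.exp y)) * Real.exp (τ * y) := by
    rw [← h1, one_div, Real.inv_rpow hA.le, Real.rpow_neg hA.le]
  refine ⟨?_, h2.symm⟩
  by_contra h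
  rw [integral_undef h] at h2
  have := mul_pos (Real.rpow_pos_of_pos hA (-τ)) (Real.Gamma_pos_of_pos hτ)
  exact this.ne' h2

noncomputable def gamR (K : Type*) [Field K] [NumberField K] (σ : ℝ) : ℝ :=
  ∏ w : InfinitePlace K, ((Real.pi * w.mult) ^ (-(w.mult * σ / 2)) * Real.Gamma (w.mult * σ / 2))

theorem mellin_K {x : K} (hx : x ≠ 0) {σ : ℝ} (hσ : 0 < σ) :
    ∫⁻ y : InfinitePlace K → ℝ, ENNReal.ofReal (thetaTerm y x * Real.exp (σ / 2 * wS y)) =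
      ENNReal.ofReal (gamR K σ * (|Algebra.norm ℚ x| : ℚ) ^ (-σ)) := by
  have hm : ∀ w : InfinitePlace K, (0 : ℝ) < w.mult := fun w => by exact_mod_cast InfinitePlace.mult_pos
  have hw : ∀ w : InfinitePlace K, 0 < w x := fun w => InfinitePlace.pos_iff.mpr hx
  have key : ∀ y : InfinitePlace K → ℝ, thetaTerm y x * Real.exp (σ / 2 * wS y) =
      ∏ w, (fun (w : InfinitePlace K) (t : ℝ) => Real.exp (-((Real.pi * w.mult * w x ^ 2) * Real.exp t)) *
        Real.exp ((w.mult * σ / 2) * t)) w (y w) := by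
    intro y
    simp only [Finset.prod_mul_distrib, ← Real.exp_sum, thetaTerm, wS, Finset.mul_sum]
    congr 2
    · exact Finset.sum_congr rfl fun w _ => by ring
    · exact Finset.sum_congr rfl fun w _ => by ring
  have hI := fun w : InfinitePlace K => mellin_one (A := Real.pi * w.mult * w x ^ 2) (τ := w.mult * σ / 2)
    (by have := hm w; have := hw w; positivity) (by have := hm w; positivity)
  rw [← ofReal_integral_eq_lintegral_ofReal]
  · congr 1
    rw [integral_congr_ae (ae_of_all _ key)]
    refine (integral_fintype_prod_volume_eq_prod (fun (w : InfinitePlace K) (t : ℝ) =>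
      Real.exp (-((Real.pi * w.mult * w x ^ 2) * Real.exp t)) * Real.exp ((w.mult * σ / 2) * t))).trans ?_
    simp only [(hI _).2]
    rw [gamR, ← InfinitePlace.prod_eq_abs_norm, ← Real.finsetProd_rpow _ _ (fun w _ => by have := hw w; positivity),
      ← Finset.prod_mul_distrib]
    refine Finset.prod_congr rfl fun w _ => ?_
    have := hm w
    rw [Real.mul_rpow (by positivity) (by positivity)]
    have : (w x ^ 2) ^ (-(w.mult * σ / 2)) = (w x ^ w.mult) ^ (-σ) := by
      rw [← Real.rpow_natCast, ← Real.rpow_natCast, ← Real.rpow_mul (hw w).le, ← Real.rpow_mul (hw w).le]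
      congr 1; push_cast; ring
    rw [this]; ring
  · simp_rw [key]
    exact Integrable.fintype_prod (fun w => (hI w).1)
  · exact ae_of_all _ fun y => mul_nonneg (Real.exp_pos _).le (Real.exp_pos _).le

theorem thetaTerm_unit (y : InfinitePlace K → ℝ) (x : K) (u : (𝓞 K)ˣ) :
    thetaTerm y (((u : 𝓞 K) : K) * x) = thetaTerm (y + uL u) x := by
  unfold thetaTerm
  congr 2
  refine Finset.sum_congr rfl fun w _ => ?_
  have hw : 0 < w ((u : 𝓞 K) : K) := InfinitePlace.pos_iff.mpr (by simp)
  have : Real.exp (uL u w) = w ((u : 𝓞 K) : K) ^ 2 := by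
    rw [uL, mul_comm, Real.exp_mul, Real.exp_log hw]; norm_cast
  rw [Pi.add_apply, Real.exp_add, this, map_mul]; ring

noncomputable def theta0 (J : FractionalIdeal (𝓞 K)⁰ K)
    (y : InfinitePlace K → ℝ) : ℝ≥0∞ :=
  ∑' x : {x : K // x ∈ J ∧ x ≠ 0}, ENNReal.ofReal (thetaTerm y x.1)

noncomputable def zcl (c : ClassGroup (𝓞 K)) (σ : ℝ) : ℝ≥0∞ :=
  ∑' I : {I : (Ideal (𝓞 K))⁰ // ClassGroup.mk0 I = c}, ENNReal.ofReal ((Ideal.absNorm (I.1 : Ideal (𝓞 K)) : ℝ) ^ (-σ))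

theorem exists_gen (J : (FractionalIdeal (𝓞 K)⁰ K)ˣ)
    (I : (Ideal (𝓞 K))⁰) :
    ClassGroup.mk0 I = (ClassGroup.mk K J)⁻¹ ↔ ∃ x : K, ((I : Ideal (𝓞 K)) : FractionalIdeal (𝓞 K)⁰ K) * J.1 =
      FractionalIdeal.spanSingleton _ x := by
  rw [eq_inv_iff_mul_eq_one, ← ClassGroup.mk_mk0 K, ← map_mul, ClassGroup.mk_eq_one_iff,
    FractionalIdeal.isPrincipal_iff]
  simp

theorem exists_unit_of_span_eq {x y : K} (hx : x ≠ 0)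
    (h : FractionalIdeal.spanSingleton (𝓞 K)⁰ x = FractionalIdeal.spanSingleton _ y) :
    ∃ u : (𝓞 K)ˣ, y = ((u : 𝓞 K) : K) * x := by
  have h1 : x ∈ FractionalIdeal.spanSingleton (𝓞 K)⁰ y := h ▸ FractionalIdeal.mem_spanSingleton_self _ _
  have h2 : y ∈ FractionalIdeal.spanSingleton (𝓞 K)⁰ x := h ▸ FractionalIdeal.mem_spanSingleton_self _ _
  obtain ⟨a, ha⟩ := (FractionalIdeal.mem_spanSingleton _).mp h1
  obtain ⟨b, hb⟩ := (FractionalIdeal.mem_spanSingleton _).mp h2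
  rw [Algebra.smul_def] at ha hb
  have hab : b * a = 1 := by
    apply RingOfIntegers.coe_injective (K := K)
    have : (algebraMap (𝓞 K) K a * algebraMap (𝓞 K) K b) * x = 1 * x := by
      rw [mul_assoc, hb, ha, one_mul]
    have := mul_right_cancel₀ hx this
    rw [map_mul, map_one, mul_comm]; exact this
  exact ⟨⟨b, a, hab, by rw [mul_comm]; exact hab⟩, hb.symm⟩

theorem ideal_unit_equiv (J : (FractionalIdeal (𝓞 K)⁰ K)ˣ) :
    ∃ g : {I : (Ideal (𝓞 K))⁰ // ClassGroup.mk0 I = (ClassGroup.mk K J)⁻¹} → K,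
      (∀ I, g I ≠ 0 ∧ |Algebra.norm ℚ (g I)| = Ideal.absNorm (I.1 : Ideal (𝓞 K)) * FractionalIdeal.absNorm J.1) ∧
      ∃ e : {I : (Ideal (𝓞 K))⁰ // ClassGroup.mk0 I = (ClassGroup.mk K J)⁻¹} × (𝓞 K)ˣ ≃ {x : K // x ∈ J.1 ∧ x ≠ 0},
        ∀ p, (e p : K) = ((p.2 : 𝓞 K) : K) * g p.1 := by
  choose g hg using fun I : {I : (Ideal (𝓞 K))⁰ // ClassGroup.mk0 I = (ClassGroup.mk K J)⁻¹} =>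
    (exists_gen J I.1).mp I.2
  have hI0 : ∀ I : (Ideal (𝓞 K))⁰, ((I : Ideal (𝓞 K)) : FractionalIdeal (𝓞 K)⁰ K) ≠ 0 := fun I =>
    FractionalIdeal.coeIdeal_ne_zero.mpr (nonZeroDivisors.ne_zero I.2)
  have hg0 : ∀ I, g I ≠ 0 := by
    intro I h0
    have := hg I
    rw [h0, FractionalIdeal.spanSingleton_zero] at this
    exact mul_ne_zero (hI0 I.1) J.ne_zero this
  refine ⟨g, fun I => ⟨hg0 I, ?_⟩, ?_⟩
  · rw [← FractionalIdeal.absNorm_span_singleton (R := 𝓞 K), ← hg, map_mul, FractionalIdeal.coeIdeal_absNorm]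
  have hmem : ∀ p : {I : (Ideal (𝓞 K))⁰ // ClassGroup.mk0 I = (ClassGroup.mk K J)⁻¹} × (𝓞 K)ˣ,
      ((p.2 : 𝓞 K) : K) * g p.1 ∈ J.1 ∧ ((p.2 : 𝓞 K) : K) * g p.1 ≠ 0 := by
    intro p
    refine ⟨?_, mul_ne_zero (by simp) (hg0 _)⟩
    have h1 : g p.1 ∈ J.1 := by
      have h2 : g p.1 ∈ FractionalIdeal.spanSingleton (𝓞 K)⁰ (g p.1) := FractionalIdeal.mem_spanSingleton_self _ _
      rw [← hg] at h2
      refine (FractionalIdeal.mul_le.mpr ?_ : _ * J.1 ≤ J.1) h2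
      intro i hi j hj
      obtain ⟨a, -, rfl⟩ := (FractionalIdeal.mem_coeIdeal _).mp hi
      have := Submodule.smul_mem (J.1 : Submodule (𝓞 K) K) a hj
      rwa [Algebra.smul_def] at this
    have := Submodule.smul_mem (J.1 : Submodule (𝓞 K) K) (p.2 : 𝓞 K) h1
    rwa [Algebra.smul_def] at this
  have hspu : ∀ (u : (𝓞 K)ˣ) (x : K), FractionalIdeal.spanSingleton (𝓞 K)⁰ (((u : 𝓞 K) : K) * x) =
      FractionalIdeal.spanSingleton (𝓞 K)⁰ x := by
    intro u x
    rw [← FractionalIdeal.spanSingleton_mul_spanSingleton, ← FractionalIdeal.coeIdeal_span_singleton,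
      Ideal.span_singleton_eq_top.mpr u.isUnit]
    simp
  refine ⟨Equiv.ofBijective (fun p => ⟨_, hmem p⟩) ⟨?_, ?_⟩, fun p => rfl⟩
  · rintro ⟨I, u⟩ ⟨I', u'⟩ h
    have h1 : ((u : 𝓞 K) : K) * g I = ((u' : 𝓞 K) : K) * g I' := Subtype.mk_eq_mk.mp h
    have h2 := congrArg (FractionalIdeal.spanSingleton (𝓞 K)⁰) h1
    rw [hspu, hspu, ← hg, ← hg] at h2
    have h3 := mul_right_cancel₀ J.ne_zero h2
    have h4 : I = I' := Subtype.ext (Subtype.ext (FractionalIdeal.coeIdeal_injective h3))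
    subst h4
    have h5 := mul_right_cancel₀ (hg0 I) h1
    have h6 : u = u' := Units.ext (RingOfIntegers.coe_injective h5)
    rw [h6]
  · rintro ⟨x, hx, hx0⟩
    have hle : FractionalIdeal.spanSingleton (𝓞 K)⁰ x * (J⁻¹).1 ≤ 1 := by
      calc _ ≤ J.1 * (J⁻¹).1 := by
            apply mul_le_mul_left
            rwa [FractionalIdeal.spanSingleton_le_iff_mem]
        _ = 1 := J.mul_inv
    obtain ⟨I, hI⟩ := FractionalIdeal.le_one_iff_exists_coeIdeal.mp hle
    have hIne : I ≠ 0 := by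
      rintro rfl
      rw [Submodule.zero_eq_bot, FractionalIdeal.coeIdeal_bot] at hI
      have := mul_ne_zero (FractionalIdeal.spanSingleton_ne_zero_iff.mpr hx0 : FractionalIdeal.spanSingleton (𝓞 K)⁰ x ≠ 0) (J⁻¹).ne_zero
      exact this hI.symm
    have hIJ : ((I : Ideal (𝓞 K)) : FractionalIdeal (𝓞 K)⁰ K) * J.1 = FractionalIdeal.spanSingleton _ x := by
      rw [hI, mul_assoc, J.inv_mul, mul_one]
    let I' : {I : (Ideal (𝓞 K))⁰ // ClassGroup.mk0 I = (ClassGroup.mk K J)⁻¹} :=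
      ⟨⟨I, mem_nonZeroDivisors_of_ne_zero hIne⟩, (exists_gen J _).mpr ⟨x, hIJ⟩⟩
    obtain ⟨u, hu⟩ := exists_unit_of_span_eq (hg0 I') ((hg I').symm.trans hIJ)
    exact ⟨⟨I', u⟩, Subtype.ext hu.symm⟩

theorem thetaTerm_pos (y : InfinitePlace K → ℝ) (x : K) :
    0 < thetaTerm y x := Real.exp_pos _

theorem thetaTerm_measurable (x : K) :
    Measurable (fun y : InfinitePlace K → ℝ => thetaTerm y x) := by
  unfold thetaTerm; fun_prop

theorem theta0_measurable (J : FractionalIdeal (𝓞 K)⁰ K) :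
    Measurable (theta0 J) := by
  have := countable_nf K
  unfold theta0
  exact Measurable.tsum fun x => (thetaTerm_measurable x.1).ennreal_ofReal

theorem mellin_theta (J : (FractionalIdeal (𝓞 K)⁰ K)ˣ)
    {ψ : (InfinitePlace K → ℝ) → ℝ≥0∞} (hψ : IsWt K ψ) {σ : ℝ} (hσ : 0 < σ) :
    ∫⁻ y, ψ y * theta0 J.1 y * ENNReal.ofReal (Real.exp (σ / 2 * wS y)) =
      ENNReal.ofReal (gamR K σ * ((FractionalIdeal.absNorm J.1 : ℚ) : ℝ) ^ (-σ)) * zcl (ClassGroup.mk K J)⁻¹ σ := by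
  have := countable_nf K
  have hcu := countable_units K
  obtain ⟨g, hg, e, he⟩ := ideal_unit_equiv J
  have hci : Countable ({I : (Ideal (𝓞 K))⁰ // ClassGroup.mk0 I = (ClassGroup.mk K J)⁻¹} × (𝓞 K)ˣ) :=
    e.injective.countable
  have hci2 : Countable {I : (Ideal (𝓞 K))⁰ // ClassGroup.mk0 I = (ClassGroup.mk K J)⁻¹} :=
    (Function.LeftInverse.injective (g := Prod.fst) (f := fun I => (I, (1 : (𝓞 K)ˣ))) fun I => rfl).countable
  have hwm := (wS_continuous (K := K)).measurable
  have h1 : ∀ y, ψ y * theta0 J.1 y * ENNReal.ofReal (Real.exp (σ / 2 * wS y)) =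
      ∑' p : {I : (Ideal (𝓞 K))⁰ // ClassGroup.mk0 I = (ClassGroup.mk K J)⁻¹} × (𝓞 K)ˣ,
      ψ y * (fun z => ENNReal.ofReal (thetaTerm z (g p.1) * Real.exp (σ / 2 * wS z))) (y + uL p.2) := by
    intro y
    rw [theta0, ← e.tsum_eq, mul_assoc, ← ENNReal.tsum_mul_right, ← ENNReal.tsum_mul_left]
    refine tsum_congr fun p => ?_
    rw [he, thetaTerm_unit, ← ENNReal.ofReal_mul (thetaTerm_pos _ _).le]
    simp only [wS_add, wS_uL, add_zero]
  have hfm : ∀ x : K, Measurable fun z : InfinitePlace K → ℝ =>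
      ENNReal.ofReal (thetaTerm z x * Real.exp (σ / 2 * wS z)) := fun x => by
    have := thetaTerm_measurable x
    fun_prop
  have hm : ∀ p : {I : (Ideal (𝓞 K))⁰ // ClassGroup.mk0 I = (ClassGroup.mk K J)⁻¹} × (𝓞 K)ˣ,
      AEMeasurable (fun y => ψ y * (fun z => ENNReal.ofReal (thetaTerm z (g p.1) * Real.exp (σ / 2 * wS z)))
        (y + uL p.2)) volume :=
    fun p => (hψ.1.mul ((hfm _).comp (measurable_add_const _))).aemeasurable
  rw [lintegral_congr h1, lintegral_tsum hm]
  refine (ENNReal.tsum_prod (f := fun I (u : (𝓞 K)ˣ) => ∫⁻ a : InfinitePlace K → ℝ,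
    ψ a * (fun z => ENNReal.ofReal (thetaTerm z (g I) * Real.exp (σ / 2 * wS z))) (a + uL u))).trans ?_
  rw [zcl, ← ENNReal.tsum_mul_left]
  refine tsum_congr fun I => ?_
  refine (unfold_wt hψ (hfm (g I))).trans ?_
  rw [mellin_K (hg I).1 hσ, (hg I).2, ← ENNReal.ofReal_mul']
  · congr 1
    push_cast
    rw [Real.mul_rpow (Nat.cast_nonneg _)]
    · ring
    · exact_mod_cast FractionalIdeal.absNorm_nonneg _
  · positivity

noncomputable def wX (J : (FractionalIdeal (𝓞 K)⁰ K)ˣ)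
    (y : InfinitePlace K → ℝ) : ℝ := wS y / 2 + Real.log (covI J)

theorem wX_dual (J : (FractionalIdeal (𝓞 K)⁰ K)ˣ)
    (y : InfinitePlace K → ℝ) : wX (dualI J) (-y) = - wX J y := by
  rw [wX, wX, wS_neg, covI_dual, Real.log_inv]; ring

theorem wX_measurable (J : (FractionalIdeal (𝓞 K)⁰ K)ˣ) :
    Measurable (wX J) := by
  have := (wS_continuous (K := K)).measurable
  unfold wX; fun_prop

theorem ofReal_thetaI (J : (FractionalIdeal (𝓞 K)⁰ K)ˣ)
    (y : InfinitePlace K → ℝ) : ENNReal.ofReal (thetaI J.1 y) = 1 + theta0 J.1 y := by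
  rw [thetaI, ENNReal.ofReal_tsum_of_nonneg (fun x => (thetaTerm_pos _ _).le) (theta_ideal J y).1, theta0]
  have e1 := tsum_subtype {x : K | x ∈ J.1} (fun x => ENNReal.ofReal (thetaTerm y x))
  have e2 := tsum_subtype {x : K | x ∈ J.1 ∧ x ≠ 0} (fun x => ENNReal.ofReal (thetaTerm y x))
  have e3 := tsum_subtype {(0 : K)} (fun x => ENNReal.ofReal (thetaTerm y x))
  have e4 : ∑' x : ({(0 : K)} : Set K), ENNReal.ofReal (thetaTerm y (x : K)) = 1 := by
    rw [tsum_singleton (0 : K) (fun x => ENNReal.ofReal (thetaTerm y x))]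
    simp [thetaTerm]
  refine e1.trans ?_
  rw [← e4]
  refine Eq.trans ?_ (congrArg₂ (· + ·) e3.symm e2.symm)
  rw [← ENNReal.tsum_add]
  refine tsum_congr fun x => ?_
  by_cases hx : x = 0
  · subst hx; simp [Set.indicator, J.1.zero_mem]
  · by_cases hJ : x ∈ J.1
    · have : x ∈ (J.1 : Submodule (𝓞 K) K) := hJ
      simp [Set.indicator, hx, hJ, this]
    · have : x ∉ (J.1 : Submodule (𝓞 K) K) := hJ
      simp [Set.indicator, hx, hJ, this]

theorem theta0_func (J : (FractionalIdeal (𝓞 K)⁰ K)ˣ)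
    (y : InfinitePlace K → ℝ) (hy : wX J y ≤ 0) :
    theta0 J.1 y = ENNReal.ofReal (Real.exp (-wX J y)) * theta0 (dualI J).1 (-y)
      + ENNReal.ofReal (Real.exp (-wX J y) - 1) := by
  have h1 := (theta_ideal J y).2
  have h2 : (covI J)⁻¹ * Real.exp (-wS y / 2) = Real.exp (-wX J y) := by
    rw [wX, neg_add, Real.exp_add, ← Real.log_inv, Real.exp_log (inv_pos.mpr (covI_pos J)), mul_comm]
    congr 2; ring
  rw [h2] at h1
  have h3 := congrArg ENNReal.ofReal h1
  rw [ENNReal.ofReal_mul (Real.exp_pos _).le, ofReal_thetaI, ofReal_thetaI] at h3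
  have h4 : ENNReal.ofReal (Real.exp (-wX J y)) = ENNReal.ofReal (Real.exp (-wX J y) - 1) + 1 := by
    rw [← ENNReal.ofReal_one, ← ENNReal.ofReal_add]
    · simp
    · have := Real.one_le_exp (x := -wX J y) (by linarith)
      linarith
    · norm_num
  rw [mul_add, mul_one] at h3
  have h5 : 1 + theta0 J.1 y = 1 + (ENNReal.ofReal (Real.exp (-wX J y)) * theta0 (dualI J).1 (-y)
      + ENNReal.ofReal (Real.exp (-wX J y) - 1)) := by
    rw [h3]
    nth_rw 1 [h4]
    ring
  exact (ENNReal.add_right_inj ENNReal.one_ne_top).mp h5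

theorem tot_eq (J : (FractionalIdeal (𝓞 K)⁰ K)ˣ)
    {ψ : (InfinitePlace K → ℝ) → ℝ≥0∞} (hψ : IsWt K ψ) {σ : ℝ} (hσ : 0 < σ) :
    ∫⁻ y, ψ y * theta0 J.1 y * ENNReal.ofReal (Real.exp (σ * wX J y)) =
      ENNReal.ofReal (gamR K σ * |(discr K : ℝ)| ^ (σ / 2)) * zcl (ClassGroup.mk K J)⁻¹ σ := by
  have hc := covI_pos J
  have h1 : ∀ y, ψ y * theta0 J.1 y * ENNReal.ofReal (Real.exp (σ * wX J y)) =
     ENNReal.ofReal (covI J ^ σ) *  (ψ y * theta0 J.1 y * ENNReal.ofReal (Real.exp (σ / 2 * wS y))) := by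
    intro y
    have : Real.exp (σ * wX J y) = covI J ^ σ * Real.exp (σ / 2 * wS y) := by
      rw [Real.rpow_def_of_pos hc, ← Real.exp_add, wX]; congr 1; ring
    rw [this, ENNReal.ofReal_mul (by positivity)]; ring
  rw [lintegral_congr h1, lintegral_const_mul', mellin_theta J hψ hσ, ← mul_assoc, ← ENNReal.ofReal_mul (by positivity)]
  · congr 2
    have hN : (0 : ℝ) < ((FractionalIdeal.absNorm J.1 : ℚ) : ℝ) := by
      have h1 : FractionalIdeal.absNorm J.1 ≠ 0 := by
        rw [ne_eq, FractionalIdeal.absNorm_eq_zero_iff]; exact J.ne_zero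
      have h2 := FractionalIdeal.absNorm_nonneg J.1
      exact_mod_cast lt_of_le_of_ne h2 (Ne.symm h1)
    rw [covI, Real.mul_rpow (Real.sqrt_nonneg _) hN.le, Real.sqrt_eq_rpow, ← Real.rpow_mul (abs_nonneg _),
      Real.rpow_neg hN.le]
    have := (Real.rpow_pos_of_pos hN σ).ne'
    field_simp
  · simp

theorem split_J (J : (FractionalIdeal (𝓞 K)⁰ K)ˣ)
    {ψ : (InfinitePlace K → ℝ) → ℝ≥0∞} (hψ : IsWt K ψ) (σ : ℝ) :
    ∫⁻ y, ψ y * theta0 J.1 y * ENNReal.ofReal (Real.exp (σ * wX J y)) =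
      (∫⁻ y in {y | 0 < wX J y}, ψ y * theta0 J.1 y * ENNReal.ofReal (Real.exp (σ * wX J y))) +
      ((∫⁻ y in {y | 0 ≤ wX (dualI J) y}, ψ (-y) * theta0 (dualI J).1 y *
          ENNReal.ofReal (Real.exp ((1 - σ) * wX (dualI J) y))) +
       ∫⁻ y in {y | wX J y ≤ 0}, ψ y * ENNReal.ofReal (Real.exp ((σ - 1) * wX J y) - Real.exp (σ * wX J y))) := by
  have hm := wX_measurable J
  have hms : MeasurableSet {y | 0 < wX J y} := measurableSet_lt measurable_const hm
  have hms2 : MeasurableSet {y | wX J y ≤ 0} := measurableSet_le hm measurable_const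
  have hms3 : MeasurableSet {y | 0 ≤ wX (dualI J) y} := measurableSet_le measurable_const (wX_measurable _)
  rw [← lintegral_add_compl _ hms]
  congr 1
  have hc : {y | 0 < wX J y}ᶜ = {y | wX J y ≤ 0} := by ext; simp
  have h1 : ∫⁻ y in {y | 0 ≤ wX (dualI J) y}, ψ (-y) * theta0 (dualI J).1 y *
          ENNReal.ofReal (Real.exp ((1 - σ) * wX (dualI J) y)) =
      ∫⁻ y in {y | wX J y ≤ 0}, ψ y * theta0 (dualI J).1 (-y) *
          ENNReal.ofReal (Real.exp ((σ - 1) * wX J y)) := by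
    rw [← lintegral_indicator hms3, ← lintegral_indicator hms2, ← lintegral_neg_eq_self]
    refine lintegral_congr fun y => ?_
    simp only [Set.indicator, Set.mem_ofPred_eq, wX_dual, neg_nonneg, neg_neg]
    congr 4
    ring
  rw [hc, h1, ← lintegral_add_left]
  · refine setLIntegral_congr_fun hms2 fun y hy => ?_
    rw [theta0_func J y hy, mul_add, add_mul, mul_assoc (ψ y) (ENNReal.ofReal _),
      mul_comm (ENNReal.ofReal _) (theta0 _ _), ← mul_assoc, mul_assoc _ (ENNReal.ofReal _), ← ENNReal.ofReal_mul (Real.exp_pos _).le,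
      ← ENNReal.ofReal_mul' (Real.exp_pos _).le, ← Real.exp_add, sub_mul, ← Real.exp_add]
    congr 4
    · ring
    · congr 2; ring
    · ring
  · have h1 := hψ.1
    have h2 := (theta0_measurable (dualI J).1).comp (measurable_neg (G := InfinitePlace K → ℝ))
    exact (h1.mul h2).mul (by fun_prop)

theorem wt_push (J : (FractionalIdeal (𝓞 K)⁰ K)ˣ)
    {ψ : (InfinitePlace K → ℝ) → ℝ≥0∞} (hψ : IsWt K ψ)
    (hfin : ∫⁻ y in {y | wX J y ≤ 0}, ψ y * ENNReal.ofReal (Real.exp ((2 - 1) * wX J y) - Real.exp (2 * wX J y)) ≠ ⊤) :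
    ∃ V : ℝ, 0 ≤ V ∧ ∀ σ : ℝ, 1 < σ →
      ∫⁻ y in {y | wX J y ≤ 0}, ψ y * ENNReal.ofReal (Real.exp ((σ - 1) * wX J y) - Real.exp (σ * wX J y)) =
        ENNReal.ofReal (V * (1 / (σ - 1) - 1 / σ)) := by
  have hm := wX_measurable J
  set ν : Measure ℝ := (volume.withDensity ψ).map (wX J) with hν
  have hconv : ∀ g : ℝ → ℝ≥0∞, Measurable g → ∫⁻ y in {y | wX J y ≤ 0}, ψ y * g (wX J y) = ∫⁻ t in Set.Iic 0, g t ∂ν := by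
    intro g hg
    rw [hν, setLIntegral_map measurableSet_Iic hg hm]
    exact (setLIntegral_withDensity_eq_setLIntegral_mul _ hψ.1 (hg.comp hm) (hm measurableSet_Iic)).symm
  have hn : (0 : ℝ) < Module.finrank ℚ K := by exact_mod_cast Module.finrank_pos
  have hinv : ν.IsAddLeftInvariant := by
    refine ⟨fun a => ?_⟩
    have hadd : ∀ y, a + wX J y = wX J (y + fun _ => 2 * a / Module.finrank ℚ K) := by
      intro y
      rw [wX, wX, wS_add, wS_const]; field_simp; ring
    ext s hs
    rw [hν, Measure.map_map (measurable_const_add a) hm]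
    rw [Measure.map_apply ((measurable_const_add a).comp hm) hs, Measure.map_apply hm hs,
      withDensity_apply _ (((measurable_const_add a).comp hm) hs), withDensity_apply _ (hm hs),
      ← lintegral_indicator (((measurable_const_add a).comp hm) hs), ← lintegral_indicator (hm hs),
      ← lintegral_add_right_eq_self ((wX J ⁻¹' s).indicator _) (fun _ => 2 * a / Module.finrank ℚ K)]
    refine lintegral_congr fun y => ?_
    simp only [Set.indicator, hψ.2.2]
    congr 1
    simp only [Set.mem_preimage, Function.comp_apply, hadd]
  have hfin2 : ν (Set.Ioo (-2) (-1)) ≠ ⊤ := by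
    rw [hconv (fun t => ENNReal.ofReal (Real.exp ((2 - 1) * t) - Real.exp (2 * t))) (by fun_prop)] at hfin
    have hk : ∀ t ∈ Set.Ioo (-2 : ℝ) (-1), Real.exp (-4) ≤ Real.exp ((2 - 1) * t) - Real.exp (2 * t) := by
      intro t ht
      have e1 : Real.exp (2 * t) = Real.exp t * Real.exp t := by rw [← Real.exp_add]; congr 1; ring
      have e2 : Real.exp (-4) = Real.exp (-2) * Real.exp (-2) := by rw [← Real.exp_add]; congr 1; norm_num
      have e3 : Real.exp (-2) ≤ Real.exp t := Real.exp_le_exp.mpr ht.1.le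
      have e4 : Real.exp t ≤ Real.exp (-1) := Real.exp_le_exp.mpr ht.2.le
      have e5 : Real.exp (-2) = Real.exp (-1) * Real.exp (-1) := by rw [← Real.exp_add]; congr 1; norm_num
      have e6 : Real.exp (-1) ≤ 1 / 2 := by
        rw [Real.exp_neg, inv_le_comm₀ (Real.exp_pos _) (by norm_num)]
        have := Real.add_one_le_exp (1 : ℝ)
        norm_num at this ⊢; linarith
      have e7 := Real.exp_pos (-2)
      have e8 := Real.exp_pos (-1)
      rw [show (2 - 1) * t = t by ring, e1, e2]
      nlinarith
    have h2 : ENNReal.ofReal (Real.exp (-4)) * ν (Set.Ioo (-2) (-1)) ≤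
        ∫⁻ t in Set.Iic 0, ENNReal.ofReal (Real.exp ((2 - 1) * t) - Real.exp (2 * t)) ∂ν := by
      rw [← setLIntegral_const]
      refine (setLIntegral_mono' measurableSet_Ioo fun t ht => ENNReal.ofReal_le_ofReal (hk t ht)).trans ?_
      exact lintegral_mono_set fun t ht => by simp at ht ⊢; linarith
    have h3 := ne_top_of_le_ne_top hfin h2
    intro h4
    rw [h4, ENNReal.mul_top] at h3
    · exact h3 rfl
    · simp [Real.exp_pos]
  have hfc : IsFiniteMeasureOnCompacts ν := ⟨fun k hk =>
    measure_lt_top_of_isCompact_of_isAddLeftInvariant (Set.Ioo (-2) (-1)) isOpen_Ioo ⟨-3/2, by norm_num⟩ hfin2 hk⟩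
  obtain ⟨V, hV⟩ : ∃ V : NNReal, ν = V • (volume : Measure ℝ) := ⟨_, Measure.isAddLeftInvariant_eq_smul ν volume⟩
  refine ⟨V, V.2, fun σ hσ => ?_⟩
  rw [hconv (fun t => ENNReal.ofReal (Real.exp ((σ - 1) * t) - Real.exp (σ * t))) (by fun_prop), hV,
    Measure.restrict_smul, lintegral_smul_measure, ENNReal.ofReal_mul V.coe_nonneg]
  have i1 := integrableOn_exp_mul_Iic (a := σ - 1) (by linarith) 0
  have i2 := integrableOn_exp_mul_Iic (a := σ) (by linarith) 0
  have i3 := ofReal_integral_eq_lintegral_ofReal (i1.sub i2) (μ := volume.restrict (Set.Iic 0)) ?_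
  · simp only [Pi.sub_apply] at i3
    rw [← i3, integral_sub i1 i2, integral_exp_mul_Iic (by linarith), integral_exp_mul_Iic (by linarith)]
    simp
    rfl
  · refine (ae_restrict_iff' measurableSet_Iic).mpr (Filter.Eventually.of_forall fun t ht => ?_)
    have : (t : ℝ) ≤ 0 := ht
    have h2 : Real.exp (σ * t) ≤ Real.exp ((σ - 1) * t) := Real.exp_le_exp.mpr (by nlinarith)
    exact sub_nonneg.mpr h2

theorem mgf_entire {Ω : Type*} [MeasurableSpace Ω] (μ : Measure Ω) {X : Ω → ℝ} (hX : Measurable X)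
    (h0 : ∀ᵐ ω ∂μ, 0 ≤ X ω) (hfin : ∀ σ : ℝ, 1 < σ → ∫⁻ ω, ENNReal.ofReal (Real.exp (σ * X ω)) ∂μ ≠ ⊤) :
    Differentiable ℂ (ProbabilityTheory.complexMGF X μ) ∧
    (∀ t : ℝ, ENNReal.ofReal (ProbabilityTheory.mgf X μ t) = ∫⁻ ω, ENNReal.ofReal (Real.exp (t * X ω)) ∂μ) ∧
    (∀ s : ℂ, ∀ σ : ℝ, s.re ≤ σ → ‖ProbabilityTheory.complexMGF X μ s‖ ≤ ProbabilityTheory.mgf X μ σ) := by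
  have hle : ∀ a b : ℝ, a ≤ b → ∀ᵐ ω ∂μ, Real.exp (a * X ω) ≤ Real.exp (b * X ω) := by
    intro a b hab
    filter_upwards [h0] with ω hω
    exact Real.exp_le_exp.mpr (mul_le_mul_of_nonneg_right hab hω)
  have hint : ∀ t : ℝ, Integrable (fun ω => Real.exp (t * X ω)) μ := by
    intro t
    refine ⟨by fun_prop, ?_⟩
    rw [hasFiniteIntegral_iff_ofReal (Filter.Eventually.of_forall fun ω => (Real.exp_pos _).le)]
    refine lt_of_le_of_lt (lintegral_mono_ae ?_) (hfin (max t 2) (lt_of_lt_of_le (by norm_num) (le_max_right t 2))).lt_top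
    filter_upwards [hle t _ (le_max_left t 2)] with ω hω
    exact ENNReal.ofReal_le_ofReal hω
  have hset : ProbabilityTheory.integrableExpSet X μ = Set.univ := Set.eq_univ_of_forall hint
  refine ⟨fun z => ?_, fun t => ?_, fun s σ hs => ?_⟩
  · exact (ProbabilityTheory.hasDerivAt_complexMGF (by rw [hset]; simp)).differentiableAt
  · rw [ProbabilityTheory.mgf, ofReal_integral_eq_lintegral_ofReal (hint t)]
    exact Filter.Eventually.of_forall fun ω => (Real.exp_pos _).le
  · refine ProbabilityTheory.norm_complexMGF_le_mgf.trans ?_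
    exact integral_mono_ae (hint _) (hint _) (hle _ _ hs)

theorem gamR_pos (K : Type*) [Field K] [NumberField K] {σ : ℝ} (hσ : 0 < σ) : 0 < gamR K σ := by
  unfold gamR
  refine Finset.prod_pos fun w _ => ?_
  have : (0 : ℝ) < w.mult := by exact_mod_cast InfinitePlace.mult_pos
  have := Real.pi_pos
  have : 0 < Real.Gamma (w.mult * σ / 2) := Real.Gamma_pos_of_pos (by positivity)
  positivity

noncomputable def gamD (K : Type*) [Field K] [NumberField K] (σ : ℝ) : ℝ := gamR K σ * |(discr K : ℝ)| ^ (σ / 2)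

theorem gamD_pos (K : Type*) [Field K] [NumberField K] {σ : ℝ} (hσ : 0 < σ) : 0 < gamD K σ := by
  have h1 : (discr K : ℝ) ≠ 0 := by exact_mod_cast NumberField.discr_ne_zero K
  have := gamR_pos K hσ
  unfold gamD; positivity

theorem hecke_J (hz : ∀ (c : ClassGroup (𝓞 K)) (σ : ℝ), 1 < σ → zcl c σ ≠ ⊤)
    (J : (FractionalIdeal (𝓞 K)⁰ K)ˣ) :
    ∃ (B B' : ℂ → ℂ) (V : ℝ), Differentiable ℂ B ∧ Differentiable ℂ B' ∧ 0 ≤ V ∧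
      (∀ σ : ℝ, 1 < σ → (gamD K σ * (zcl (ClassGroup.mk K J)⁻¹ σ).toReal : ℂ) =
        B σ + B' (1 - σ) + V * (1 / (σ - 1) - 1 / σ)) ∧
      (∀ σ : ℝ, 1 < σ → V * (1 / (σ - 1) - 1 / σ) ≤ gamD K σ * (zcl (ClassGroup.mk K J)⁻¹ σ).toReal) ∧
      (∀ (s : ℂ) (σ : ℝ), 1 < σ → s.re ≤ σ → ‖B s‖ ≤ gamD K σ * (zcl (ClassGroup.mk K J)⁻¹ σ).toReal) ∧
      (∀ (s : ℂ) (σ : ℝ), 1 < σ → s.re ≤ σ → ‖B' s‖ ≤ gamD K σ * (zcl (ClassGroup.mk K (dualI J))⁻¹ σ).toReal) := by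
  obtain ⟨ψ, hψ⟩ := exists_wt K
  have htop : ∀ (J : (FractionalIdeal (𝓞 K)⁰ K)ˣ) {ψ : (InfinitePlace K → ℝ) → ℝ≥0∞} (_ : IsWt K ψ) {σ : ℝ}, 1 < σ →
     ∫⁻ y, ψ y * theta0 J.1 y * ENNReal.ofReal (Real.exp (σ * wX J y)) ≠ ⊤ := by
    intro J ψ hψ σ hσ
    rw [tot_eq J hψ (by linarith)]
    exact ENNReal.mul_ne_top ENNReal.ofReal_ne_top (hz _ _ hσ)
  have htr : ∀ (J : (FractionalIdeal (𝓞 K)⁰ K)ˣ) {ψ : (InfinitePlace K → ℝ) → ℝ≥0∞} (_ : IsWt K ψ) {σ : ℝ}, 1 < σ →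
     ∫⁻ y, ψ y * theta0 J.1 y * ENNReal.ofReal (Real.exp (σ * wX J y)) =
       ENNReal.ofReal (gamD K σ * (zcl (ClassGroup.mk K J)⁻¹ σ).toReal) := by
    intro J ψ hψ σ hσ
    rw [tot_eq J hψ (by linarith), gamD, ENNReal.ofReal_mul (p := _ * _) (gamD_pos K (by linarith)).le, ENNReal.ofReal_toReal (hz _ _ hσ)]
  have key : ∀ (J : (FractionalIdeal (𝓞 K)⁰ K)ˣ) {ψ : (InfinitePlace K → ℝ) → ℝ≥0∞} (_ : IsWt K ψ)
      (s : Set (InfinitePlace K → ℝ)) (_ : MeasurableSet s) (_ : ∀ y ∈ s, 0 ≤ wX J y),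
      ∃ (B : ℂ → ℂ) (b : ℝ → ℝ), Differentiable ℂ B ∧ (∀ t : ℝ, B t = b t ∧ 0 ≤ b t ∧
        ∫⁻ y in s, ψ y * theta0 J.1 y * ENNReal.ofReal (Real.exp (t * wX J y)) = ENNReal.ofReal (b t)) ∧
        ∀ (s : ℂ) (σ : ℝ), 1 < σ → s.re ≤ σ → ‖B s‖ ≤ gamD K σ * (zcl (ClassGroup.mk K J)⁻¹ σ).toReal := by
    intro J ψ hψ s hs hs0
    set f : (InfinitePlace K → ℝ) → ℝ≥0∞ := fun y => ψ y * theta0 J.1 y with hf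
    have hfm : Measurable f := hψ.1.mul (theta0_measurable _)
    have hm := wX_measurable J
    set μ := (volume.withDensity f).restrict s with hμ
    have e1 : ∀ t : ℝ, ∫⁻ y, ENNReal.ofReal (Real.exp (t * wX J y)) ∂μ =
        ∫⁻ y in s, ψ y * theta0 J.1 y * ENNReal.ofReal (Real.exp (t * wX J y)) := by
      intro t
      exact setLIntegral_withDensity_eq_setLIntegral_mul _ hfm (by fun_prop) hs
    have e2 : ∀ t : ℝ, ∫⁻ y, ENNReal.ofReal (Real.exp (t * wX J y)) ∂μ ≤
        ∫⁻ y, ψ y * theta0 J.1 y * ENNReal.ofReal (Real.exp (t * wX J y)) := by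
      intro t
      rw [e1]; exact setLIntegral_le_lintegral _ _
    obtain ⟨h1, h2, h3⟩ := mgf_entire μ hm ((ae_restrict_iff' hs).mpr (Filter.Eventually.of_forall hs0))
      (fun σ hσ => ne_top_of_le_ne_top (htop J hψ hσ) (e2 σ))
    refine ⟨_, ProbabilityTheory.mgf (wX J) μ, h1, fun t => ⟨?_, ProbabilityTheory.mgf_nonneg, ?_⟩, fun z σ hσ hz => ?_⟩
    · exact ProbabilityTheory.complexMGF_ofReal t
    · rw [h2, e1]
    · refine (h3 z σ hz).trans ?_
      rw [← ENNReal.ofReal_le_ofReal_iff, h2, ← htr J hψ hσ]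
      · exact e2 σ
      · have := (gamD_pos K (σ := σ) (by linarith)).le
        positivity
  obtain ⟨B, b, hB1, hB2, hB3⟩ := key J hψ {y | 0 < wX J y} (measurableSet_lt measurable_const (wX_measurable J)) (fun y hy => le_of_lt hy)
  obtain ⟨B', b', hB1', hB2', hB3'⟩ := key (dualI J) hψ.neg {y | 0 ≤ wX (dualI J) y}
    (measurableSet_le measurable_const (wX_measurable _)) (fun y hy => hy)
  obtain ⟨V, hV0, hV⟩ := wt_push J hψ (by
    have := htop J hψ (σ := 2) (by norm_num)
    rw [split_J J hψ 2] at this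
    exact (ENNReal.add_ne_top.mp (ENNReal.add_ne_top.mp this).2).2)
  have hmain : ∀ σ : ℝ, 1 < σ → gamD K σ * (zcl (ClassGroup.mk K J)⁻¹ σ).toReal =
        b σ + b' (1 - σ) + V * (1 / (σ - 1) - 1 / σ) := by
    intro σ hσ
    have h1 := htr J hψ hσ
    have hp : 0 ≤ V * (1 / (σ - 1) - 1 / σ) := by
      refine mul_nonneg hV0 (sub_nonneg.mpr (one_div_le_one_div_of_le (by linarith) (by linarith)))
    have := (gamD_pos K (σ := σ) (by linarith)).le
    rw [split_J J hψ, hV σ hσ, (hB2 σ).2.2, (hB2' (1 - σ)).2.2, ← ENNReal.ofReal_add (hB2' _).2.1 hp,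
      ← ENNReal.ofReal_add (hB2 _).2.1 (add_nonneg (hB2' _).2.1 hp),
      ENNReal.ofReal_eq_ofReal_iff (add_nonneg (hB2 _).2.1 (add_nonneg (hB2' _).2.1 hp)) (by positivity)] at h1
    rw [← h1]; ring
  refine ⟨B, B', V, hB1, hB1', hV0, fun σ hσ => ?_, fun σ hσ => ?_, hB3, hB3'⟩
  · have := hmain σ hσ
    have h2 := (hB2' (1 - σ)).1
    push_cast at h2
    rw [h2, (hB2 σ).1]
    exact_mod_cast congrArg ((↑) : ℝ → ℂ) this
  · rw [hmain σ hσ]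
    have := (hB2 σ).2.1
    have := (hB2' (1 - σ)).2.1
    linarith

end

section

open MeasureTheory NumberField nonZeroDivisors Filter Topology
open scoped ENNReal
variable {K : Type*} [Field K] [NumberField K]

theorem tsum_fiber {α β : Type*} (N : α → β) (g : α → ℝ≥0∞) :
    ∑' a, g a = ∑' m, ∑' a : {a // N a = m}, g a := by
  rw [← (Equiv.sigmaFiberEquiv N).tsum_eq, ENNReal.tsum_sigma']
  rfl

abbrev NzI (K : Type*) [Field K] [NumberField K] := {I : Ideal (𝓞 K) // I ≠ ⊥}

noncomputable def nzN (I : NzI K) : ℕ := Ideal.absNorm I.1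

theorem nzN_pos (I : NzI K) : 0 < nzN I :=
  Nat.pos_of_ne_zero (by rw [nzN, ne_eq, Ideal.absNorm_eq_zero_iff]; exact I.2)

theorem nzN_fin (m : ℕ) : Finite {I : NzI K // nzN I = m} := by
  have := (Ideal.finite_setOfPred_absNorm_eq (S := 𝓞 K) m).to_subtype
  exact Finite.of_injective (β := {I : Ideal (𝓞 K) | Ideal.absNorm I = m}) (fun I => ⟨I.1.1, I.2⟩)
    (fun I J h => Subtype.ext (Subtype.ext (Subtype.mk_eq_mk.mp h)))

noncomputable def rK (K : Type*) [Field K] [NumberField K] (m : ℕ) : ℕ := Nat.card {I : NzI K // nzN I = m}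

theorem rK_eq {m : ℕ} (hm : m ≠ 0) :
    rK K m = Nat.card {I : Ideal (𝓞 K) // Ideal.absNorm I = m} := by
  refine Nat.card_congr ⟨fun I => ⟨I.1.1, I.2⟩, fun I => ⟨⟨I.1, ?_⟩, I.2⟩, fun _ => rfl, fun _ => rfl⟩
  rintro h
  apply hm; rw [← I.2, h]; simp

theorem rK_zero : rK K 0 = 0 := by
  have : IsEmpty {I : NzI K // nzN I = 0} := ⟨fun I => (nzN_pos I.1).ne' I.2⟩
  simp [rK]

theorem tsum_nzI (h : ℕ → ℝ≥0∞) :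
    ∑' I : NzI K, h (nzN I) = ∑' m, (rK K m : ℝ≥0∞) * h m := by
  rw [tsum_fiber nzN]
  refine tsum_congr fun m => ?_
  have := nzN_fin (K := K) m
  have := Fintype.ofFinite {I : NzI K // nzN I = m}
  have h1 : ∀ I : {I : NzI K // nzN I = m}, h (nzN I.1) = h m := fun I => by rw [I.2]
  rw [tsum_congr h1, tsum_fintype, Finset.sum_const, rK, Nat.card_eq_fintype_card]
  simp

theorem rK_bigO (K : Type*) [Field K] [NumberField K] {s : ℂ} (hs : 1 < s.re) :
    LSeriesSummable (fun n => ((rK K n : ℝ) : ℂ)) s := by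
  refine LSeriesSummable_of_sum_norm_bigO_and_nonneg (r := 1) ?_ (fun n => Nat.cast_nonneg _) zero_le_one hs
  have h1 := (Ideal.tendsto_norm_le_div_atTop₀ K).comp tendsto_natCast_atTop_atTop
  have h2 := h1.isBigO_one ℝ
  have h3 : (fun n : ℕ => ((∑ k ∈ Finset.Icc 1 n, (rK K k : ℝ)) : ℝ) / n) =O[atTop] (fun _ => (1 : ℝ)) := by
    refine h2.congr' (Eventually.of_forall fun n => ?_) EventuallyEq.rfl
    simp only [Function.comp_apply, Nat.cast_le]
    congr 1
    rw [← Nat.cast_sum]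
    congr 1
    rw [Finset.sum_congr rfl (fun k hk => rK_eq (K := K) (m := k) (by simp at hk; omega))]
    rw [← add_left_inj 1, ← Ideal.card_norm_le_eq_card_norm_le_add_one,
      show Finset.Icc 1 n = Finset.Ioc 0 n from Finset.Icc_succ_left_eq_Ioc _ _,
      show 1 = Nat.card {I : Ideal (𝓞 K) // Ideal.absNorm I = 0} by simp [Ideal.absNorm_eq_zero_iff],
      Finset.sum_Ioc_add_eq_sum_Icc (n.zero_le),
      ← Finset.card_preimage_eq_sum_card_image_eq (fun k _ ↦ Ideal.finite_setOfPred_absNorm_eq k)]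
    simp [Set.coe_eq_subtype]
  have h4 := h3.mul (Asymptotics.isBigO_refl (fun n : ℕ => (n : ℝ)) atTop)
  refine h4.congr' ?_ ?_
  · filter_upwards [eventually_ne_atTop 0] with n hn
    have : (n : ℝ) ≠ 0 := by exact_mod_cast hn
    field_simp
  · exact Eventually.of_forall fun n => by simp

noncomputable def zK (K : Type*) [Field K] [NumberField K] (s : ℂ) : ℂ := LSeries (fun n => ((rK K n : ℝ) : ℂ)) s

theorem zK_eq_dedekind (K : Type*) [Field K] [NumberField K] (s : ℂ) : zK K s = NumberField.dedekindZeta K s := by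
  refine LSeries_congr (fun {m} hm => ?_) s
  rw [rK_eq hm]; simp

theorem zK_ofReal {σ : ℝ} (hσ : 1 < σ) :
    Summable (fun n : ℕ => (rK K n : ℝ) * (n : ℝ) ^ (-σ)) ∧ zK K σ = ((∑' n : ℕ, (rK K n : ℝ) * (n : ℝ) ^ (-σ) : ℝ) : ℂ) := by
  have h1 := rK_bigO K (s := σ) (by simpa using hσ)
  have h2 : LSeries.term (fun n => ((rK K n : ℝ) : ℂ)) σ = fun n : ℕ => (((rK K n : ℝ) * (n : ℝ) ^ (-σ) : ℝ) : ℂ) := by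
    ext n
    rcases eq_or_ne n 0 with rfl | hn
    · simp [rK_zero]
    · rw [LSeries.term_of_ne_zero hn, Real.rpow_neg (Nat.cast_nonneg _), Complex.ofReal_mul, Complex.ofReal_inv,
        Complex.ofReal_cpow (Nat.cast_nonneg _)]
      simp [div_eq_mul_inv]
  constructor
  · rw [LSeriesSummable, h2] at h1
    exact_mod_cast h1
  · rw [zK, LSeries, h2, Complex.ofReal_tsum]

theorem nzI_sum {σ : ℝ} (hσ : 1 < σ) :
    ∑' I : NzI K, ENNReal.ofReal ((nzN I : ℝ) ^ (-σ)) = ENNReal.ofReal (∑' n : ℕ, (rK K n : ℝ) * (n : ℝ) ^ (-σ)) := by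
  rw [tsum_nzI (fun m => ENNReal.ofReal ((m : ℝ) ^ (-σ))),
    ENNReal.ofReal_tsum_of_nonneg (fun n => by positivity) (zK_ofReal hσ).1]
  refine tsum_congr fun m => ?_
  rw [ENNReal.ofReal_mul (Nat.cast_nonneg _)]; simp

theorem zK_eq_tsum {s : ℂ} (hs : 1 < s.re) :
    zK K s = ∑' I : NzI K, (Ideal.absNorm I.1 : ℂ) ^ (-s) := by
  have hn : ∀ I : NzI K, ‖(nzN I : ℂ) ^ (-s)‖ = (nzN I : ℝ) ^ (-s.re) := fun I => by
    rw [Complex.norm_natCast_cpow_of_pos (nzN_pos I)]; simp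
  have hsum : Summable (fun I : NzI K => (nzN I : ℂ) ^ (-s)) := by
    rw [← summable_norm_iff]
    simp_rw [hn]
    have := nzI_sum (K := K) hs
    have h2 : ∑' I : NzI K, ENNReal.ofReal ((nzN I : ℝ) ^ (-s.re)) ≠ ⊤ := by rw [this]; exact ENNReal.ofReal_ne_top
    refine (ENNReal.summable_toReal h2).congr fun I => ?_
    rw [ENNReal.toReal_ofReal (by positivity)]
  change _ = ∑' I : NzI K, (nzN I : ℂ) ^ (-s)
  rw [← (Equiv.sigmaFiberEquiv (nzN (K := K))).tsum_eq]
  refine Eq.trans ?_ ((Equiv.sigmaFiberEquiv (nzN (K := K))).summable_iff.mpr hsum).tsum_sigma.symm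
  refine tsum_congr fun m => ?_
  have := nzN_fin (K := K) m
  have := Fintype.ofFinite {I : NzI K // nzN I = m}
  have h1 : ∀ I : {I : NzI K // nzN I = m}, (nzN ((Equiv.sigmaFiberEquiv (nzN (K := K))) ⟨m, I⟩) : ℂ) ^ (-s) = (m : ℂ) ^ (-s) :=
    fun I => by simp [Equiv.sigmaFiberEquiv, I.2]
  refine Eq.trans ?_ (tsum_congr h1).symm
  rw [tsum_fintype, Finset.sum_const, Finset.card_univ, ← Nat.card_eq_fintype_card]
  rcases eq_or_ne m 0 with rfl | hm
  · have := rK_zero (K := K)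
    rw [rK] at this
    rw [this]; simp
  · rw [LSeries.term_of_ne_zero hm, Complex.cpow_neg]
    simp [rK, div_eq_mul_inv]

theorem sum_zcl {σ : ℝ} (hσ : 1 < σ) :
    (∀ c : ClassGroup (𝓞 K), zcl c σ ≠ ⊤) ∧
    ∑ c : ClassGroup (𝓞 K), (zcl c σ).toReal = ∑' n : ℕ, (rK K n : ℝ) * (n : ℝ) ^ (-σ) := by
  have h1 : ∑ c : ClassGroup (𝓞 K), zcl c σ = ∑' I : NzI K, ENNReal.ofReal ((nzN I : ℝ) ^ (-σ)) := by
    let e : (Ideal (𝓞 K))⁰ ≃ NzI K := ⟨fun I => ⟨I.1, nonZeroDivisors.ne_zero I.2⟩,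
      fun I => ⟨I.1, mem_nonZeroDivisors_of_ne_zero I.2⟩, fun _ => rfl, fun _ => rfl⟩
    rw [← e.tsum_eq, tsum_fiber (ClassGroup.mk0 (R := 𝓞 K)), tsum_fintype]
    rfl
  rw [nzI_sum hσ] at h1
  have h2 : ∀ c : ClassGroup (𝓞 K), zcl c σ ≠ ⊤ := by
    intro c
    have h3 : ∑ c : ClassGroup (𝓞 K), zcl c σ ≠ ⊤ := by rw [h1]; exact ENNReal.ofReal_ne_top
    exact (ENNReal.sum_ne_top.mp h3) c (Finset.mem_univ _)
  refine ⟨h2, ?_⟩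
  rw [← ENNReal.toReal_sum (fun c _ => h2 c), h1, ENNReal.toReal_ofReal]
  exact tsum_nonneg fun n => by positivity

abbrev PP (K : Type*) [Field K] [NumberField K] := IsDedekindDomain.HeightOneSpectrum (𝓞 K) × ℕ

noncomputable def ppN (q : PP K) : ℕ := Ideal.absNorm q.1.asIdeal ^ (q.2 + 1)

noncomputable def ppL (q : PP K) : ℝ≥0∞ :=
  ENNReal.ofReal (Real.log (Ideal.absNorm q.1.asIdeal))

open Classical in
theorem log_ideal (I : Ideal (𝓞 K)) : I ≠ 0 →
    ENNReal.ofReal (Real.log (Ideal.absNorm I)) =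
      ∑' q : PP K, if q.1.asIdeal ^ (q.2 + 1) ∣ I then ppL q else 0 := by
  refine UniqueFactorizationMonoid.induction_on_prime I (fun h => absurd rfl h) ?_ ?_
  · intro I hI _
    have hq : ∀ q : PP K, (if q.1.asIdeal ^ (q.2 + 1) ∣ I then ppL q else 0) = 0 := fun q => by
      rw [if_neg]
      intro h
      have h2 : q.1.asIdeal ∣ I := (dvd_pow_self _ (Nat.succ_ne_zero _)).trans h
      exact q.1.prime.not_isUnit (isUnit_of_dvd_unit h2 hI)
    rw [tsum_congr hq, tsum_zero]
    rw [Ideal.isUnit_iff] at hI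
    simp [hI]
  · intro I P hI hP ih _
    have ih := ih hI
    let v0 : IsDedekindDomain.HeightOneSpectrum (𝓞 K) := ⟨P, Ideal.isPrime_of_prime hP, hP.ne_zero⟩
    have hNP : (Ideal.absNorm P : ℝ) ≠ 0 := by
      rw [Nat.cast_ne_zero, ne_eq, Ideal.absNorm_eq_zero_iff]; exact hP.ne_zero
    have hNI : (Ideal.absNorm I : ℝ) ≠ 0 := by
      rw [Nat.cast_ne_zero, ne_eq, Ideal.absNorm_eq_zero_iff]; exact hI
    rw [map_mul, Nat.cast_mul, Real.log_mul hNP hNI,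
      ENNReal.ofReal_add (Real.log_natCast_nonneg _) (Real.log_natCast_nonneg _), ih,
      ENNReal.tsum_prod', ENNReal.tsum_prod',
      show ENNReal.ofReal (Real.log (Ideal.absNorm P)) = ∑' v : IsDedekindDomain.HeightOneSpectrum (𝓞 K),
        (if v = v0 then ENNReal.ofReal (Real.log (Ideal.absNorm P)) else 0) by rw [tsum_ite_eq],
      ← ENNReal.tsum_add]
    refine tsum_congr fun v => ?_
    by_cases hv : v = v0
    · subst hv
      rw [if_pos rfl, tsum_eq_zero_add' (f := fun b => if v0.asIdeal ^ (b + 1) ∣ P * I then ppL (v0, b) else 0) ENNReal.summable]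
      simp only [zero_add, pow_one]
      congr 1
      · rw [if_pos (dvd_mul_right _ _)]; rfl
      · refine tsum_congr fun k => ?_
        congr 1
        rw [pow_succ' _ (k + 1), show v0.asIdeal = P from rfl]
        exact propext (mul_dvd_mul_iff_left hP.ne_zero).symm
    · rw [if_neg hv, zero_add]
      refine tsum_congr fun k => ?_
      congr 1
      refine propext ⟨fun h => h.mul_left _, fun h => v.prime.pow_dvd_of_dvd_mul_left _ ?_ h⟩
      intro h2
      apply hv
      ext1
      exact associated_iff_eq.mp (v.prime.associated_of_dvd hP h2)

open Classical in
theorem log_conv (σ : ℝ) :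
    ∑' I : NzI K, ENNReal.ofReal (Real.log (nzN I)) * ENNReal.ofReal ((nzN I : ℝ) ^ (-σ)) =
      (∑' q : PP K, ppL q * ENNReal.ofReal ((ppN q : ℝ) ^ (-σ))) *
        ∑' I : NzI K, ENNReal.ofReal ((nzN I : ℝ) ^ (-σ)) := by
  have h1 : ∀ I : NzI K, ENNReal.ofReal (Real.log (nzN I)) * ENNReal.ofReal ((nzN I : ℝ) ^ (-σ)) =
      ∑' q : PP K, (if q.1.asIdeal ^ (q.2 + 1) ∣ I.1 then ppL q else 0) * ENNReal.ofReal ((nzN I : ℝ) ^ (-σ)) := by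
    intro I
    rw [ENNReal.tsum_mul_right, nzN, log_ideal I.1 I.2]
  rw [tsum_congr h1, ENNReal.tsum_comm, ← ENNReal.tsum_mul_right]
  refine tsum_congr fun q => ?_
  let D : Ideal (𝓞 K) := q.1.asIdeal ^ (q.2 + 1)
  have hD : D ≠ 0 := pow_ne_zero _ q.1.prime.ne_zero
  let g : NzI K → NzI K := fun J => ⟨D * J.1, mul_ne_zero hD J.2⟩
  have hg : Function.Injective g := fun J J' h => by
    have : D * J.1 = D * J'.1 := congrArg Subtype.val h
    exact Subtype.ext (mul_left_cancel₀ hD this)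
  rw [← hg.tsum_eq, mul_assoc, ← ENNReal.tsum_mul_left, ← ENNReal.tsum_mul_left]
  · refine tsum_congr fun J => ?_
    rw [if_pos (dvd_mul_right _ _), ← ENNReal.ofReal_mul (by positivity),
      ← Real.mul_rpow (Nat.cast_nonneg _) (Nat.cast_nonneg _), ← Nat.cast_mul]
    congr 4
    simp [nzN, ppN, g, D]
  · intro I hI
    by_cases h : D ∣ I.1
    · obtain ⟨J, hJ⟩ := h
      refine ⟨⟨J, ?_⟩, Subtype.ext hJ.symm⟩
      rintro rfl
      exact I.2 (by rw [hJ]; exact mul_zero D)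
    · exact absurd (by simp only [D] at h; simp [h]) hI

theorem ppN_prime (q : PP K) :
    ∃ p f : ℕ, p.Prime ∧ f ≠ 0 ∧ Ideal.absNorm q.1.asIdeal = p ^ f ∧ q.1.asIdeal ∣ Ideal.span {(p : 𝓞 K)} := by
  obtain ⟨v, k⟩ := q
  simp only
  have hv := v.isPrime
  have h1 := Ideal.absNorm_mem v.asIdeal
  have h0 : Ideal.absNorm v.asIdeal ≠ 0 := by rw [ne_eq, Ideal.absNorm_eq_zero_iff]; exact v.ne_bot
  have h3 : ∀ m : ℕ, m ≠ 0 → (m : 𝓞 K) ∈ v.asIdeal → ∃ p : ℕ, p.Prime ∧ (p : 𝓞 K) ∈ v.asIdeal := by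
    intro m
    refine Nat.recOnMul (by simp) (by intro _ h; exact absurd ((Ideal.eq_top_iff_one _).mpr (by simpa using h)) hv.ne_top) ?_ ?_ m
    · intro p hp _ h; exact ⟨p, hp, h⟩
    · intro a b ha hb hab h
      rw [Nat.cast_mul] at h
      rcases hv.mem_or_mem h with h | h
      · exact ha (left_ne_zero_of_mul hab) h
      · exact hb (right_ne_zero_of_mul hab) h
  obtain ⟨p, hp, hpv⟩ := h3 _ h0 h1
  have hdvd : v.asIdeal ∣ Ideal.span {(p : 𝓞 K)} := by
    rw [Ideal.dvd_iff_le, Ideal.span_singleton_le_iff_mem]; exact hpv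
  have h4 := map_dvd Ideal.absNorm hdvd
  rw [Ideal.absNorm_span_natCast] at h4
  obtain ⟨f, -, hf⟩ := (Nat.dvd_prime_pow hp).mp h4
  refine ⟨p, f, hp, ?_, hf, hdvd⟩
  rintro rfl
  rw [pow_zero, Ideal.absNorm_eq_one_iff] at hf
  exact hv.ne_top hf

noncomputable def lamE (K : Type*) [Field K] [NumberField K] (m : ℕ) : ℝ≥0∞ := ∑' q : {q : PP K // ppN q = m}, ppL q.1

theorem lamE_le (m : ℕ) :
    lamE K m ≤ ENNReal.ofReal (Module.finrank ℚ K * ArithmeticFunction.vonMangoldt m) := by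
  classical
  rw [lamE, ENNReal.tsum_eq_iSup_sum]
  refine iSup_le fun s => ?_
  rcases s.eq_empty_or_nonempty with rfl | ⟨q0, hq0⟩
  · simp
  obtain ⟨p, f, hp, hf, hN, -⟩ := ppN_prime q0.1
  have hm : m = p ^ (f * (q0.1.2 + 1)) := q0.2.symm.trans (by rw [ppN, hN, pow_mul])
  have hL : ArithmeticFunction.vonMangoldt m = Real.log p := by
    rw [hm, ArithmeticFunction.vonMangoldt_apply_pow (by positivity), ArithmeticFunction.vonMangoldt_apply_prime hp]
  have hdv : ∀ q : {q : PP K // ppN q = m}, q.1.1.asIdeal ∣ Ideal.span {(p : 𝓞 K)} := by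
    intro q
    obtain ⟨p', f', hp', hf', hN', hd⟩ := ppN_prime q.1
    have hm' : m = p' ^ (f' * (q.1.2 + 1)) := q.2.symm.trans (by rw [ppN, hN', pow_mul])
    have : p = p' := by
      have h1 : p ∣ p' ^ (f' * (q.1.2 + 1)) := by
        rw [← hm', hm]; exact dvd_pow_self _ (by positivity)
      exact (Nat.prime_dvd_prime_iff_eq hp hp').mp (hp.dvd_of_dvd_pow h1)
    rw [this]; exact hd
  have hinj : Set.InjOn (fun q : {q : PP K // ppN q = m} => q.1.1.asIdeal) s := by
    intro q _ q' _ h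
    obtain ⟨p', f', hp', hf', hN', hd⟩ := ppN_prime q.1
    have h1 : q.1.1 = q'.1.1 := by ext1; exact h
    have h2 := q.2.trans q'.2.symm
    rw [ppN, ppN, ← h1] at h2
    have h3 : 2 ≤ Ideal.absNorm q.1.1.asIdeal := by
      rw [hN']; exact hp'.two_le.trans (Nat.le_self_pow hf' _)
    have h4 := Nat.pow_right_injective h3 h2
    exact Subtype.ext (Prod.ext h1 (by omega))
  have hprod : ∏ I ∈ s.image (fun q => q.1.1.asIdeal), I ∣ Ideal.span {(p : 𝓞 K)} := by
    refine Finset.prod_primes_dvd _ ?_ ?_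
    · intro I hI
      obtain ⟨q, -, rfl⟩ := Finset.mem_image.mp hI
      exact q.1.1.prime
    · intro I hI
      obtain ⟨q, -, rfl⟩ := Finset.mem_image.mp hI
      exact hdv q
  rw [Finset.prod_image hinj] at hprod
  have h4 := map_dvd Ideal.absNorm hprod
  rw [Ideal.absNorm_span_natCast, map_prod, RingOfIntegers.rank] at h4
  have h5 := Nat.le_of_dvd (pow_pos hp.pos _) h4
  have h0 : ∀ q : {q : PP K // ppN q = m}, (Ideal.absNorm q.1.1.asIdeal : ℝ) ≠ 0 := fun q => by
    rw [Nat.cast_ne_zero, ne_eq, Ideal.absNorm_eq_zero_iff]; exact q.1.1.ne_bot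
  simp only [ppL]
  rw [← ENNReal.ofReal_sum_of_nonneg (fun _ _ => Real.log_natCast_nonneg _)]
  apply ENNReal.ofReal_le_ofReal
  rw [← Real.log_prod (fun q _ => h0 q), hL, ← Real.log_pow]
  apply Real.log_le_log
  · exact Finset.prod_pos fun q _ => lt_of_le_of_ne (Nat.cast_nonneg _) (h0 q).symm
  · exact_mod_cast h5

noncomputable def lamK (K : Type*) [Field K] [NumberField K] (m : ℕ) : ℝ := (lamE K m).toReal

theorem lamK_nonneg (m : ℕ) : 0 ≤ lamK K m := ENNReal.toReal_nonneg

theorem ofReal_lamK (m : ℕ) : ENNReal.ofReal (lamK K m) = lamE K m :=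
  ENNReal.ofReal_toReal (ne_top_of_le_ne_top ENNReal.ofReal_ne_top (lamE_le m))

theorem lamK_le (m : ℕ) :
    lamK K m ≤ Module.finrank ℚ K * ArithmeticFunction.vonMangoldt m :=
  ENNReal.toReal_le_of_le_ofReal (mul_nonneg (Nat.cast_nonneg _) ArithmeticFunction.vonMangoldt_nonneg) (lamE_le m)

theorem lamK_prime {p : ℕ} (hp : p.Prime) (h : lamK K p ≠ 0) :
    ∃ P : Ideal (𝓞 K), P.IsPrime ∧ Ideal.absNorm P = p := by
  have : Nonempty {q : PP K // ppN q = p} := by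
    by_contra h2
    rw [not_nonempty_iff] at h2
    apply h; simp [lamK, lamE]
  obtain ⟨⟨v, k⟩, hq⟩ := this
  refine ⟨v.asIdeal, v.isPrime, ?_⟩
  rw [ppN] at hq
  have : k + 1 = 1 := by
    by_contra h3
    exact Nat.Prime.not_prime_pow' (n := k + 1) (x := Ideal.absNorm v.asIdeal) h3 (by simpa using hq ▸ hp)
  rw [this, pow_one] at hq
  exact hq

theorem halfplane_open : IsOpen {s : ℂ | 1 < s.re} := isOpen_lt continuous_const Complex.continuous_re

theorem eqOn_half {f g : ℂ → ℂ} (hf : DifferentiableOn ℂ f {s : ℂ | 1 < s.re})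
    (hg : DifferentiableOn ℂ g {s : ℂ | 1 < s.re}) (h : ∀ σ : ℝ, 1 < σ → f σ = g σ) {s : ℂ} (hs : 1 < s.re) :
    f s = g s := by
  refine AnalyticOnNhd.eqOn_of_preconnected_of_frequently_eq (𝕜 := ℂ) (z₀ := 2)
    (hf.analyticOnNhd halfplane_open) (hg.analyticOnNhd halfplane_open)
    (convex_halfSpace_re_gt 1).isPreconnected (by simp) ?_ hs
  have h1 : Tendsto (fun t : ℝ => ((2 + t : ℝ) : ℂ)) (𝓝[>] 0) (𝓝[≠] 2) := by
    refine tendsto_nhdsWithin_iff.mpr ⟨?_, ?_⟩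
    · have : Continuous (fun t : ℝ => ((2 + t : ℝ) : ℂ)) := by fun_prop
      have h2 := this.tendsto 0
      simp only [add_zero, Complex.ofReal_ofNat] at h2
      exact h2.mono_left nhdsWithin_le_nhds
    · filter_upwards [self_mem_nhdsWithin] with t ht
      simp only [Set.mem_compl_iff, Set.mem_singleton_iff]
      push_cast
      simpa using (ne_of_gt ht : t ≠ 0)
  refine h1.frequently (Eventually.frequently ?_)
  filter_upwards [self_mem_nhdsWithin] with t ht
  exact h _ (by have : (0 : ℝ) < t := ht; linarith)

theorem LSeries_real {a : ℕ → ℝ} (h0 : a 0 = 0) (σ : ℝ) :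
    (LSeriesSummable (fun n => (a n : ℂ)) σ ↔ Summable (fun n : ℕ => a n * (n : ℝ) ^ (-σ))) ∧
    LSeries (fun n => (a n : ℂ)) σ = ((∑' n : ℕ, a n * (n : ℝ) ^ (-σ) : ℝ) : ℂ) := by
  have h2 : LSeries.term (fun n => (a n : ℂ)) σ = fun n : ℕ => ((a n * (n : ℝ) ^ (-σ) : ℝ) : ℂ) := by
    ext n
    rcases eq_or_ne n 0 with rfl | hn
    · simp [h0]
    · rw [LSeries.term_of_ne_zero hn, Real.rpow_neg (Nat.cast_nonneg _), Complex.ofReal_mul, Complex.ofReal_inv,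
        Complex.ofReal_cpow (Nat.cast_nonneg _)]
      simp [div_eq_mul_inv]
  constructor
  · rw [LSeriesSummable, h2, Complex.summable_ofReal]
  · rw [LSeries, h2, Complex.ofReal_tsum]

theorem lamK_summable (K : Type*) [Field K] [NumberField K] {s : ℂ} (hs : 1 < s.re) :
    LSeriesSummable (fun n => (lamK K n : ℂ)) s := by
  have h1 := ArithmeticFunction.LSeriesSummable_vonMangoldt hs
  refine Summable.of_norm_bounded (h1.norm.mul_left (Module.finrank ℚ K : ℝ)) fun m => ?_
  have e : ∀ a : ℕ → ℂ, ‖LSeries.term a s m‖ = if m = 0 then 0 else ‖a m‖ / m ^ s.re := fun a => LSeries.norm_term_eq a s m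
  rw [e, e]
  split_ifs
  · simp
  · rw [← mul_div_assoc]
    gcongr
    rw [Complex.norm_real, Complex.norm_real, Real.norm_of_nonneg (lamK_nonneg m),
      Real.norm_of_nonneg ArithmeticFunction.vonMangoldt_nonneg]
    exact lamK_le m

theorem absc_lt {a : ℕ → ℂ} (h : ∀ y : ℝ, 1 < y → LSeriesSummable a y) {s : ℂ} (hs : 1 < s.re) :
    LSeries.abscissaOfAbsConv a < s.re :=
  lt_of_le_of_lt (LSeries.abscissaOfAbsConv_le_of_forall_lt_LSeriesSummable (x := 1) h) (by exact_mod_cast hs)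

theorem rK_absc (K : Type*) [Field K] [NumberField K] {s : ℂ} (hs : 1 < s.re) :
    LSeries.abscissaOfAbsConv (fun n => ((rK K n : ℝ) : ℂ)) < s.re :=
  absc_lt (fun y hy => rK_bigO K (by simpa using hy)) hs

theorem lamK_absc (K : Type*) [Field K] [NumberField K] {s : ℂ} (hs : 1 < s.re) :
    LSeries.abscissaOfAbsConv (fun n => (lamK K n : ℂ)) < s.re :=
  absc_lt (fun y hy => lamK_summable K (by simpa using hy)) hs

theorem lamK_zero : lamK K 0 = 0 :=
  le_antisymm (by simpa using lamK_le (K := K) 0) (lamK_nonneg 0)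

theorem lam_tsum {σ : ℝ} (hσ : 1 < σ) :
    Summable (fun n : ℕ => (rK K n * Real.log n) * (n : ℝ) ^ (-σ)) ∧
    ∑' n : ℕ, (rK K n * Real.log n) * (n : ℝ) ^ (-σ) =
      (∑' n : ℕ, lamK K n * (n : ℝ) ^ (-σ)) * ∑' n : ℕ, rK K n * (n : ℝ) ^ (-σ) := by
  have hs : (1 : ℝ) < (σ : ℂ).re := by simpa using hσ
  have h1 := log_conv (K := K) σ
  have h2 : ∑' q : PP K, ppL q * ENNReal.ofReal ((ppN q : ℝ) ^ (-σ)) =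
      ENNReal.ofReal (∑' n : ℕ, lamK K n * (n : ℝ) ^ (-σ)) := by
    rw [tsum_fiber ppN, ENNReal.ofReal_tsum_of_nonneg (fun n => mul_nonneg (lamK_nonneg n) (by positivity))
      ((LSeries_real lamK_zero σ).1.mp (lamK_summable K hs))]
    refine tsum_congr fun m => ?_
    rw [ENNReal.ofReal_mul (lamK_nonneg m), ofReal_lamK, lamE, ← ENNReal.tsum_mul_right]
    refine tsum_congr fun q => ?_
    rw [q.2]
  have hr : Summable (fun n : ℕ => (rK K n * Real.log n) * (n : ℝ) ^ (-σ)) := by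
    refine (LSeries_real (a := fun n => rK K n * Real.log n) (by simp) σ).1.mp ?_
    refine (LSeriesSummable_congr _ fun {n} hn => ?_).mp (LSeriesSummable_logMul_of_lt_re (rK_absc K hs))
    simp [LSeries.logMul, Complex.natCast_log, mul_comm]
  refine ⟨hr, ?_⟩
  have h0 : ∀ n : ℕ, (0 : ℝ) ≤ (rK K n * Real.log n) * (n : ℝ) ^ (-σ) := fun n =>
    mul_nonneg (mul_nonneg (Nat.cast_nonneg _) (Real.log_natCast_nonneg _)) (by positivity)
  rw [h2, nzI_sum hσ] at h1
  have h3 : ∑' I : NzI K, ENNReal.ofReal (Real.log (nzN I)) * ENNReal.ofReal ((nzN I : ℝ) ^ (-σ)) =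
      ENNReal.ofReal (∑' n : ℕ, (rK K n * Real.log n) * (n : ℝ) ^ (-σ)) := by
    rw [tsum_nzI (fun m => ENNReal.ofReal (Real.log m) * ENNReal.ofReal ((m : ℝ) ^ (-σ))),
      ENNReal.ofReal_tsum_of_nonneg h0 hr]
    refine tsum_congr fun m => ?_
    rw [mul_assoc (rK K m : ℝ), ENNReal.ofReal_mul (Nat.cast_nonneg _), ENNReal.ofReal_mul (Real.log_natCast_nonneg _)]
    simp
  have hA : 0 ≤ ∑' n : ℕ, lamK K n * (n : ℝ) ^ (-σ) :=
    tsum_nonneg fun n => mul_nonneg (lamK_nonneg n) (by positivity)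
  rw [h3, ← ENNReal.ofReal_mul hA, ENNReal.ofReal_eq_ofReal_iff (tsum_nonneg h0)
    (mul_nonneg hA (tsum_nonneg fun n => by positivity))] at h1
  exact h1

theorem zK_diff (K : Type*) [Field K] [NumberField K] : DifferentiableOn ℂ (zK K) {s : ℂ | 1 < s.re} :=
  (LSeries_differentiableOn _).mono fun _ hs => rK_absc K hs

theorem zK_deriv {s : ℂ} (hs : 1 < s.re) :
    deriv (zK K) s = - (zK K s * LSeries (fun n => (lamK K n : ℂ)) s) := by
  refine eqOn_half (f := deriv (zK K)) (g := fun s => - (zK K s * LSeries (fun n => (lamK K n : ℂ)) s))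
    ((zK_diff K).deriv halfplane_open) ?_ ?_ hs
  · exact ((zK_diff K).mul ((LSeries_differentiableOn _).mono fun _ hs => lamK_absc K hs)).neg
  · intro σ hσ
    have hs : (1 : ℝ) < (σ : ℂ).re := by simpa using hσ
    have h1 : deriv (zK K) σ = _ := LSeries_deriv (rK_absc K hs)
    rw [h1, neg_inj, (LSeries_real lamK_zero σ).2, (zK_ofReal hσ).2, ← Complex.ofReal_mul, mul_comm, ← (lam_tsum hσ).2,
      ← (LSeries_real (a := fun n => rK K n * Real.log n) (by simp) σ).2]
    refine LSeries_congr (fun {n} hn => ?_) _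
    simp [LSeries.logMul, Complex.natCast_log, mul_comm]

theorem zK_two :
    ∑' n : ℕ, (rK K n : ℝ) * (n : ℝ) ^ (-((Module.finrank ℚ K : ℝ) + 5)) ≤ 2 := by
  set N := Module.finrank ℚ K with hN
  set σ : ℝ := (N : ℝ) + 5 with hσd
  have hσ : 1 < σ := by have : (0 : ℝ) ≤ N := Nat.cast_nonneg _; linarith
  set Z := ∑' n : ℕ, (rK K n : ℝ) * (n : ℝ) ^ (-σ) with hZ
  set A := ∑' n : ℕ, lamK K n * (n : ℝ) ^ (-σ) with hA
  have hZ0 : 0 ≤ Z := tsum_nonneg fun n => by positivity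
  have hAb : A ≤ 1 / 4 := by
    have hz := (hasSum_zeta_two.mul_left ((N : ℝ) * 2⁻¹ ^ (N + 2)))
    have h1 : A ≤ (N : ℝ) * 2⁻¹ ^ (N + 2) * (Real.pi ^ 2 / 6) := by
      rw [← hz.tsum_eq]
      refine Summable.tsum_le_tsum (fun m => ?_) ((LSeries_real lamK_zero σ).1.mp (lamK_summable K (by simpa using hσ))) hz.summable
      rcases Nat.lt_or_ge m 2 with hm | hm
      · have : lamK K m ≤ 0 := (lamK_le m).trans (by interval_cases m <;> simp)
        rw [le_antisymm this (lamK_nonneg m), zero_mul]; positivity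
      · have hm0 : (2 : ℝ) ≤ m := by exact_mod_cast hm
        have e1 : (m : ℝ) ^ (-σ) = (m : ℝ)⁻¹ ^ (N + 2) * (m : ℝ)⁻¹ ^ 3 := by
          rw [Real.rpow_neg (by positivity), ← pow_add, inv_pow, ← Real.rpow_natCast]
          congr 2; rw [hσd]; push_cast; ring
        have e2 : lamK K m ≤ N * m := (lamK_le m).trans (by
          gcongr
          exact ArithmeticFunction.vonMangoldt_le_log.trans ((Real.log_le_sub_one_of_pos (by linarith)).trans (by linarith)))
        calc lamK K m * (m : ℝ) ^ (-σ) ≤ (N * m) * (2⁻¹ ^ (N + 2) * (m : ℝ)⁻¹ ^ 3) := by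
              rw [e1]; gcongr
          _ = _ := by field_simp
    have h2 : (N : ℝ) * 2⁻¹ ^ (N + 2) ≤ 1 / 8 := by
      have : (N : ℝ) * 2⁻¹ ^ N ≤ 1 / 2 := by
        have h3 : N * 2 ≤ 2 ^ N := by
          clear_value N
          rcases N with _ | _ | k
          · simp
          · simp
          · have := Nat.lt_two_pow_self (n := k + 1)
            rw [pow_succ]; omega
        have h4 : (N : ℝ) * 2 ≤ 2 ^ N := by exact_mod_cast h3
        rw [inv_pow, ← div_eq_mul_inv, div_le_div_iff₀ (by positivity) (by norm_num)]
        linarith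
      rw [pow_add]; nlinarith
    have h3 : Real.pi ^ 2 / 6 ≤ 2 := by nlinarith [Real.pi_lt_d2, Real.pi_pos]
    calc A ≤ _ := h1
      _ ≤ 1 / 8 * 2 := by gcongr
      _ = _ := by norm_num
  have hr1 : rK K 1 ≤ 1 := by
    have : Subsingleton {I : NzI K // nzN I = 1} := ⟨fun I J => by
      have h : ∀ I : {I : NzI K // nzN I = 1}, I.1.1 = ⊤ := fun I => Ideal.absNorm_eq_one_iff.mp I.2
      exact Subtype.ext (Subtype.ext ((h I).trans (h J).symm))⟩
    exact Finite.card_le_one_iff_subsingleton.mpr this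
  have hl : Z * Real.log 2 ≤ Real.log 2 + A * Z := by
    rw [← (lam_tsum hσ).2, hZ, ← tsum_mul_right,
      show Real.log 2 = ∑' n : ℕ, (if n = 1 then Real.log 2 else 0) by rw [tsum_ite_eq],
      ← Summable.tsum_add (summable_of_hasFiniteSupport ((Set.finite_singleton 1).subset (by intro n; simp +contextual))) (lam_tsum hσ).1, tsum_ite_eq]
    refine Summable.tsum_le_tsum (fun m => ?_) ((zK_ofReal hσ).1.mul_right _)
      ((summable_of_hasFiniteSupport ((Set.finite_singleton 1).subset (by intro n; simp +contextual))).add (lam_tsum hσ).1)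
    have hl2 : 0 < Real.log 2 := Real.log_pos (by norm_num)
    rcases m with _ | _ | m
    · simp [rK_zero]
    · have : (rK K 1 : ℝ) ≤ 1 := by exact_mod_cast hr1
      simp; nlinarith
    · rw [if_neg (by omega), zero_add, mul_assoc, mul_assoc, mul_comm (Real.log _)]
      gcongr
      · push_cast; linarith
  have hl2 : 0.69 < Real.log 2 := by linarith [Real.log_two_gt_d9]
  nlinarith

noncomputable def zR (K : Type*) [Field K] [NumberField K] (σ : ℝ) : ℝ := ∑' n : ℕ, (rK K n : ℝ) * (n : ℝ) ^ (-σ)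

theorem hecke_K (K : Type*) [Field K] [NumberField K] :
    ∃ (H : ℂ → ℂ) (V : ℝ), Differentiable ℂ H ∧ 0 ≤ V ∧
      (∀ σ : ℝ, 1 < σ → ((gamD K σ * zR K σ : ℝ) : ℂ) = H σ + V * (1 / (σ - 1) - 1 / σ)) ∧
      (∀ σ : ℝ, 1 < σ → V * (1 / (σ - 1) - 1 / σ) ≤ gamD K σ * zR K σ) ∧
      (∀ (s : ℂ) (σ : ℝ), 1 < σ → s.re ≤ σ → 1 - s.re ≤ σ → ‖H s‖ ≤ 2 * (gamD K σ * zR K σ)) := by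
  have hz : ∀ (c : ClassGroup (𝓞 K)) (σ : ℝ), 1 < σ → zcl c σ ≠ ⊤ := fun c σ hσ => (sum_zcl hσ).1 c
  have hJ : ∀ c : ClassGroup (𝓞 K), ∃ J : (FractionalIdeal (𝓞 K)⁰ K)ˣ, ClassGroup.mk K J = c :=
    fun c => ClassGroup.induction K (P := fun c => ∃ J : (FractionalIdeal (𝓞 K)⁰ K)ˣ, ClassGroup.mk K J = c)
      (fun I => ⟨I, rfl⟩) c
  choose J hJ using hJ
  choose B B' V hB hB' hV h1 h2 h3 h4 using fun c => hecke_J hz (J c)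
  have s1 : ∀ σ : ℝ, 1 < σ → ∑ c : ClassGroup (𝓞 K), gamD K σ * (zcl (ClassGroup.mk K (J c))⁻¹ σ).toReal = gamD K σ * zR K σ := by
    intro σ hσ
    rw [← Finset.mul_sum, zR, ← (sum_zcl hσ).2]
    congr 1
    refine Eq.trans ?_ (Equiv.sum_comp (Equiv.inv (ClassGroup (𝓞 K))) (fun c => (zcl c σ).toReal))
    exact Finset.sum_congr rfl fun c _ => by rw [hJ]; rfl
  have s2 : ∀ σ : ℝ, 1 < σ → ∑ c : ClassGroup (𝓞 K), gamD K σ * (zcl (ClassGroup.mk K (dualI (J c)))⁻¹ σ).toReal = gamD K σ * zR K σ := by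
    intro σ hσ
    rw [← Finset.mul_sum, zR, ← (sum_zcl hσ).2]
    congr 1
    refine Eq.trans ?_ (Equiv.sum_comp (Equiv.mulRight (ClassGroup.mk K (dualI (1 : (FractionalIdeal (𝓞 K)⁰ K)ˣ)))⁻¹) (fun c => (zcl c σ).toReal))
    refine Finset.sum_congr rfl fun c _ => ?_
    rw [dualI_eq, map_mul, map_inv, hJ, mul_inv, inv_inv, mul_comm]; rfl
  refine ⟨fun s => ∑ c, (B c s + B' c (1 - s)), ∑ c, V c, ?_, Finset.sum_nonneg fun c _ => hV c, ?_, ?_, ?_⟩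
  · refine Differentiable.fun_sum fun c _ => (hB c).add ((hB' c).comp (by fun_prop))
  · intro σ hσ
    rw [← s1 σ hσ]
    push_cast
    rw [Finset.sum_mul, ← Finset.sum_add_distrib]
    exact Finset.sum_congr rfl fun c _ => h1 c σ hσ
  · intro σ hσ
    rw [← s1 σ hσ, Finset.sum_mul]
    exact Finset.sum_le_sum fun c _ => h2 c σ hσ
  · intro s σ hσ ha hb
    rw [two_mul]
    nth_rewrite 1 [← s1 σ hσ]
    rw [← s2 σ hσ, ← Finset.sum_add_distrib]
    refine norm_sum_le_of_le _ fun c _ => (norm_add_le _ _).trans (add_le_add (h3 c s σ hσ ha) (h4 c _ σ hσ (by simpa using hb)))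

theorem Gamma_lb {x : ℝ} (hx : 0 < x) : 1 / 6 ≤ Real.Gamma x := by
  have hm : ∀ y : ℝ, 2 ≤ y → 1 ≤ Real.Gamma y := fun y hy => by
    have := Real.Gamma_strictMonoOn_Ici.monotoneOn (a := 2) (b := y) (by simp) hy hy
    rwa [show (2 : ℝ) = (1 : ℕ) + 1 by norm_num, Real.Gamma_nat_eq_factorial, Nat.factorial_one, Nat.cast_one] at this
  rcases le_or_gt 2 x with h | h
  · linarith [hm x h]
  · have h1 := hm (x + 1 + 1) (by linarith)
    rw [Real.Gamma_add_one (by linarith), Real.Gamma_add_one hx.ne'] at h1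
    have := Real.Gamma_pos_of_pos hx
    by_contra h3
    have : (x + 1) * (x * Real.Gamma x) ≤ 3 * (2 * (Real.Gamma x)) := by gcongr; linarith
    linarith

theorem Gamma_vert {z : ℂ} (hz : 1 / 4 ≤ z.re) :
    Real.Gamma z.re * ‖(Complex.Gamma z)⁻¹‖ ≤ Real.exp (9 * z.im ^ 2) := by
  have hz0 : Complex.Gamma z ≠ 0 := Complex.Gamma_ne_zero_of_re_pos (by linarith)
  rw [norm_inv, ← div_eq_mul_inv, div_le_iff₀ (norm_pos_iff.mpr hz0),
    ← Real.norm_of_nonneg (Real.Gamma_pos_of_pos (show 0 < z.re by linarith)).le, ← Complex.norm_real, ← Complex.Gamma_ofReal]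
  refine le_of_tendsto_of_tendsto' (Complex.GammaSeq_tendsto_Gamma z.re).norm
    ((Complex.GammaSeq_tendsto_Gamma z).norm.const_mul _) fun n => ?_
  rcases Nat.eq_zero_or_pos n with rfl | hn
  · have h0 : z ≠ 0 := by rintro rfl; norm_num at hz
    have h00 : ((z.re : ℝ) : ℂ) ≠ 0 := by rw [Complex.ofReal_ne_zero]; linarith
    simp [Complex.GammaSeq, Complex.zero_cpow h0, Complex.zero_cpow h00]
  simp only [Complex.GammaSeq, norm_div, norm_mul, norm_prod, Complex.norm_natCast_cpow_of_pos hn, Complex.ofReal_re]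
  have hp : ∀ j : ℕ, 0 < ‖z + j‖ := fun j => norm_pos_iff.mpr (by
    intro h; have := congrArg Complex.re h; simp at this
    have hj : (0 : ℝ) ≤ j := Nat.cast_nonneg _
    linarith)
  have hp' : ∀ j : ℕ, 0 < ‖(z.re : ℂ) + j‖ := fun j => norm_pos_iff.mpr (by
    intro h; have := congrArg Complex.re h; simp at this
    have hj : (0 : ℝ) ≤ j := Nat.cast_nonneg _
    linarith)
  rw [← mul_div_assoc, div_le_div_iff₀ (Finset.prod_pos fun j _ => hp' j) (Finset.prod_pos fun j _ => hp j),
    mul_comm (Real.exp _), mul_assoc _ (Real.exp _)]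
  refine mul_le_mul_of_nonneg_left ?_ (mul_nonneg (Real.rpow_nonneg (Nat.cast_nonneg _) _) (norm_nonneg _))
  have hj : ∀ j : ℕ, ‖z + j‖ ≤ Real.exp (z.im ^ 2 / 2 * (1 / (1 / 4 + j) ^ 2)) * ‖(z.re : ℂ) + j‖ := by
    intro j
    have hj0 : (0 : ℝ) ≤ j := Nat.cast_nonneg _
    have e1 : ‖(z.re : ℂ) + j‖ = z.re + j := by
      rw [← Complex.ofReal_natCast, ← Complex.ofReal_add, Complex.norm_real, Real.norm_of_nonneg (by linarith)]
    rw [e1]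
    refine abs_le_of_sq_le_sq' ?_ (by have : 0 ≤ z.re := by linarith
                                      positivity) |>.2
    rw [Complex.sq_norm, Complex.normSq_apply]
    simp only [Complex.add_re, Complex.natCast_re, Complex.add_im, Complex.natCast_im, add_zero]
    rw [mul_pow, ← Real.exp_nat_mul]
    have h5 := Real.add_one_le_exp (((2 : ℕ) : ℝ) * (z.im ^ 2 / 2 * (1 / (1 / 4 + (j : ℝ)) ^ 2)))
    have h6 : z.im * z.im ≤ ((2 : ℕ) : ℝ) * (z.im ^ 2 / 2 * (1 / (1 / 4 + (j : ℝ)) ^ 2)) * (z.re + j) ^ 2 := by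
      have : (1 : ℝ) ≤ (1 / (1 / 4 + (j : ℝ)) ^ 2) * (z.re + j) ^ 2 := by
        rw [one_div, ← div_eq_inv_mul, one_le_div (by positivity)]
        gcongr
      push_cast
      nlinarith [sq_nonneg z.im]
    nlinarith [sq_nonneg (z.re + j)]
  refine (Finset.prod_le_prod (fun j _ => (hp j).le) fun j _ => hj j).trans ?_
  rw [Finset.prod_mul_distrib, ← Real.exp_sum, ← Finset.mul_sum]
  refine mul_le_mul_of_nonneg_right ?_ (Finset.prod_nonneg fun j _ => (hp' j).le)
  apply Real.exp_le_exp.mpr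
  have h7 : ∑ j ∈ Finset.range (n + 1), (1 / (1 / 4 + (j : ℝ)) ^ 2) ≤ 18 := by
    rw [Finset.sum_range_succ']
    have h8 : ∑ j ∈ Finset.range n, (1 / (1 / 4 + ((j + 1 : ℕ) : ℝ)) ^ 2) ≤ ∑ j ∈ Finset.range n, (1 / ((j + 1 : ℕ) : ℝ) ^ 2) := by
      refine Finset.sum_le_sum fun j _ => ?_
      have : (0 : ℝ) < ((j + 1 : ℕ) : ℝ) := by positivity
      gcongr
      linarith
    have h9 : ∑ j ∈ Finset.range n, (1 / ((j + 1 : ℕ) : ℝ) ^ 2) ≤ Real.pi ^ 2 / 6 := by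
      have := sum_le_hasSum (Finset.range (n + 1)) (fun i _ => by positivity) hasSum_zeta_two
      rw [Finset.sum_range_succ'] at this
      simpa using this
    have : Real.pi ^ 2 / 6 ≤ 2 := by nlinarith [Real.pi_lt_d2, Real.pi_pos]
    norm_num at h8 h9 ⊢
    linarith
  nlinarith [sq_nonneg z.im]

theorem mult_cases {K : Type*} [Field K] (w : InfinitePlace K) : (1 : ℝ) ≤ w.mult ∧ (w.mult : ℝ) ≤ 2 := by
  rw [InfinitePlace.mult]; split_ifs <;> norm_num

noncomputable def gI {K : Type*} [Field K] (w : InfinitePlace K) (s : ℂ) : ℂ :=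
  ((Real.pi * w.mult : ℝ) : ℂ) ^ (w.mult * s / 2) * (Complex.Gamma (w.mult * s / 2))⁻¹

theorem cpow_diff {a : ℝ} (ha : 0 < a) {f : ℂ → ℂ} (hf : Differentiable ℂ f) : Differentiable ℂ fun s => (a : ℂ) ^ f s :=
  hf.const_cpow (Or.inl (by exact_mod_cast ha.ne'))

theorem gI_diff {K : Type*} [Field K] (w : InfinitePlace K) : Differentiable ℂ (gI w) := by
  have := (mult_cases w).1
  exact (cpow_diff (by positivity) (by fun_prop)).mul (Complex.differentiable_one_div_Gamma.comp (f := fun s : ℂ => (w.mult : ℂ) * s / 2) (by fun_prop))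

theorem gI_real {K : Type*} [Field K] (w : InfinitePlace K) {σ : ℝ} (hσ : 0 < σ) :
    gI w σ * (((Real.pi * w.mult) ^ (-(w.mult * σ / 2)) * Real.Gamma (w.mult * σ / 2) : ℝ) : ℂ) = 1 := by
  have h1 := (mult_cases w).1
  have hp : 0 < Real.pi * w.mult := by positivity
  have e : (w.mult : ℂ) * σ / 2 = ((w.mult * σ / 2 : ℝ) : ℂ) := by push_cast; ring
  have hG := (Real.Gamma_pos_of_pos (show 0 < w.mult * σ / 2 by positivity)).ne'
  rw [gI, e, Complex.Gamma_ofReal, ← Complex.ofReal_cpow hp.le, ← Complex.ofReal_inv, ← Complex.ofReal_mul, ← Complex.ofReal_mul,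
    Real.rpow_neg hp.le]
  have := (Real.rpow_pos_of_pos hp (w.mult * σ / 2)).ne'
  norm_cast
  field_simp

theorem gI_bound {K : Type*} [Field K] (w : InfinitePlace K) {s : ℂ} (hs : 1 / 2 ≤ s.re) :
    ‖gI w s‖ * ((Real.pi * w.mult) ^ (-(w.mult * s.re / 2)) * Real.Gamma (w.mult * s.re / 2)) ≤ Real.exp (w.mult * (9 * s.im ^ 2)) := by
  obtain ⟨h1, h2⟩ := mult_cases w
  have hp : 0 < Real.pi * w.mult := by positivity
  have e1 : ((w.mult : ℂ) * s / 2).re = w.mult * s.re / 2 := by simp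
  have e2 : ((w.mult : ℂ) * s / 2).im = w.mult * s.im / 2 := by simp
  have h3 := Gamma_vert (z := (w.mult : ℂ) * s / 2) (by rw [e1]; nlinarith)
  rw [e1, e2] at h3
  rw [gI, norm_mul, Complex.norm_cpow_eq_rpow_re_of_pos hp, e1, Real.rpow_neg hp.le]
  have := (Real.rpow_pos_of_pos hp (w.mult * s.re / 2)).ne'
  calc _ = Real.Gamma (w.mult * s.re / 2) * ‖(Complex.Gamma ((w.mult : ℂ) * s / 2))⁻¹‖ := by field_simp
    _ ≤ _ := h3
    _ ≤ _ := by
      apply Real.exp_le_exp.mpr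
      nlinarith [mul_nonneg (sq_nonneg s.im) (show (0 : ℝ) ≤ w.mult * (2 - w.mult) by nlinarith), mul_nonneg (sq_nonneg s.im) (show (0:ℝ) ≤ w.mult by linarith)]

theorem gI_split {K : Type*} [Field K] (w : InfinitePlace K) :
    ∃ g : ℂ → ℂ, Differentiable ℂ g ∧ ∀ s, gI w s = s * g s := by
  have h1 := (mult_cases w).1
  refine ⟨fun s => ((Real.pi * w.mult : ℝ) : ℂ) ^ (w.mult * s / 2) * (w.mult / 2 * (Complex.Gamma (w.mult * s / 2 + 1))⁻¹), ?_, ?_⟩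
  · exact (cpow_diff (by positivity) (by fun_prop)).mul
      ((Complex.differentiable_one_div_Gamma.comp (f := fun s : ℂ => (w.mult : ℂ) * s / 2 + 1) (by fun_prop)).const_mul _)
  · intro s
    rw [gI, Complex.one_div_Gamma_eq_self_mul_one_div_Gamma_add_one]; ring

theorem discr_ge_one (K : Type*) [Field K] [NumberField K] : 1 ≤ |(discr K : ℝ)| := by
  have := Int.one_le_abs (discr_ne_zero K)
  exact_mod_cast this

theorem gamD_ratio {σ : ℝ} (hσ : 1 / 2 ≤ σ) (hσ' : σ ≤ Module.finrank ℚ K + 5) :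
    gamD K (Module.finrank ℚ K + 5) ≤ gamD K σ * Real.exp (Module.finrank ℚ K * (2 + (Module.finrank ℚ K + 4) ^ 2) +
      Real.log |(discr K : ℝ)| * ((Module.finrank ℚ K + 5) / 2)) := by
  set N := Module.finrank ℚ K with hN
  have hNp : 1 ≤ N := Module.finrank_pos
  have hNp' : (1 : ℝ) ≤ N := by exact_mod_cast hNp
  have hd := discr_ge_one K
  rw [gamD, gamD, Real.exp_add, Real.exp_mul (Real.log _), Real.exp_log (by linarith)]
  have h1 : gamR K (N + 5) ≤ gamR K σ * Real.exp (N * (2 + ((N : ℝ) + 4) ^ 2)) := by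
    have : Real.exp (∑ w : InfinitePlace K, (2 + ((N : ℝ) + 4) ^ 2)) ≤ Real.exp (N * (2 + ((N : ℝ) + 4) ^ 2)) := by
      apply Real.exp_le_exp.mpr
      rw [Finset.sum_const, nsmul_eq_mul]
      gcongr
      rw [hN, ← InfinitePlace.sum_mult_eq, Finset.card_eq_sum_ones]
      exact Finset.sum_le_sum fun w _ => InfinitePlace.mult_pos
    refine le_trans ?_ (mul_le_mul_of_nonneg_left this (gamR_pos K (by linarith)).le)
    rw [gamR, gamR, Real.exp_sum, ← Finset.prod_mul_distrib]
    refine Finset.prod_le_prod (fun w _ => ?_) (fun w _ => ?_)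
    · have := (mult_cases w).1
      have := Real.Gamma_pos_of_pos (show 0 < w.mult * ((N : ℝ) + 5) / 2 by positivity)
      positivity
    · obtain ⟨m1, m2⟩ := mult_cases w
      have hp : 1 ≤ Real.pi * w.mult := by nlinarith [Real.pi_gt_three]
      rw [mul_assoc]
      refine mul_le_mul (Real.rpow_le_rpow_of_exponent_le hp (by nlinarith)) ?_ (Real.Gamma_pos_of_pos (by positivity)).le (by positivity)
      have hG := Gamma_lb (x := w.mult * σ / 2) (by positivity)
      have hG2 : Real.Gamma (w.mult * ((N : ℝ) + 5) / 2) ≤ Real.exp ((N + 4) ^ 2) := by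
        have h3 : Real.Gamma (w.mult * ((N : ℝ) + 5) / 2) ≤ Real.Gamma ((N + 4 : ℕ) + 1) :=
          Real.Gamma_strictMonoOn_Ici.monotoneOn (by simp; nlinarith) (by simp; linarith) (by push_cast; nlinarith)
        rw [Real.Gamma_nat_eq_factorial] at h3
        have h4 : ((N + 4).factorial : ℝ) ≤ ((N + 4 : ℕ) : ℝ) ^ (N + 4) := by exact_mod_cast Nat.factorial_le_pow _
        refine (h3.trans h4).trans ?_
        rw [show ((N : ℝ) + 4) ^ 2 = ((N + 4 : ℕ) : ℝ) * ((N + 4 : ℕ) : ℝ) by push_cast; ring, Real.exp_nat_mul]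
        gcongr
        linarith [Real.add_one_le_exp (((N + 4 : ℕ) : ℝ))]
      have h6 : (6 : ℝ) ≤ Real.exp 2 := by
        rw [show (2 : ℝ) = 1 + 1 by norm_num, Real.exp_add]
        nlinarith [Real.exp_one_gt_d9]
      calc _ ≤ Real.exp ((N + 4) ^ 2) := hG2
        _ ≤ (1 / 6 * 6) * Real.exp ((N + 4) ^ 2) := by norm_num
        _ ≤ (Real.Gamma (w.mult * σ / 2) * Real.exp 2) * Real.exp ((N + 4) ^ 2) := by gcongr
        _ = _ := by rw [Real.exp_add]; ring
  have h2 : |(discr K : ℝ)| ^ (((N : ℝ) + 5) / 2) ≤ |(discr K : ℝ)| ^ (σ / 2) * |(discr K : ℝ)| ^ (((N : ℝ) + 5) / 2) :=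
    le_mul_of_one_le_left (by positivity) (Real.one_le_rpow hd (by linarith))
  have hg := (gamR_pos K (show 0 < σ by linarith)).le
  calc _ ≤ (gamR K σ * Real.exp (N * (2 + ((N : ℝ) + 4) ^ 2))) * (|(discr K : ℝ)| ^ (σ / 2) * |(discr K : ℝ)| ^ (((N : ℝ) + 5) / 2)) := by
        gcongr
    _ = _ := by ring

theorem zK_norm_le {s : ℂ} {σ : ℝ} (hσ : 1 < σ) (hs : σ ≤ s.re) : ‖zK K s‖ ≤ zR K σ := by
  have h1 := rK_bigO K (s := s) (by linarith)
  refine (norm_tsum_le_tsum_norm h1.norm).trans ?_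
  refine Summable.tsum_le_tsum (fun n => ?_) h1.norm (zK_ofReal hσ).1
  rw [LSeries.norm_term_eq]
  split_ifs with hn
  · subst hn; positivity
  · rw [Complex.norm_real, Real.norm_of_nonneg (Nat.cast_nonneg _), div_eq_mul_inv, ← Real.rpow_neg (Nat.cast_nonneg _)]
    gcongr
    exact_mod_cast Nat.pos_of_ne_zero hn

noncomputable def qK (K : Type*) [Field K] [NumberField K] : ℝ :=
  ((Module.finrank ℚ K : ℝ) + 5) ^ 4 * Real.log (3 * |(discr K : ℝ)|)

theorem log3_ge {D : ℝ} (hd : 1 ≤ D) : 1 ≤ Real.log (3 * D) ∧ Real.log D ≤ Real.log (3 * D) ∧ 0 ≤ Real.log D := by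
  refine ⟨?_, Real.log_le_log (by linarith) (by linarith), Real.log_nonneg hd⟩
  rw [Real.le_log_iff_exp_le (by linarith)]
  linarith [Real.exp_one_lt_d9]

theorem qK_ge (K : Type*) [Field K] [NumberField K] : 625 ≤ qK K := by
  have h1 := (log3_ge (discr_ge_one K)).1
  have h2 : (5 : ℝ) ^ 4 ≤ ((Module.finrank ℚ K : ℝ) + 5) ^ 4 := by
    gcongr; have : (0 : ℝ) ≤ Module.finrank ℚ K := Nat.cast_nonneg _
    linarith
  rw [qK]; nlinarith

set_option maxHeartbeats 1000000 in
theorem exists_F (K : Type*) [Field K] [NumberField K] :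
    ∃ F : ℂ → ℂ, Differentiable ℂ F ∧ (∀ s : ℂ, 1 < s.re → F s = (s - 1) * zK K s) ∧
      (∀ s : ℂ, 1 / 2 ≤ s.re → ‖F s‖ ≤ Real.exp (40 * qK K * (‖s‖ + 2) ^ 2)) ∧ F 1 ≠ 0 := by
  obtain ⟨H, V, hH, hV, h1, h2, h3⟩ := hecke_K K
  obtain ⟨w0⟩ : Nonempty (InfinitePlace K) := inferInstance
  obtain ⟨g, hg, hgs⟩ := gI_split w0
  classical
  have hd := discr_ge_one K
  set D := |(discr K : ℝ)| with hD
  set N : ℝ := (Module.finrank ℚ K : ℝ) with hN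
  have hN1 : 1 ≤ N := by rw [hN]; exact_mod_cast Module.finrank_pos
  let G1 : ℂ → ℂ := fun s => (g s * ∏ w ∈ Finset.univ.erase w0, gI w s) * (D : ℂ) ^ (-(s / 2))
  have hG1 : Differentiable ℂ G1 :=
    (hg.mul (Differentiable.fun_finsetProd fun w _ => gI_diff w)).mul (cpow_diff (by linarith) (by fun_prop))
  have hG : ∀ s, s * G1 s = (∏ w : InfinitePlace K, gI w s) * (D : ℂ) ^ (-(s / 2)) := fun s => by
    rw [← Finset.mul_prod_erase _ _ (Finset.mem_univ w0), hgs]; ring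
  have hGr : ∀ σ : ℝ, 0 < σ → σ * G1 σ * gamD K σ = 1 := by
    intro σ hσ
    have e1 : (D : ℂ) ^ (-((σ : ℂ) / 2)) * ((D ^ (σ / 2) : ℝ) : ℂ) = 1 := by
      rw [show (-((σ : ℂ) / 2)) = ((-(σ / 2) : ℝ) : ℂ) by push_cast; ring, ← Complex.ofReal_cpow (by linarith),
        ← Complex.ofReal_mul, ← Real.rpow_add (by linarith)]
      simp
    rw [hG, gamD, gamR, Complex.ofReal_mul, Complex.ofReal_prod]
    calc _ = (∏ w : InfinitePlace K, gI w σ) * (∏ w : InfinitePlace K, (((Real.pi * w.mult) ^ (-(w.mult * σ / 2)) * Real.Gamma (w.mult * σ / 2) : ℝ) : ℂ)) *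
        ((D : ℂ) ^ (-((σ : ℂ) / 2)) * ((D ^ (σ / 2) : ℝ) : ℂ)) := by ring
      _ = 1 := by
        rw [e1, ← Finset.prod_mul_distrib, Finset.prod_eq_one (fun w _ => gI_real w hσ), one_mul]
  have hGb : ∀ s : ℂ, 1 / 2 ≤ s.re → ‖s * G1 s‖ * gamD K s.re ≤ Real.exp (9 * N * s.im ^ 2) := by
    intro s hs
    have e1 : ‖(D : ℂ) ^ (-(s / 2))‖ * D ^ (s.re / 2) = 1 := by
      rw [Complex.norm_cpow_eq_rpow_re_of_pos (by linarith), ← Real.rpow_add (by linarith)]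
      simp
    rw [hG, gamD, gamR, norm_mul, norm_prod]
    calc _ = (∏ w : InfinitePlace K, ‖gI w s‖) * (∏ w : InfinitePlace K, ((Real.pi * w.mult) ^ (-(w.mult * s.re / 2)) * Real.Gamma (w.mult * s.re / 2))) *
        (‖(D : ℂ) ^ (-(s / 2))‖ * D ^ (s.re / 2)) := by ring
      _ = ∏ w : InfinitePlace K, (‖gI w s‖ * ((Real.pi * w.mult) ^ (-(w.mult * s.re / 2)) * Real.Gamma (w.mult * s.re / 2))) := by
        rw [e1, ← Finset.prod_mul_distrib, mul_one]
      _ ≤ ∏ w : InfinitePlace K, Real.exp (w.mult * (9 * s.im ^ 2)) := by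
        refine Finset.prod_le_prod (fun w _ => ?_) (fun w _ => gI_bound w hs)
        have := (mult_cases w).1
        have h0 : 0 < s.re := by linarith
        have := Real.Gamma_pos_of_pos (show 0 < w.mult * s.re / 2 by positivity)
        positivity
      _ = _ := by
        rw [← Real.exp_sum, ← Finset.sum_mul, hN, ← InfinitePlace.sum_mult_eq]
        push_cast; congr 1; ring
  have hFd : Differentiable ℂ (fun s => G1 s * (s * (s - 1) * H s + V)) :=
    hG1.mul (((differentiable_id.mul (differentiable_id.sub_const 1)).mul hH).add_const _)
  have hFz : ∀ s : ℂ, 1 < s.re → G1 s * (s * (s - 1) * H s + V) = (s - 1) * zK K s := by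
    intro s hs
    refine eqOn_half (f := fun s => G1 s * (s * (s - 1) * H s + V)) (g := fun s => (s - 1) * zK K s) hFd.differentiableOn
      ((differentiableOn_id.sub_const 1).mul (zK_diff K)) ?_ hs
    intro σ hσ
    have hs0 : (σ : ℂ) ≠ 0 := by rw [Complex.ofReal_ne_zero]; linarith
    have hs1 : (σ : ℂ) - 1 ≠ 0 := by rw [← Complex.ofReal_one, ← Complex.ofReal_sub, Complex.ofReal_ne_zero]; linarith
    have h4 := h1 σ hσ
    have h5 := hGr σ (by linarith)
    have h6 : (zK K σ : ℂ) = zR K σ := (zK_ofReal hσ).2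
    rw [h6]
    have h7 : (σ : ℂ) * (σ - 1) * H σ + V = σ * (σ - 1) * (gamD K σ * zR K σ : ℝ) := by
      rw [h4]; field_simp; ring
    rw [h7]; push_cast
    linear_combination ((σ : ℂ) - 1) * zR K σ * h5
  refine ⟨fun s => G1 s * (s * (s - 1) * H s + V), hFd, hFz, ?_, ?_⟩
  · intro s hs
    obtain ⟨l1, l2, l3⟩ := log3_ge hd
    have hns : s.re ≤ ‖s‖ := Complex.re_le_norm s
    have him : s.im ^ 2 ≤ (‖s‖ + 2) ^ 2 := by
      have := Complex.abs_im_le_norm s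
      rw [← sq_abs s.im]; gcongr; linarith
    have hn1 : ‖s - 1‖ ≤ ‖s‖ + 1 := (norm_sub_le _ _).trans (by simp)
    have hN5 : (N + 5) ^ 2 ≤ (N + 5) ^ 4 := by gcongr <;> linarith
    have hN53 : (N + 5) ^ 3 ≤ (N + 5) ^ 4 := by gcongr <;> linarith
    have hN51 : (N + 5) ≤ (N + 5) ^ 4 := le_self_pow₀ (by linarith) (by norm_num)
    have hQ : qK K = (N + 5) ^ 4 * Real.log (3 * D) := rfl
    have hq4 : (N + 5) ^ 4 ≤ qK K := by rw [hQ]; exact le_mul_of_one_le_right (by positivity) l1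
    have hql : (N + 5) * Real.log D ≤ qK K := by rw [hQ]; gcongr
    have hq0 := qK_ge K
    have hT : 4 ≤ (‖s‖ + 2) ^ 2 := by nlinarith only [norm_nonneg s]
    set T := (‖s‖ + 2) ^ 2 with hTd
    have hQT1 : qK K ≤ qK K * T := le_mul_of_one_le_right (by linarith only [hq0]) (by linarith only [hT])
    have hQT2 : T ≤ qK K * T := le_mul_of_one_le_left (by linarith only [hT]) (by linarith only [hq0])
    rcases le_or_gt s.re (N + 5) with hs5 | hs5
    · have b1 := gamD_ratio hs hs5
      have z2 : zR K (N + 5) ≤ 2 := zK_two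
      have g0 := gamD_pos K (show 0 < N + 5 by linarith)
      have gs := gamD_pos K (show 0 < s.re by linarith)
      have b2 := h3 s (N + 5) (by linarith) hs5 (by linarith)
      have b3 := h2 (N + 5) (by linarith)
      have b4 := hGb s hs
      set E1 := Real.exp (N * (2 + (N + 4) ^ 2) + Real.log D * ((N + 5) / 2)) with hE1
      have hgz : gamD K (N + 5) * zR K (N + 5) ≤ 2 * gamD K (N + 5) := by nlinarith only [g0, z2]
      have b5 : V ≤ 2 * gamD K (N + 5) * (N + 5) ^ 2 := by
        have : V = V * (1 / (N + 5 - 1) - 1 / (N + 5)) * ((N + 5) * (N + 4)) := by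
          have : N + 5 - 1 ≠ 0 := by linarith
          have : N + 4 ≠ 0 := by linarith
          field_simp; ring
        rw [this]
        have h8 : (N + 5) * (N + 4) ≤ (N + 5) ^ 2 := by nlinarith only [hN1]
        have h9 := mul_le_mul (b3.trans hgz) h8 (by positivity) (by positivity)
        exact h9
      have b6 : ‖G1 s‖ ≤ 2 * ‖s * G1 s‖ := by
        have h11 := norm_mul s (G1 s)
        have h12 := norm_nonneg (G1 s)
        have h13 : (1 / 2) * ‖G1 s‖ ≤ ‖s‖ * ‖G1 s‖ := mul_le_mul_of_nonneg_right (by linarith) h12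
        rw [h11]; linarith
      calc ‖G1 s * (s * (s - 1) * H s + V)‖ ≤ (2 * ‖s * G1 s‖) * (‖s‖ * ‖s - 1‖ * ‖H s‖ + V) := by
            rw [norm_mul]
            refine mul_le_mul b6 ((norm_add_le _ _).trans ?_) (norm_nonneg _) (by positivity)
            rw [norm_mul, norm_mul, Complex.norm_real, Real.norm_of_nonneg hV]
        _ ≤ (2 * ‖s * G1 s‖) * (‖s‖ * (‖s‖ + 1) * (2 * (2 * gamD K (N + 5))) + 2 * gamD K (N + 5) * (N + 5) ^ 2) := by
            gcongr
            linarith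
        _ = (2 * ‖s * G1 s‖) * gamD K (N + 5) * (4 * ‖s‖ * (‖s‖ + 1) + 2 * (N + 5) ^ 2) := by ring
        _ ≤ (2 * ‖s * G1 s‖) * (gamD K s.re * E1) * (4 * ‖s‖ * (‖s‖ + 1) + 2 * (N + 5) ^ 2) := by gcongr
        _ = 2 * (‖s * G1 s‖ * gamD K s.re) * E1 * (4 * ‖s‖ * (‖s‖ + 1) + 2 * (N + 5) ^ 2) := by ring
        _ ≤ Real.exp 1 * Real.exp (9 * N * s.im ^ 2) * E1 * Real.exp (4 * ‖s‖ * (‖s‖ + 1) + 2 * (N + 5) ^ 2) := by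
            gcongr
            · linarith [Real.exp_one_gt_d9]
            · linarith [Real.add_one_le_exp (4 * ‖s‖ * (‖s‖ + 1) + 2 * (N + 5) ^ 2)]
        _ ≤ _ := by
            rw [hE1, ← Real.exp_add, ← Real.exp_add, ← Real.exp_add]
            apply Real.exp_le_exp.mpr
            have c1 : 9 * N * s.im ^ 2 ≤ 9 * (qK K * T) := by
              rw [mul_assoc]; gcongr; linarith
            have c2 : N * (2 + (N + 4) ^ 2) ≤ qK K := le_trans (by nlinarith only [hN1]) (hN53.trans hq4)
            have c3 : 4 * ‖s‖ * (‖s‖ + 1) ≤ 4 * T := by rw [hTd]; nlinarith only [norm_nonneg s]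
            have c4 : Real.log D * ((N + 5) / 2) ≤ qK K := by
              have h10 : 0 ≤ (N + 5) * Real.log D := by positivity
              linarith
            linarith
    · have z2 : zR K (N + 5) ≤ 2 := zK_two
      simp only
      rw [hFz s (by linarith), norm_mul]
      have := zK_norm_le (K := K) (s := s) (σ := N + 5) (by linarith) hs5.le
      calc ‖s - 1‖ * ‖zK K s‖ ≤ (‖s‖ + 1) * 2 := by gcongr; linarith
        _ ≤ 40 * qK K * T + 1 := by
          have : ‖s‖ ≤ T := by rw [hTd]; nlinarith only [norm_nonneg s]
          linarith only [this, hQT1, hQT2, hq0]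
        _ ≤ _ := Real.add_one_le_exp _
  · have c1 := (hFd.continuous.tendsto 1)
    have c2 := (tendsto_sub_one_mul_dedekindZeta_nhdsGT K)
    have c3 : Tendsto (fun t : ℝ => (t : ℂ)) (𝓝[>] 1) (𝓝 1) := by
      have := (Complex.continuous_ofReal.tendsto 1)
      simp only [Complex.ofReal_one] at this
      exact this.mono_left nhdsWithin_le_nhds
    have c4 := c1.comp c3
    have c5 := tendsto_nhds_unique_of_eventuallyEq c4 c2 (by
      filter_upwards [self_mem_nhdsWithin] with t ht
      have ht : (1 : ℝ) < t := ht
      simp only [Function.comp_apply]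
      rw [hFz _ (by simpa using ht), zK_eq_dedekind])
    simp only at c5 ⊢
    rw [c5]
    exact_mod_cast (dedekindZeta_residue_pos K).ne'

theorem coef_bound {G : ℂ → ℂ} {c : ℂ} {r r' A : ℝ} (hA : 0 < A) (hr' : 0 < r') (hrr : r' < r)
    (hG : DifferentiableOn ℂ G (Metric.ball c r)) (h0 : ∀ z ∈ Metric.ball c r, G z ≠ 0)
    (hb : ∀ z ∈ Metric.ball c r, ‖G z‖ ≤ Real.exp A * ‖G c‖) (k : ℕ) :
    ‖iteratedDeriv k (fun z => deriv G z / G z) c‖ ≤ k.factorial * ((k + 1) * (2 * A / (r - r')) / r' ^ k) := by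
  have hcb : c ∈ Metric.ball c r := Metric.mem_ball_self (hr'.trans hrr)
  have hdG : DifferentiableOn ℂ (fun z => deriv G z / G z) (Metric.ball c r) :=
    (hG.deriv Metric.isOpen_ball).div hG h0
  obtain ⟨h, hc, hh⟩ := hdG.isExactOn_ball.with_val_at c 0
  have hhd : DifferentiableOn ℂ h (Metric.ball c r) := fun z hz => (hh z hz).differentiableAt.differentiableWithinAt
  have hconst : ∀ z ∈ Metric.ball c r, G z * Complex.exp (-h z) = G c := by
    intro z hz
    have hd : ∀ w ∈ Metric.ball c r, HasDerivAt (fun w => G w * Complex.exp (-h w)) 0 w := by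
      intro w hw
      have h1 : HasDerivAt G (deriv G w) w := (hG.differentiableAt (Metric.isOpen_ball.mem_nhds hw)).hasDerivAt
      refine (h1.mul (hh w hw).neg.cexp).congr_deriv ?_
      have := h0 w hw
      simp only [Pi.neg_apply]
      rw [mul_neg, mul_neg, mul_left_comm, mul_div_cancel₀ _ this]
      ring
    have := (convex_ball c r).is_const_of_fderivWithin_eq_zero (𝕜 := ℂ) (f := fun w => G w * Complex.exp (-h w))
      (fun w hw => (hd w hw).differentiableAt.differentiableWithinAt)
      (fun w hw => by
        have := (hd w hw).hasFDerivAt.hasFDerivWithinAt (s := Metric.ball c r)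
        rw [this.fderivWithin (Metric.isOpen_ball.uniqueDiffWithinAt hw)]; ext; simp) hz hcb
    simpa [hc] using this
  have hre : ∀ z ∈ Metric.ball c r, (h z).re ≤ A := by
    intro z hz
    have h1 := congrArg norm (hconst z hz)
    rw [norm_mul, Complex.norm_exp, Complex.neg_re] at h1
    have h2 := hb z hz
    have h3 : 0 < ‖G c‖ := norm_pos_iff.2 (h0 c hcb)
    have h4 : ‖G z‖ = Real.exp (h z).re * ‖G c‖ := by
      rw [← h1, mul_left_comm, ← Real.exp_add]; simp
    rw [h4] at h2
    exact Real.exp_le_exp.1 (le_of_mul_le_mul_right h2 h3)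
  have hbc : ∀ z ∈ Metric.sphere c r', ‖h z‖ ≤ 2 * A * r' / (r - r') := by
    intro z hz
    have hz' : ‖z - c‖ = r' := by simpa [dist_eq_norm] using hz
    have := Complex.borelCaratheodory_zero (f := fun w => h (c + w)) (R := r) (z := z - c) hA
      (hhd.comp (by fun_prop) (fun w hw => by simpa using hw))
      (fun w hw => hre _ (by simpa using hw)) (hr'.trans hrr) (by simpa [hz'] using hrr) (by simpa using hc)
    simpa [hz'] using this
  have hdc : DiffContOnCl ℂ h (Metric.ball c r') :=
    DifferentiableOn.diffContOnCl (hhd.mono ((closure_mono subset_rfl).trans (Metric.closure_ball_subset_closedBall.trans (Metric.closedBall_subset_ball hrr))))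
  have h1 := Complex.norm_iteratedDeriv_le_of_forall_mem_sphere_norm_le (k + 1) hr' hdc hbc
  have h2 : (fun z => deriv G z / G z) =ᶠ[𝓝 c] deriv h := by
    filter_upwards [Metric.isOpen_ball.mem_nhds hcb] with z hz using (hh z hz).deriv.symm
  rw [h2.iteratedDeriv_eq, ← iteratedDeriv_succ']
  refine h1.trans (le_of_eq ?_)
  have : r - r' ≠ 0 := by linarith
  rw [Nat.factorial_succ]; push_cast; field_simp; ring

theorem order_lim {F : ℂ → ℂ} (hF : Differentiable ℂ F) (h1 : F 1 ≠ 0) (s₀ : ℂ) :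
    ∃ m : ℕ, (F s₀ = 0 → 1 ≤ m) ∧ (∀ᶠ s in 𝓝[≠] s₀, F s ≠ 0) ∧
      Tendsto (fun s => (s - s₀) * (deriv F s / F s)) (𝓝[≠] s₀) (𝓝 (m : ℂ)) := by
  have han : AnalyticOnNhd ℂ F Set.univ := fun z _ => hF.analyticAt z
  have hne : ¬ ∀ᶠ z in 𝓝 s₀, F z = 0 := fun h =>
    h1 (han.eqOn_zero_of_preconnected_of_eventuallyEq_zero isPreconnected_univ (Set.mem_univ s₀) h (Set.mem_univ 1))
  have hord : analyticOrderAt F s₀ ≠ ⊤ := by rwa [Ne, analyticOrderAt_eq_top]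
  obtain ⟨g, hg, hg0, hev⟩ := ((hF.analyticAt s₀).analyticOrderAt_ne_top).1 hord
  set m := analyticOrderNatAt F s₀
  have hgne : ∀ᶠ s in 𝓝 s₀, g s ≠ 0 := hg.continuousAt.eventually_ne hg0
  refine ⟨m, ?_, ?_, ?_⟩
  · intro h
    by_contra hm
    have : m = 0 := by omega
    have := hev.self_of_nhds
    simp_all
  · filter_upwards [hgne.filter_mono nhdsWithin_le_nhds, hev.filter_mono nhdsWithin_le_nhds, self_mem_nhdsWithin] with s h1 h2 h3
    rw [h2]
    exact mul_ne_zero (pow_ne_zero _ (sub_ne_zero.2 h3)) h1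
  · have h2 : Tendsto (fun s => (m : ℂ) + (s - s₀) * (deriv g s / g s)) (𝓝 s₀) (𝓝 m) := by
      have hc : ContinuousAt (fun s => (m : ℂ) + (s - s₀) * (deriv g s / g s)) s₀ :=
        continuousAt_const.add ((continuousAt_id.sub continuousAt_const).mul (hg.deriv.continuousAt.div hg.continuousAt hg0))
      simpa [ContinuousAt] using hc
    refine (h2.mono_left nhdsWithin_le_nhds).congr' ?_
    filter_upwards [hgne.filter_mono nhdsWithin_le_nhds, hev.eventually_nhds.filter_mono nhdsWithin_le_nhds, self_mem_nhdsWithin,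
      hg.eventually_analyticAt.filter_mono nhdsWithin_le_nhds] with s h1 h2 h3 h4
    have h3' : s - s₀ ≠ 0 := sub_ne_zero.2 h3
    have h2' : F =ᶠ[𝓝 s] fun z => (z - s₀) ^ m • g z := h2
    rw [h2'.deriv_eq, h2'.self_of_nhds]
    have hd : HasDerivAt (fun z => (z - s₀) ^ m • g z) ((s - s₀) ^ m • deriv g s + (m * (s - s₀) ^ (m - 1) * 1) • g s) s :=
      (((hasDerivAt_id s).sub_const s₀).pow m).smul h4.differentiableAt.hasDerivAt
    rw [hd.deriv]
    simp only [smul_eq_mul, id, mul_one]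
    rcases Nat.eq_zero_or_pos m with hm | hm
    · rw [hm]; simp
    · obtain ⟨j, hj⟩ : ∃ j, m = j + 1 := ⟨m - 1, by omega⟩
      rw [hj]; simp only [Nat.add_sub_cancel, pow_succ]
      field_simp
      push_cast; ring

noncomputable def LK (K : Type*) [Field K] [NumberField K] (s : ℂ) : ℂ := LSeries (fun n => (lamK K n : ℂ)) s

def IsFK (K : Type*) [Field K] [NumberField K] (F : ℂ → ℂ) : Prop :=
  Differentiable ℂ F ∧ (∀ s : ℂ, 1 < s.re → F s = (s - 1) * zK K s) ∧
    (∀ s : ℂ, 1 / 2 ≤ s.re → ‖F s‖ ≤ Real.exp (40 * qK K * (‖s‖ + 2) ^ 2)) ∧ F 1 ≠ 0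

theorem LK_diff (K : Type*) [Field K] [NumberField K] : DifferentiableOn ℂ (LK K) {s : ℂ | 1 < s.re} :=
  (LSeries_differentiableOn _).mono fun _ hs => lamK_absc K hs

theorem F_deriv {F : ℂ → ℂ} (hF : IsFK K F) {s : ℂ} (hs : 1 < s.re) :
    deriv F s * (s - 1) = F s * (1 - (s - 1) * LK K s) := by
  have h1 : F =ᶠ[𝓝 s] fun s => (s - 1) * zK K s := by
    filter_upwards [halfplane_open.mem_nhds hs] with z hz using hF.2.1 z hz
  have h2 : HasDerivAt (zK K) (deriv (zK K) s) s := ((zK_diff K).differentiableAt (halfplane_open.mem_nhds hs)).hasDerivAt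
  have h3 : HasDerivAt (fun s => (s - 1) * zK K s) (1 * zK K s + (s - 1) * deriv (zK K) s) s :=
    ((hasDerivAt_id s).sub_const 1).mul h2
  rw [h1.deriv_eq, h1.self_of_nhds, h3.deriv, zK_deriv hs, ← LK]
  ring

theorem F_logd {F : ℂ → ℂ} (hF : IsFK K F) {s : ℂ} (hs : 1 < s.re)
    (h : F s ≠ 0) : deriv F s / F s = (s - 1)⁻¹ - LK K s := by
  have h1 : s - 1 ≠ 0 := by
    intro h; rw [sub_eq_zero.1 h] at hs; simp at hs
  have := F_deriv hF hs
  field_simp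
  linear_combination this

theorem F_ne {F : ℂ → ℂ} (hF : IsFK K F) {s : ℂ} (hs : 1 < s.re) : F s ≠ 0 := by
  intro h
  obtain ⟨m, hm, hne, ht⟩ := order_lim hF.1 hF.2.2.2 s
  have h1 : s - 1 ≠ 0 := by
    intro h; rw [sub_eq_zero.1 h] at hs; simp at hs
  have hc : ContinuousAt (fun z => (z - s) * ((z - 1)⁻¹ - LK K z)) s :=
    (continuousAt_id.sub continuousAt_const).mul (((continuousAt_id.sub continuousAt_const).inv₀ h1).sub
      ((LK_diff K).differentiableAt (halfplane_open.mem_nhds hs)).continuousAt)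
  have h2 : Tendsto (fun z => (z - s) * ((z - 1)⁻¹ - LK K z)) (𝓝[≠] s) (𝓝 0) := by
    have := hc.tendsto; simp only [sub_self, zero_mul] at this; exact this.mono_left nhdsWithin_le_nhds
  have h3 := tendsto_nhds_unique (ht.congr' (by
    filter_upwards [hne, mem_nhdsWithin_of_mem_nhds (halfplane_open.mem_nhds hs)] with z hz hz'
    rw [F_logd hF hz' hz])) h2
  have := hm h
  have h4 : m = 0 := by exact_mod_cast h3
  omega

theorem lam_341 (K : Type*) [Field K] [NumberField K] {σ : ℝ} (hσ : 1 < σ) (t : ℝ) :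
    0 ≤ (3 * LK K σ + 4 * LK K (σ + t * Complex.I) + LK K (σ + 2 * t * Complex.I)).re := by
  have hs0 := lamK_summable K (s := σ) (by simpa using hσ)
  have hs1 := lamK_summable K (s := σ + t * Complex.I) (by simpa using hσ)
  have hs2 := lamK_summable K (s := σ + 2 * t * Complex.I) (by simpa using hσ)
  have h := ((hs0.hasSum.mul_left 3).add (hs1.hasSum.mul_left 4)).add hs2.hasSum
  have h' := Complex.hasSum_re h
  rw [LK, LK, LK, LSeries, LSeries, LSeries, ← h'.tsum_eq]
  refine tsum_nonneg fun n => ?_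
  rcases eq_or_ne n 0 with rfl | hn
  · simp
  have hn0 : (n : ℂ) ≠ 0 := by exact_mod_cast hn
  simp only [LSeries.term_of_ne_zero hn]
  set w := (n : ℂ) ^ (-(t * Complex.I)) with hw
  have hwn : ‖w‖ = 1 := by
    rw [hw, Complex.norm_natCast_cpow_of_pos (Nat.pos_of_ne_zero hn)]; simp
  have e1 : (lamK K n : ℂ) / (n : ℂ) ^ (σ + t * Complex.I : ℂ) = (lamK K n : ℂ) / (n : ℂ) ^ (σ : ℂ) * w := by
    rw [Complex.cpow_add _ _ hn0, hw, Complex.cpow_neg]; field_simp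
  have e2 : (lamK K n : ℂ) / (n : ℂ) ^ (σ + 2 * t * Complex.I : ℂ) = (lamK K n : ℂ) / (n : ℂ) ^ (σ : ℂ) * w ^ 2 := by
    rw [Complex.cpow_add _ _ hn0, mul_assoc, two_mul, Complex.cpow_add _ _ hn0, hw, Complex.cpow_neg]; field_simp
  have e0 : (lamK K n : ℂ) / (n : ℂ) ^ (σ : ℂ) = ((lamK K n / (n : ℝ) ^ σ : ℝ) : ℂ) := by
    rw [Complex.ofReal_div, Complex.ofReal_cpow (Nat.cast_nonneg n)]; simp
  rw [e1, e2, e0]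
  have e3 : 3 * ((lamK K n / (n : ℝ) ^ σ : ℝ) : ℂ) + 4 * (((lamK K n / (n : ℝ) ^ σ : ℝ) : ℂ) * w) + ((lamK K n / (n : ℝ) ^ σ : ℝ) : ℂ) * w ^ 2
     = ((lamK K n / (n : ℝ) ^ σ : ℝ) : ℂ) * (3 + 4 * w + w ^ 2) := by ring
  rw [e3, Complex.re_ofReal_mul]
  have h0 : 0 ≤ lamK K n := lamK_nonneg n
  refine mul_nonneg (by positivity) ?_
  have h5 : w.re * w.re + w.im * w.im = 1 := by
    rw [← Complex.normSq_apply, Complex.normSq_eq_norm_sq, hwn]; norm_num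
  have : (3 + 4 * w + w ^ 2).re = 2 * (1 + w.re) ^ 2 := by
    simp [pow_two]; nlinarith
  rw [this]; positivity

theorem F_line {F : ℂ → ℂ} (hF : IsFK K F) {s : ℂ} (hs : s.re = 1) : F s ≠ 0 := by
  intro h
  obtain ⟨t, rfl⟩ : ∃ t : ℝ, s = 1 + t * Complex.I := ⟨s.im, by apply Complex.ext <;> simp [hs]⟩
  have ht : t ≠ 0 := by rintro rfl; simp [hF.2.2.2] at h
  have key : ∀ u : ℝ, u ≠ 0 → ∃ m : ℕ, (F (1 + u * Complex.I) = 0 → 1 ≤ m) ∧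
      Tendsto (fun σ : ℝ => (σ - 1 : ℂ) * LK K (σ + u * Complex.I)) (𝓝[>] 1) (𝓝 (-m : ℂ)) := by
    intro u hu
    obtain ⟨m, hm, hne, hl⟩ := order_lim hF.1 hF.2.2.2 (1 + u * Complex.I)
    refine ⟨m, hm, ?_⟩
    have hpath : Tendsto (fun σ : ℝ => (σ + u * Complex.I : ℂ)) (𝓝[>] 1) (𝓝[≠] (1 + u * Complex.I)) := by
      refine tendsto_nhdsWithin_iff.2 ⟨?_, ?_⟩
      · have : Continuous (fun σ : ℝ => (σ + u * Complex.I : ℂ)) := by fun_prop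
        have h := this.tendsto 1
        simp only [Complex.ofReal_one] at h
        exact h.mono_left nhdsWithin_le_nhds
      · filter_upwards [self_mem_nhdsWithin] with σ hσ
        intro he
        have := congrArg Complex.re he
        simp at this
        exact (ne_of_gt hσ) this
    have h1 := hl.comp hpath
    have h2 : Tendsto (fun σ : ℝ => (σ - 1 : ℂ) * (σ + u * Complex.I - 1)⁻¹) (𝓝[>] 1) (𝓝 0) := by
      have hc : ContinuousAt (fun σ : ℝ => (σ - 1 : ℂ) * (σ + u * Complex.I - 1)⁻¹) 1 := by
        refine ContinuousAt.mul (by fun_prop) (ContinuousAt.inv₀ (by fun_prop) ?_)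
        simp [hu]
      have := hc.tendsto
      simp only [Complex.ofReal_one, sub_self, zero_mul] at this
      exact this.mono_left nhdsWithin_le_nhds
    have h3 := h2.sub h1
    rw [zero_sub] at h3
    refine h3.congr' ?_
    filter_upwards [self_mem_nhdsWithin] with σ hσ
    have hσ' : 1 < (σ + u * Complex.I : ℂ).re := by simpa using hσ
    simp only [Function.comp]
    rw [F_logd hF hσ' (F_ne hF hσ')]
    ring
  have key0 : Tendsto (fun σ : ℝ => (σ - 1 : ℂ) * LK K σ) (𝓝[>] 1) (𝓝 1) := by
    have hc : ContinuousAt (fun σ : ℝ => (1 : ℂ) - (σ - 1 : ℂ) * (deriv F σ / F σ)) 1 := by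
      refine continuousAt_const.sub (ContinuousAt.mul (by fun_prop) (ContinuousAt.div ?_ ?_ (by simpa using hF.2.2.2)))
      · have : Differentiable ℂ (deriv F) := hF.1.deriv
        exact (this.continuous.comp Complex.continuous_ofReal).continuousAt
      · exact (hF.1.continuous.comp Complex.continuous_ofReal).continuousAt
    have h1 := hc.tendsto
    simp only [Complex.ofReal_one, sub_self, zero_mul, sub_zero] at h1
    refine (h1.mono_left nhdsWithin_le_nhds).congr' ?_
    filter_upwards [self_mem_nhdsWithin] with σ hσ
    have hσ' : 1 < (σ : ℂ).re := by simpa using hσ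
    have h2 : (σ : ℂ) - 1 ≠ 0 := by
      intro h; rw [sub_eq_zero.1 h] at hσ'; simp at hσ'
    rw [F_logd hF hσ' (F_ne hF hσ')]
    field_simp; ring
  obtain ⟨m, hm, h1⟩ := key t ht
  obtain ⟨m', -, h2⟩ := key (2 * t) (by simpa using ht)
  have h3 := ((key0.const_mul 3).add (h1.const_mul 4)).add h2
  have h4 := (Complex.continuous_re.tendsto _).comp h3
  have h5 := ge_of_tendsto h4 (b := 0) (by
    filter_upwards [self_mem_nhdsWithin] with σ hσ
    have hσ1 : 1 < σ := hσ
    have h6 := lam_341 K hσ1 t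
    have : (3 * ((σ - 1 : ℂ) * LK K σ) + 4 * ((σ - 1 : ℂ) * LK K (σ + t * Complex.I)) +
        (σ - 1 : ℂ) * LK K (σ + (2 * t : ℝ) * Complex.I)) = ((σ - 1 : ℝ) : ℂ) *
        (3 * LK K σ + 4 * LK K (σ + t * Complex.I) + LK K (σ + 2 * t * Complex.I)) := by push_cast; ring
    simp only [Function.comp]
    rw [this, Complex.re_ofReal_mul]
    exact mul_nonneg (by linarith) h6)
  have h6 := hm h
  simp at h5
  have : (1 : ℝ) ≤ m := by exact_mod_cast h6
  have : (0 : ℝ) ≤ m' := Nat.cast_nonneg _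
  linarith

theorem LK_conj (K : Type*) [Field K] [NumberField K] (s : ℂ) : zK K ((starRingEnd ℂ) s) = (starRingEnd ℂ) (zK K s) := by
  rw [zK, zK, LSeries, LSeries, Complex.conj_tsum]
  refine tsum_congr fun n => ?_
  rcases eq_or_ne n 0 with rfl | hn
  · simp
  · rw [LSeries.term_of_ne_zero hn, LSeries.term_of_ne_zero hn, map_div₀, Complex.conj_ofReal,
      Complex.cpow_conj _ _ (by rw [Complex.natCast_arg]; exact Real.pi_ne_zero.symm), Complex.conj_natCast]

theorem F_conj {F : ℂ → ℂ} (hF : IsFK K F) (s : ℂ) :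
    F ((starRingEnd ℂ) s) = (starRingEnd ℂ) (F s) := by
  have h1 : Differentiable ℂ ((starRingEnd ℂ) ∘ F ∘ (starRingEnd ℂ)) := fun z => by
    rw [differentiableAt_conj_conj_iff]
    exact hF.1 _
  have h2 : AnalyticOnNhd ℂ ((starRingEnd ℂ) ∘ F ∘ (starRingEnd ℂ)) Set.univ := fun z _ => h1.analyticAt z
  have h3 : AnalyticOnNhd ℂ F Set.univ := fun z _ => hF.1.analyticAt z
  have h4 := h2.eq_of_eventuallyEq h3 (z₀ := 2) (by
    filter_upwards [halfplane_open.mem_nhds (show (2 : ℂ) ∈ {s : ℂ | 1 < s.re} by simp)] with z hz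
    have hz1 : 1 < z.re := hz
    simp only [Function.comp]
    rw [hF.2.1 _ hz, hF.2.1 _ (by simpa using hz1), LK_conj]
    simp)
  have := congrFun h4 s
  simp only [Function.comp] at this
  rw [← this, Complex.conj_conj]

noncomputable def aK (K : Type*) [Field K] [NumberField K] (R : ℝ) (k : ℕ) : ℝ :=
  ∑' m : ℕ, lamK K m * (Real.log m) ^ k * (m : ℝ) ^ (-(1 + R))

theorem logMul_iter (a : ℕ → ℝ) (k : ℕ) :
    (LSeries.logMul^[k] fun n => (a n : ℂ)) = fun n => ((a n * (Real.log n) ^ k : ℝ) : ℂ) := by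
  induction k with
  | zero => simp
  | succ k ih =>
    rw [Function.iterate_succ', Function.comp, ih]
    ext n
    simp only [LSeries.logMul]
    rw [← Complex.natCast_log]; push_cast; ring

theorem aK_spec {R : ℝ} (hR : 0 < R) (k : ℕ) :
    Summable (fun m : ℕ => lamK K m * (Real.log m) ^ k * (m : ℝ) ^ (-(1 + R))) ∧
    iteratedDeriv k (LK K) ((1 + R : ℝ) : ℂ) = (-1) ^ k * (aK K R k : ℂ) := by
  have hs : 1 < (((1 + R : ℝ) : ℂ)).re := by simpa using hR
  have h1 := lamK_absc K hs
  have h0 : lamK K 0 * (Real.log (0 : ℕ)) ^ k = 0 := by rw [lamK_zero, zero_mul]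
  have h3 := LSeries_real (a := fun n => lamK K n * (Real.log n) ^ k) h0 (1 + R)
  constructor
  · refine h3.1.1 ?_
    rw [← logMul_iter]
    exact LSeriesSummable_of_abscissaOfAbsConv_lt_re (by rwa [LSeries.absicssaOfAbsConv_logPowMul])
  · have h2 := LSeries_iteratedDeriv k h1
    rw [logMul_iter, h3.2] at h2
    exact h2

theorem itd_F {F : ℂ → ℂ} (hF : IsFK K F) {R : ℝ} (hR : 0 < R) (k : ℕ) :
    iteratedDeriv k (fun z => deriv F z / F z) ((1 + R : ℝ) : ℂ) =
      (-1) ^ k * ((k.factorial * (R ^ (k + 1))⁻¹ - aK K R k : ℝ) : ℂ) := by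
  have hs : 1 < (((1 + R : ℝ) : ℂ)).re := by simpa using hR
  have h1 : (fun z => deriv F z / F z) =ᶠ[𝓝 ((1 + R : ℝ) : ℂ)] (fun z => (1 * z - 1)⁻¹) - LK K := by
    filter_upwards [halfplane_open.mem_nhds hs] with z hz
    rw [F_logd hF hz (F_ne hF hz)]; simp
  rw [h1.iteratedDeriv_eq, iteratedDeriv_sub, (aK_spec hR k).2, iteratedDeriv_eq_iterate, iter_deriv_inv_linear_sub]
  · have e : (1 : ℂ) * ((1 + R : ℝ) : ℂ) - 1 = R := by push_cast; ring
    simp only [e]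
    have : (-1 - k : ℤ) = -((k + 1 : ℕ) : ℤ) := by push_cast; ring
    rw [this, zpow_neg, zpow_natCast]
    push_cast; ring
  · refine (AnalyticAt.contDiffAt ?_)
    refine AnalyticAt.inv (by fun_prop) ?_
    have : (R : ℂ) ≠ 0 := by exact_mod_cast hR.ne'
    simpa using this
  · exact ((LK_diff K).analyticAt (halfplane_open.mem_nhds hs)).contDiffAt

theorem aK_near {F : ℂ → ℂ} (hF : IsFK K F) {R r r' A : ℝ} (hR : 0 < R)
    (hA : 0 < A) (hr' : 0 < r') (hrr : r' < r)
    (h0 : ∀ z ∈ Metric.ball ((1 + R : ℝ) : ℂ) r, F z ≠ 0)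
    (hb : ∀ z ∈ Metric.ball ((1 + R : ℝ) : ℂ) r, ‖F z‖ ≤ Real.exp A * ‖F ((1 + R : ℝ) : ℂ)‖) (k : ℕ) :
    |aK K R k / k.factorial - (R ^ (k + 1))⁻¹| ≤ (k + 1) * (2 * A / (r - r')) / r' ^ k := by
  have h := coef_bound hA hr' hrr hF.1.differentiableOn h0 hb k
  rw [itd_F hF hR, norm_mul, norm_pow, norm_neg, norm_one, one_pow, one_mul, Complex.norm_real, Real.norm_eq_abs] at h
  have hk : (0 : ℝ) < k.factorial := by exact_mod_cast k.factorial_pos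
  rw [← mul_le_mul_iff_right₀ hk]
  refine le_trans (le_of_eq ?_) h
  rw [abs_sub_comm, ← abs_of_pos hk, ← abs_mul, abs_of_pos hk]
  congr 1; field_simp

theorem zK_ge_one {σ : ℝ} (hσ : 1 < σ) : 1 ≤ ‖zK K σ‖ := by
  rw [(zK_ofReal hσ).2, Complex.norm_real]
  refine le_trans ?_ (le_abs_self _)
  have h := (zK_ofReal (K := K) hσ).1
  refine le_trans ?_ (h.le_tsum 1 fun j _ => by positivity)
  have : 1 ≤ rK K 1 := by
    have := nzN_fin (K := K) 1
    exact Nat.card_pos_iff.2 ⟨⟨⟨⟨⊤, by simp⟩, by simp [nzN]⟩⟩, this⟩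
  have h2 : (1 : ℝ) ≤ rK K 1 := by exact_mod_cast this
  simpa using h2

theorem F_growth {F : ℂ → ℂ} (hF : IsFK K F) {R δ : ℝ} (hR : 1 ≤ R)
    (hδ : δ ≤ 1 / 2) : ∀ z ∈ Metric.ball ((1 + R : ℝ) : ℂ) (R + δ),
      ‖F z‖ ≤ Real.exp (1440 * qK K * R ^ 2) * ‖F ((1 + R : ℝ) : ℂ)‖ := by
  intro z hz
  rw [Metric.mem_ball, dist_eq_norm] at hz
  have h1 : 1 ≤ ‖F ((1 + R : ℝ) : ℂ)‖ := by
    rw [hF.2.1 _ (by simp; linarith), norm_mul]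
    have h2 := zK_ge_one (K := K) (σ := 1 + R) (by linarith)
    have h3 : ‖((1 + R : ℝ) : ℂ) - 1‖ = R := by
      rw [show ((1 + R : ℝ) : ℂ) - 1 = (R : ℂ) by push_cast; ring, Complex.norm_real, Real.norm_of_nonneg (by linarith)]
    rw [h3]; nlinarith
  have h2 : 1 / 2 ≤ z.re := by
    have := (Complex.abs_re_le_norm (z - ((1 + R : ℝ) : ℂ))).trans hz.le
    rw [Complex.sub_re, Complex.ofReal_re, abs_le] at this
    linarith
  refine (hF.2.2.1 z h2).trans ?_
  refine le_trans ?_ (le_mul_of_one_le_right (Real.exp_pos _).le h1)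
  apply Real.exp_le_exp.2
  have h3 : ‖z‖ ≤ 2 * R + 3 / 2 := by
    have := norm_add_le (z - ((1 + R : ℝ) : ℂ)) ((1 + R : ℝ) : ℂ)
    rw [sub_add_cancel, Complex.norm_real, Real.norm_of_nonneg (by linarith)] at this
    linarith
  have h4 := qK_ge (K := K)
  have h5 : (‖z‖ + 2) ^ 2 ≤ (6 * R) ^ 2 := pow_le_pow_left₀ (by positivity) (by linarith) 2
  nlinarith [mul_le_mul_of_nonneg_left h5 (by linarith : 0 ≤ 40 * qK K)]

theorem sum_tail_T (K : Type*) [Field K] [NumberField K] :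
    Summable (fun m : ℕ => lamK K m * (m : ℝ) ^ (-4 : ℝ)) ∧
    ∑' m : ℕ, lamK K m * (m : ℝ) ^ (-4 : ℝ) ≤ 2 * Module.finrank ℚ K := by
  have h1 := hasSum_zeta_two.mul_left (Module.finrank ℚ K : ℝ)
  have hle : ∀ m : ℕ, lamK K m * (m : ℝ) ^ (-4 : ℝ) ≤ (Module.finrank ℚ K : ℝ) * (1 / (m : ℝ) ^ 2) := by
    intro m
    rcases Nat.eq_zero_or_pos m with rfl | hm
    · simp [lamK_zero]
    · have hm1 : (1 : ℝ) ≤ m := by exact_mod_cast hm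
      have h2 : lamK K m ≤ Module.finrank ℚ K * m := by
        refine (lamK_le m).trans (mul_le_mul_of_nonneg_left ?_ (Nat.cast_nonneg _))
        exact ArithmeticFunction.vonMangoldt_le_log.trans (Real.log_le_self (by positivity))
      refine (mul_le_mul_of_nonneg_right h2 (by positivity)).trans ?_
      rw [mul_assoc]
      refine mul_le_mul_of_nonneg_left ?_ (Nat.cast_nonneg _)
      rw [Real.rpow_neg (by positivity), show (4 : ℝ) = ((4 : ℕ) : ℝ) by norm_num, Real.rpow_natCast, ← div_eq_mul_inv, div_le_div_iff₀ (by positivity) (by positivity)]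
      nlinarith [pow_le_pow_right₀ hm1 (show 3 ≤ 4 by norm_num)]
  have hs : Summable (fun m : ℕ => lamK K m * (m : ℝ) ^ (-4 : ℝ)) :=
    Summable.of_nonneg_of_le (fun m => mul_nonneg (lamK_nonneg m) (by positivity)) hle h1.summable
  refine ⟨hs, (Summable.tsum_le_tsum hle hs h1.summable).trans ?_⟩
  rw [h1.tsum_eq, mul_comm]
  refine mul_le_mul_of_nonneg_right ?_ (Nat.cast_nonneg _)
  have := Real.pi_lt_d2
  have := Real.pi_pos
  nlinarith

theorem exp_trunc {z y : ℝ} (hz : 0 < z) (hz1 : z ≤ 1) (hy : 0 ≤ y) (N : ℕ) :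
    ∑ k ∈ Finset.range N, y ^ k / k.factorial ≤ (z ^ N)⁻¹ * Real.exp (z * y) := by
  have h := Real.sum_le_exp_of_nonneg (mul_nonneg hz.le hy) N
  refine le_trans ?_ (mul_le_mul_of_nonneg_left h (by positivity))
  rw [Finset.mul_sum]
  refine Finset.sum_le_sum fun k hk => ?_
  have hk := (Finset.mem_range.1 hk).le
  have h1 : z ^ N ≤ z ^ k := pow_le_pow_of_le_one hz.le hz1 hk
  rw [mul_pow, mul_div_assoc, ← mul_assoc]
  refine le_mul_of_one_le_left (by positivity) ?_
  rw [← div_eq_inv_mul, le_div_iff₀ (by positivity), one_mul]; exact h1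

noncomputable def wt (R : ℝ) (N m : ℕ) : ℝ :=
  (m : ℝ) ^ (-(1 + R)) * ∑ k ∈ Finset.range N, ((R + 1) * Real.log m) ^ k / k.factorial

theorem wt_le {R z : ℝ} (hR : 0 < R) (hz : 0 < z) (hz1 : z ≤ 1) (N : ℕ) {m : ℕ} (hm : 1 ≤ m) :
    wt R N m ≤ (z ^ N)⁻¹ * Real.exp (-((1 - z) * (R + 1) * Real.log m)) := by
  have hm0 : (1 : ℝ) ≤ m := by exact_mod_cast hm
  have hl : 0 ≤ Real.log m := Real.log_nonneg hm0
  have h := exp_trunc hz hz1 (mul_nonneg (by linarith : 0 ≤ R + 1) hl) N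
  rw [wt, Real.rpow_def_of_pos (by linarith)]
  refine (mul_le_mul_of_nonneg_left h (Real.exp_pos _).le).trans (le_of_eq ?_)
  rw [mul_left_comm, ← Real.exp_add]; congr 2; ring

theorem wt_sum {R : ℝ} (hR : 0 < R) (N : ℕ) :
    HasSum (fun m => lamK K m * wt R N m) (∑ k ∈ Finset.range N, (R + 1) ^ k * (aK K R k / k.factorial)) := by
  have h : ∀ k ∈ Finset.range N, HasSum (fun m : ℕ => (R + 1) ^ k / k.factorial * (lamK K m * (Real.log m) ^ k * (m : ℝ) ^ (-(1 + R))))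
      ((R + 1) ^ k * (aK K R k / k.factorial)) := by
    intro k _
    have := ((aK_spec (K := K) hR k).1.hasSum.mul_left ((R + 1) ^ k / k.factorial))
    have e : (R + 1) ^ k * (aK K R k / k.factorial) = (R + 1) ^ k / k.factorial * aK K R k := by ring
    rw [e]; exact this
  convert hasSum_sum h using 1
  ext m
  rw [wt, Finset.mul_sum, Finset.mul_sum]
  refine Finset.sum_congr rfl fun k _ => ?_
  rw [mul_pow]; ring

theorem main_S {F : ℂ → ℂ} (hF : IsFK K F) {R δ X η : ℝ} (hR : 1 ≤ R)
    (hδ0 : 0 < δ) (hδ : δ ≤ 1 / 2) (hX : 1 ≤ X) (hη0 : 0 < η) (hη : η ≤ 1) (hRη : 4 ≤ (R + 1) * (η / (4 * X)))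
    (h0 : ∀ z ∈ Metric.ball ((1 + R : ℝ) : ℂ) (R + δ), F z ≠ 0) :
    Real.exp X * (1 - η - (X + 1) / R) - 1 - (R * X) ^ 2 * (5760 * qK K * R ^ 2 / δ) * Real.exp (X * (1 - δ / 2))
      - 2 * Module.finrank ℚ K * Real.exp (4 * X - R * η ^ 2 / (8 * X)) ≤
    ∑ m ∈ Finset.range (⌊Real.exp X⌋₊ + 1), lamK K m := by
  have hR0 : 0 < R := by linarith
  have hq := qK_ge (K := K)
  set N := ⌊R * (X - η)⌋₊ with hN
  have hN1 : (N : ℝ) ≤ R * (X - η) := Nat.floor_le (mul_nonneg hR0.le (by linarith))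
  have hN2 : R * (X - η) - 1 ≤ N := by have := Nat.lt_floor_add_one (R * (X - η)); linarith
  have hNX : (N : ℝ) ≤ R * X := hN1.trans (by nlinarith)
  set a := η / (4 * X) with ha
  have ha0 : 0 < a := by positivity
  have ha1 : a ≤ 1 / 4 := by rw [ha, div_le_iff₀ (by positivity)]; linarith
  have haX : a * X = η / 4 := by rw [ha]; field_simp
  have hs := wt_sum (K := K) hR0 N
  have hlow : Real.exp X * (1 - η - (X + 1) / R) - 1 - (R * X) ^ 2 * (5760 * qK K * R ^ 2 / δ) * Real.exp (X * (1 - δ / 2)) ≤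
      ∑ k ∈ Finset.range N, (R + 1) ^ k * (aK K R k / k.factorial) := by
    set B := 5760 * qK K * R ^ 2 / δ with hB
    have hB0 : 0 ≤ B := by positivity
    set r' := R + δ / 2 with hr'
    set q := (R + 1) / r' with hqd
    have hr0 : 0 < r' := by positivity
    have hq1 : 1 ≤ q := by rw [hqd, le_div_iff₀ hr0]; linarith
    have hqN : q ^ N ≤ Real.exp (X * (1 - δ / 2)) := by
      have h1 : q ≤ Real.exp ((1 - δ / 2) / R) := by
        have : q ≤ 1 + (1 - δ / 2) / R := by
          rw [hqd, div_le_iff₀ hr0, hr']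
          have : (1 + (1 - δ / 2) / R) * (R + δ / 2) = R + 1 + (1 - δ / 2) / R * (δ / 2) := by field_simp; ring
          rw [this]
          have : 0 ≤ (1 - δ / 2) / R * (δ / 2) := mul_nonneg (div_nonneg (by linarith) hR0.le) (by linarith)
          linarith
        refine this.trans ?_
        rw [add_comm]; exact Real.add_one_le_exp _
      refine (pow_le_pow_left₀ (by linarith) h1 N).trans ?_
      rw [← Real.exp_nat_mul]
      apply Real.exp_le_exp.2
      rw [mul_div_assoc', div_le_iff₀ hR0]
      nlinarith
    have hk : ∀ k ∈ Finset.range N, ((1 + 1 / R) ^ k * (1 / R)) - N * B * q ^ N ≤ (R + 1) ^ k * (aK K R k / k.factorial) := by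
      intro k hk
      have hkN := Finset.mem_range.1 hk
      have h1 := aK_near hF hR0 (A := 1440 * qK K * R ^ 2) (by positivity) hr0 (r := R + δ) (by rw [hr']; linarith) h0
        (F_growth hF hR hδ) k
      have h2 := (abs_le.1 h1).1
      have e1 : 2 * (1440 * qK K * R ^ 2) / (R + δ - r') = B := by
        rw [hB, hr', show R + δ - (R + δ / 2) = δ / 2 by ring]; field_simp; norm_num
      rw [e1] at h2
      have h3 := mul_le_mul_of_nonneg_left h2 (by positivity : 0 ≤ (R + 1) ^ k)
      have e2 : (R + 1) ^ k * -((↑k + 1) * B / r' ^ k) = -((k + 1) * B * q ^ k) := by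
        rw [hqd, div_pow]; field_simp
      have e3 : (R + 1) ^ k * (aK K R k / k.factorial - (R ^ (k + 1))⁻¹) =
          (R + 1) ^ k * (aK K R k / k.factorial) - (1 + 1 / R) ^ k * (1 / R) := by
        have : 1 + 1 / R = (R + 1) / R := by field_simp
        rw [this, div_pow, pow_succ]; field_simp
      rw [e2, e3] at h3
      have h4 : ((k : ℝ) + 1) * B * q ^ k ≤ N * B * q ^ N := by
        have : (k : ℝ) + 1 ≤ N := by exact_mod_cast hkN
        have := pow_le_pow_right₀ hq1 hkN.le
        gcongr
      linarith only [h3, h4]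
    refine le_trans ?_ (Finset.sum_le_sum hk)
    rw [Finset.sum_sub_distrib, ← Finset.sum_mul, Finset.sum_const, Finset.card_range, nsmul_eq_mul, geom_sum_eq (by simp [hR0.ne'])]
    have e4 : ((1 + 1 / R) ^ N - 1) / (1 + 1 / R - 1) * (1 / R) = (1 + 1 / R) ^ N - 1 := by field_simp; ring
    rw [e4]
    have h5 : Real.exp X * (1 - η - (X + 1) / R) ≤ (1 + 1 / R) ^ N := by
      have h6 : Real.exp (X - η - (X + 1) / R) ≤ (1 + 1 / R) ^ N := by
        have h7 : Real.exp (1 / (R + 1)) ≤ 1 + 1 / R := by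
          rw [← Real.le_log_iff_exp_le (by positivity)]
          refine le_trans (le_of_eq ?_) (Real.one_sub_inv_le_log_of_pos (by positivity))
          field_simp; ring
        refine le_trans ?_ (pow_le_pow_left₀ (Real.exp_pos _).le h7 N)
        rw [← Real.exp_nat_mul]
        apply Real.exp_le_exp.2
        rw [mul_one_div, le_div_iff₀ (by linarith)]
        have : (X + 1) / R * R = X + 1 := by field_simp
        have : 0 ≤ (X + 1) / R := by positivity
        nlinarith only [this, ‹(X + 1) / R * R = X + 1›, hN2, hη0, hη, hX]
      refine le_trans ?_ h6
      rw [show X - η - (X + 1) / R = X + (- η - (X + 1) / R) by ring, Real.exp_add]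
      refine mul_le_mul_of_nonneg_left ?_ (Real.exp_pos _).le
      have := Real.add_one_le_exp (- η - (X + 1) / R)
      linarith only [this]
    have h8 : (N : ℝ) * (N * B * q ^ N) ≤ (R * X) ^ 2 * B * Real.exp (X * (1 - δ / 2)) := by
      calc (N : ℝ) * (N * B * q ^ N) = (N : ℝ) ^ 2 * B * q ^ N := by ring
        _ ≤ _ := by gcongr
    linarith only [h5, h8]
  have hup : ∑ k ∈ Finset.range N, (R + 1) ^ k * (aK K R k / k.factorial) ≤
      ∑ m ∈ Finset.range (⌊Real.exp X⌋₊ + 1), lamK K m + 2 * Module.finrank ℚ K * Real.exp (4 * X - R * η ^ 2 / (8 * X)) := by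
    obtain ⟨hT, hT2⟩ := sum_tail_T K
    set D := Real.exp (4 * X - R * η ^ 2 / (8 * X)) with hD
    set s := Finset.range (⌊Real.exp X⌋₊ + 1)
    have hfin : HasSum (fun m => if m ∈ s then lamK K m else 0) (∑ m ∈ s, lamK K m) := by
      have h1 := hasSum_sum_of_ne_finset_zero (L := SummationFilter.unconditional ℕ) (f := fun m => if m ∈ s then lamK K m else 0) (s := s) (fun b hb => if_neg hb)
      rwa [Finset.sum_congr rfl (fun m hm => if_pos hm)] at h1
    have h2 := hfin.add (hT.hasSum.mul_left D)
    have h3 := hasSum_le (fun m => ?_) hs h2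
    · refine h3.trans ?_
      have := mul_le_mul_of_nonneg_left hT2 (Real.exp_pos (4 * X - R * η ^ 2 / (8 * X))).le
      rw [← hD] at this
      linarith only [this]
    · show lamK K m * wt R N m ≤ (if m ∈ s then lamK K m else 0) + D * (lamK K m * (m : ℝ) ^ (-4 : ℝ))
      have hl := lamK_nonneg (K := K) m
      rcases Nat.eq_zero_or_pos m with rfl | hm
      · simp [lamK_zero]
      have hm0 : (0 : ℝ) < m := by exact_mod_cast hm
      by_cases hms : m ∈ s
      · rw [if_pos hms]
        have h4 := wt_le hR0 one_pos le_rfl N hm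
        simp at h4
        have : 0 ≤ D * (lamK K m * (m : ℝ) ^ (-4 : ℝ)) := by positivity
        nlinarith only [h4, this, hl]
      · rw [if_neg hms, zero_add]
        have h4 := wt_le hR0 (z := 1 - a) (by linarith) (by linarith) N hm
        have hmX : X ≤ Real.log m := by
          rw [Real.le_log_iff_exp_le hm0]
          simp only [s, Finset.mem_range, not_lt] at hms
          exact (Nat.lt_of_floor_lt (by omega)).le
        have h5 : ((1 - a) ^ N)⁻¹ ≤ Real.exp (N * (a + 2 * a ^ 2)) := by
          rw [Real.exp_nat_mul, ← inv_pow]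
          refine pow_le_pow_left₀ (inv_nonneg.2 (by linarith)) ?_ N
          refine le_trans ?_ (Real.add_one_le_exp _)
          rw [inv_le_iff_one_le_mul₀ (by linarith)]
          nlinarith
        have h6 : wt R N m ≤ D * (m : ℝ) ^ (-4 : ℝ) := by
          refine h4.trans ((mul_le_mul_of_nonneg_right h5 (Real.exp_pos _).le).trans ?_)
          rw [Real.rpow_def_of_pos hm0, hD, ← Real.exp_add, ← Real.exp_add]
          apply Real.exp_le_exp.2
          have e1 : R * η ^ 2 / (8 * X) = R * η * a / 2 := by rw [ha]; field_simp; ring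
          rw [e1]
          have h7 : 0 ≤ ((R + 1) * a - 4) * (Real.log m - X) := mul_nonneg (by linarith) (by linarith)
          have h8 : (N : ℝ) * (a + 2 * a ^ 2) ≤ R * (X - η) * (a + 2 * a ^ 2) := by gcongr
          have h9 : R * (X - η) * (a + 2 * a ^ 2) = R * (a * X) - R * η * a + 2 * R * a * (a * X) - R * η * (2 * a ^ 2) := by ring
          have h10 : 0 ≤ R * η * (2 * a ^ 2) := by positivity
          rw [haX] at h9
          have h11 : (R + 1) * (a * X) = (R + 1) * (η / 4) := by rw [haX]
          have h12 : 0 ≤ η := hη0.le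
          nlinarith only [h7, h8, h9, h10, h11, h12]
        calc lamK K m * wt R N m ≤ lamK K m * (D * (m : ℝ) ^ (-4 : ℝ)) := mul_le_mul_of_nonneg_left h6 hl
          _ = _ := by ring
  linarith only [hlow, hup]

noncomputable def bC (c : ℂ) (r : ℝ) (k : ℕ) (ρ : ℂ) : ℂ :=
  ((starRingEnd ℂ) (c - ρ) / (r : ℂ) ^ 2) ^ (k + 1) - ((c - ρ)⁻¹) ^ (k + 1)

theorem bl_step {F : ℂ → ℂ} {c ρ : ℂ} {r B : ℝ} (hr : 0 < r) (hF : Differentiable ℂ F)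
    (hB : ∀ s ∈ Metric.closedBall c r, ‖F s‖ ≤ B) (hc : F c ≠ 0) (hρ : ‖c - ρ‖ < r) (hz : F ρ = 0) :
    ∃ G : ℂ → ℂ, Differentiable ℂ G ∧ (∀ s ∈ Metric.closedBall c r, ‖G s‖ ≤ B) ∧
      ‖G c‖ = ‖F c‖ * (r / ‖c - ρ‖) ∧ (∀ s ∈ Metric.ball c r, s ≠ ρ → (G s = 0 ↔ F s = 0)) ∧
      ∀ k, iteratedDeriv k (fun s => deriv G s / G s) c = iteratedDeriv k (fun s => deriv F s / F s) c +
        (-1) ^ k * k.factorial * bC c r k ρ := by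
  set u := c - ρ with hu
  have hu0 : u ≠ 0 := by
    intro h; rw [hu, sub_eq_zero] at h; rw [h] at hc; exact hc hz
  have hr0 : (r : ℂ) ≠ 0 := by exact_mod_cast hr.ne'
  set h : ℂ → ℂ := fun s => ((r : ℂ) ^ 2 + (starRingEnd ℂ) u * (s - c)) / r with hh
  have hhd : Differentiable ℂ h := by rw [hh]; fun_prop
  have hds : Differentiable ℂ (dslope F ρ) := by
    rw [← differentiableOn_univ]
    exact (Complex.differentiableOn_dslope (by simp)).2 hF.differentiableOn
  set G : ℂ → ℂ := fun s => dslope F ρ s * h s with hG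
  have hGd : Differentiable ℂ G := hds.mul hhd
  have hid : ∀ s, G s * (s - ρ) = F s * h s := by
    intro s
    have := sub_smul_dslope F ρ s
    rw [hz, sub_zero, smul_eq_mul] at this
    rw [← this, hG]; ring
  have hhne : ∀ s ∈ Metric.ball c r, h s ≠ 0 := by
    intro s hs h0
    rw [hh] at h0
    simp only [div_eq_zero_iff, hr0, or_false] at h0
    have h1 : ‖(r : ℂ) ^ 2‖ = ‖(starRingEnd ℂ) u * (s - c)‖ := by
      rw [eq_neg_of_add_eq_zero_left h0, norm_neg]
    rw [norm_mul, norm_pow, Complex.norm_real, Real.norm_of_nonneg hr.le, RCLike.norm_conj] at h1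
    rw [Metric.mem_ball, dist_eq_norm] at hs
    have h2 : 0 ≤ ‖s - c‖ := norm_nonneg _
    nlinarith [norm_nonneg u]
  have hcball : c ∈ Metric.ball c r := Metric.mem_ball_self hr
  refine ⟨G, hGd, ?_, ?_, ?_, ?_⟩
  · intro s hs
    have := Complex.norm_le_of_forall_mem_frontier_norm_le (U := Metric.ball c r) (f := G) (C := B) Metric.isBounded_ball
      hGd.diffContOnCl ?_ (z := s) (by rwa [closure_ball c hr.ne'])
    · exact this
    · intro z hz'
      rw [frontier_ball c hr.ne', mem_sphere_iff_norm] at hz'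
      have h1 : ‖h z‖ = ‖z - ρ‖ := by
        have e : h z = (z - c) * (starRingEnd ℂ) (z - ρ) / r := by
          have h2 : (z - c) * (starRingEnd ℂ) (z - c) = (r : ℂ) ^ 2 := by
            rw [Complex.mul_conj, Complex.normSq_eq_norm_sq, hz']; push_cast; ring
          rw [hh]
          simp only
          rw [show z - ρ = (z - c) + u by rw [hu]; ring, map_add, mul_add, h2]; ring
        rw [e, norm_div, norm_mul, RCLike.norm_conj, hz', Complex.norm_real, Real.norm_of_nonneg hr.le]
        field_simp
      have h2 : z - ρ ≠ 0 := by
        intro h3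
        rw [sub_eq_zero] at h3
        rw [h3, norm_sub_rev] at hz'; linarith
      have h3 := congrArg norm (hid z)
      rw [norm_mul (G z), norm_mul (F z), h1] at h3
      have h4 := mul_right_cancel₀ (norm_ne_zero_iff.2 h2) h3
      rw [h4]
      exact hB z (by rw [Metric.mem_closedBall, dist_eq_norm, hz'])
  · have h3 := congrArg norm (hid c)
    have h4 : h c = r := by rw [hh]; simp; field_simp
    rw [norm_mul (G c), norm_mul (F c), h4, Complex.norm_real, Real.norm_of_nonneg hr.le] at h3
    rw [mul_div_assoc', eq_div_iff (norm_ne_zero_iff.2 hu0)]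
    exact h3
  · intro s hs hsρ
    have h1 := hid s
    have h2 := hhne s hs
    have h3 : s - ρ ≠ 0 := sub_ne_zero.2 hsρ
    constructor
    · intro h4; rw [h4, zero_mul] at h1; exact (mul_eq_zero.1 h1.symm).resolve_right h2
    · intro h4; rw [h4, zero_mul] at h1; exact (mul_eq_zero.1 h1).resolve_right h3
  · intro k
    have hcρ : c ≠ ρ := sub_ne_zero.1 hu0
    have hne : ∀ᶠ s in 𝓝 c, F s ≠ 0 ∧ s ≠ ρ ∧ s ∈ Metric.ball c r :=
      (hF.continuous.continuousAt.eventually_ne hc).and ((continuousAt_id.eventually_ne hcρ).and (Metric.isOpen_ball.mem_nhds hcball))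
    have hev : (fun s => deriv G s / G s) =ᶠ[𝓝 c] (fun s => deriv F s / F s) +
        ((fun s => (starRingEnd ℂ) u * ((starRingEnd ℂ) u * s + ((r : ℂ) ^ 2 - (starRingEnd ℂ) u * c))⁻¹) - fun s => (1 * s - ρ)⁻¹) := by
      filter_upwards [hne] with s hs
      obtain ⟨h1, h2, h3⟩ := hs
      have h4 := hhne s h3
      have h5 : s - ρ ≠ 0 := sub_ne_zero.2 h2
      have h6 : HasDerivAt (fun s => G s * (s - ρ)) (deriv G s * (s - ρ) + G s * 1) s :=
        hGd.differentiableAt.hasDerivAt.mul ((hasDerivAt_id s).sub_const ρ)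
      have h7 : HasDerivAt (fun s => F s * h s) (deriv F s * h s + F s * deriv h s) s :=
        hF.differentiableAt.hasDerivAt.mul hhd.differentiableAt.hasDerivAt
      have h8 : HasDerivAt h ((starRingEnd ℂ) u / r) s := by
        have : HasDerivAt (fun s => ((r : ℂ) ^ 2 + (starRingEnd ℂ) u * (s - c)) / r) ((0 + (starRingEnd ℂ) u * 1) / r) s :=
          ((hasDerivAt_const s _).add (((hasDerivAt_id s).sub_const c).const_mul _)).div_const _
        simpa using this
      rw [h8.deriv] at h7
      have h9 := h6.unique (h7.congr_of_eventuallyEq (Eventually.of_forall hid))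
      have h10 := hid s
      have h11 : G s ≠ 0 := by
        intro h0; rw [h0, zero_mul] at h10; exact mul_ne_zero h1 h4 h10.symm
      have h12 : (starRingEnd ℂ) u * s + ((r : ℂ) ^ 2 - (starRingEnd ℂ) u * c) = r * h s := by
        rw [hh]; field_simp; ring
      simp only [Pi.add_apply, Pi.sub_apply]
      rw [h12, one_mul]
      have h13 : G s = F s * h s / (s - ρ) := by rw [eq_div_iff h5, h10]
      have h14 : deriv G s = (deriv F s * h s + F s * ((starRingEnd ℂ) u / r) - G s) / (s - ρ) := by
        rw [eq_div_iff h5]; linear_combination h9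
      rw [h14, h13]
      field_simp
      ring
    have c1 : ContDiffAt ℂ k (fun s => deriv F s / F s) c :=
      ((hF.analyticAt c).deriv.div (hF.analyticAt c) hc).contDiffAt
    have e2 : (starRingEnd ℂ) u * c + ((r : ℂ) ^ 2 - (starRingEnd ℂ) u * c) = (r : ℂ) ^ 2 := by ring
    have c2 : ContDiffAt ℂ k (fun s => ((starRingEnd ℂ) u * s + ((r : ℂ) ^ 2 - (starRingEnd ℂ) u * c))⁻¹) c := by
      refine (AnalyticAt.inv (by fun_prop) ?_).contDiffAt
      rw [e2]; exact pow_ne_zero _ hr0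
    have c3 : ContDiffAt ℂ k (fun s => (1 * s - ρ)⁻¹) c :=
      (AnalyticAt.inv (by fun_prop) (by simpa using hu0)).contDiffAt
    have c2' : ContDiffAt ℂ k (fun s => (starRingEnd ℂ) u * ((starRingEnd ℂ) u * s + ((r : ℂ) ^ 2 - (starRingEnd ℂ) u * c))⁻¹) c :=
      contDiffAt_const.mul c2
    have c4 : ContDiffAt ℂ k ((fun s => (starRingEnd ℂ) u * ((starRingEnd ℂ) u * s + ((r : ℂ) ^ 2 - (starRingEnd ℂ) u * c))⁻¹) -
        fun s => (1 * s - ρ)⁻¹) c := c2'.sub c3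
    have hz1 : (-1 - k : ℤ) = -((k + 1 : ℕ) : ℤ) := by push_cast; ring
    rw [hev.iteratedDeriv_eq, iteratedDeriv_add c1 c4, iteratedDeriv_sub c2' c3,
      iteratedDeriv_const_mul_field, iteratedDeriv_eq_iterate (f := fun s => (1 * s - ρ)⁻¹),
      iteratedDeriv_eq_iterate (f := fun s => ((starRingEnd ℂ) u * s + ((r : ℂ) ^ 2 - (starRingEnd ℂ) u * c))⁻¹),
      iter_deriv_inv_linear_sub, iter_deriv_inv_linear]
    simp only [e2, one_mul, one_pow, mul_one, hz1, zpow_neg, zpow_natCast]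
    rw [bC, ← hu, div_pow, inv_pow]
    ring

theorem blaschke {c : ℂ} {r r1 B : ℝ} (hr1 : 0 < r1) (hr : r1 < r) (n : ℕ) : ∀ F : ℂ → ℂ, Differentiable ℂ F →
    (∀ s ∈ Metric.closedBall c r, ‖F s‖ ≤ B) → F c ≠ 0 → B < ‖F c‖ * (r / r1) ^ n →
    ∃ (T : Multiset ℂ) (G : ℂ → ℂ), Differentiable ℂ G ∧ (∀ s ∈ Metric.closedBall c r, ‖G s‖ ≤ B) ∧
      ‖F c‖ ≤ ‖G c‖ ∧ (∀ s ∈ Metric.ball c r1, G s ≠ 0) ∧ (∀ s, s ∈ T ↔ s ∈ Metric.ball c r1 ∧ F s = 0) ∧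
      ∀ k, iteratedDeriv k (fun s => deriv G s / G s) c = iteratedDeriv k (fun s => deriv F s / F s) c +
        (-1) ^ k * k.factorial * (T.map (bC c r k)).sum := by
  have hr0 : 0 < r := hr1.trans hr
  induction n with
  | zero =>
    intro F hF hB hc h
    have := hB c (Metric.mem_closedBall_self hr0.le)
    simp at h; linarith
  | succ n ih =>
    intro F hF hB hc h
    by_cases hz : ∀ s ∈ Metric.ball c r1, F s ≠ 0
    · refine ⟨0, F, hF, hB, le_rfl, hz, fun s => ?_, fun k => by simp⟩
      simp only [Multiset.notMem_zero, false_iff, not_and]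
      exact fun hs => hz s hs
    · push Not at hz
      obtain ⟨ρ, hρ, hρz⟩ := hz
      have hρ' : ‖c - ρ‖ < r1 := by rwa [Metric.mem_ball, dist_comm, dist_eq_norm] at hρ
      have hu0 : 0 < ‖c - ρ‖ := by
        rw [norm_pos_iff]; intro h; rw [sub_eq_zero] at h; rw [h] at hc; exact hc hρz
      obtain ⟨G1, h1, h2, h3, h4, h5⟩ := bl_step hr0 hF hB hc (hρ'.trans hr) hρz
      have h6 : r / r1 ≤ r / ‖c - ρ‖ := by gcongr
      have hFc : 0 < ‖F c‖ := norm_pos_iff.2 hc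
      have h7 : ‖F c‖ * (r / r1) ≤ ‖G1 c‖ := by rw [h3]; gcongr
      have h8 : 1 ≤ r / r1 := by rw [le_div_iff₀ hr1]; linarith
      have h9 : ‖F c‖ ≤ ‖G1 c‖ := by nlinarith
      obtain ⟨T, G, g1, g2, g3, g4, g5, g6⟩ := ih G1 h1 h2 (by rw [← norm_pos_iff]; linarith) (by
        refine h.trans_le ?_
        rw [pow_succ', ← mul_assoc]
        gcongr)
      refine ⟨ρ ::ₘ T, G, g1, g2, h9.trans g3, g4, fun s => ?_, fun k => ?_⟩
      · rw [Multiset.mem_cons, g5]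
        by_cases hs : s = ρ
        · simp [hs, hρz]; simpa using hρ
        · constructor
          · rintro (h | ⟨h, h'⟩)
            · exact absurd h hs
            · exact ⟨h, (h4 s (Metric.ball_subset_ball hr.le h) hs).1 h'⟩
          · rintro ⟨h, h'⟩
            exact Or.inr ⟨h, (h4 s (Metric.ball_subset_ball hr.le h) hs).2 h'⟩
      · rw [g6, h5, Multiset.map_cons, Multiset.sum_cons]; ring

theorem pow_sub_one_le {v : ℂ} (hv : ‖v‖ ≤ 1) (N : ℕ) : ‖v ^ N - 1‖ ≤ N * ‖v - 1‖ := by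
  induction N with
  | zero => simp
  | succ N ih =>
    have h1 : v ^ (N + 1) - 1 = v ^ N * (v - 1) + (v ^ N - 1) := by ring
    rw [h1]
    refine (norm_add_le _ _).trans ?_
    rw [norm_mul, norm_pow]
    have h2 : ‖v‖ ^ N ≤ 1 := pow_le_one₀ (norm_nonneg _) hv
    have h3 := norm_nonneg (v - 1)
    push_cast
    nlinarith

theorem bC_re {ρ : ℂ} {k : ℕ} (hk : 6 ≤ k) (hx : ρ.re ≤ 1) (hn : ‖2 - ρ‖ ≤ 5 / 4) (him : |ρ.im| * (k + 1) ≤ 1 / 10) :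
    (bC 2 (3 / 2) k ρ).re ≤ - (4 / 5 * ((2 - ρ.re) ^ (k + 1))⁻¹) := by
  set u := 2 - ρ with hu
  set x := 2 - ρ.re with hxd
  have hux : u.re = x := by simp [hu, hxd]
  have hui : |u.im| = |ρ.im| := by simp [hu]
  have hx1 : 1 ≤ x := by rw [hxd]; linarith
  have hxu : x ≤ ‖u‖ := by rw [← hux]; exact Complex.re_le_norm u
  have hu0 : u ≠ 0 := by rw [← norm_pos_iff]; linarith
  have hx0 : (x : ℂ) ≠ 0 := by exact_mod_cast (by linarith : x ≠ 0)
  set v : ℂ := x * u⁻¹ with hv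
  have hv1 : ‖v‖ ≤ 1 := by
    rw [hv, norm_mul, norm_inv, Complex.norm_real, Real.norm_of_nonneg (by linarith), ← div_eq_mul_inv, div_le_one (by linarith)]
    exact hxu
  have hv2 : ‖v - 1‖ ≤ |ρ.im| := by
    have e : v - 1 = -(u.im * Complex.I) * u⁻¹ := by
      rw [hv]
      have : (x : ℂ) = u - u.im * Complex.I := by
        rw [← hux]; linear_combination Complex.re_add_im u
      rw [this]; field_simp; ring
    rw [e, norm_mul, norm_neg, norm_mul, Complex.norm_I, mul_one, Complex.norm_real, Real.norm_eq_abs, norm_inv, hui, ← div_eq_mul_inv]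
    exact div_le_self (abs_nonneg _) (by linarith)
  have hv3 := pow_sub_one_le hv1 (k + 1)
  have hv4 : ‖v ^ (k + 1) - 1‖ ≤ 1 / 10 := by
    refine hv3.trans ?_
    push_cast
    have : (0 : ℝ) ≤ k + 1 := by positivity
    nlinarith
  have hv5 : 9 / 10 ≤ (v ^ (k + 1)).re := by
    have := (Complex.abs_re_le_norm (v ^ (k + 1) - 1)).trans hv4
    rw [Complex.sub_re, Complex.one_re, abs_le] at this
    linarith
  have e1 : (u⁻¹) ^ (k + 1) = (((x ^ (k + 1))⁻¹ : ℝ) : ℂ) * v ^ (k + 1) := by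
    rw [hv, mul_pow]; push_cast; field_simp
  have h2 : ((starRingEnd ℂ u / ((3 / 2 : ℝ) : ℂ) ^ 2) ^ (k + 1)).re ≤ 1 / 10 * (x ^ (k + 1))⁻¹ := by
    refine (Complex.re_le_norm _).trans ?_
    rw [norm_pow, norm_div, RCLike.norm_conj, norm_pow, Complex.norm_real, Real.norm_of_nonneg (by norm_num)]
    rw [← div_eq_mul_inv, le_div_iff₀ (by positivity), ← mul_pow]
    have h3 : ‖u‖ / (3 / 2) ^ 2 * x ≤ 25 / 36 := by
      rw [div_mul_eq_mul_div, div_le_iff₀ (by norm_num)]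
      nlinarith
    refine (pow_le_pow_left₀ (by positivity) h3 _).trans ?_
    refine (pow_le_pow_of_le_one (by norm_num) (by norm_num) (by omega : 7 ≤ k + 1)).trans ?_
    norm_num
  rw [bC, Complex.sub_re, ← hu, e1, Complex.re_ofReal_mul]
  have h4 : 0 < (x ^ (k + 1))⁻¹ := by positivity
  nlinarith only [h2, h4, hv5]

theorem multi_re {f : ℂ → ℂ} (T : Multiset ℂ) : (∀ s ∈ T, (f s).re ≤ 0) → (T.map f).sum.re ≤ 0 := by
  induction T using Multiset.induction with
  | empty => simp
  | cons a T ih =>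
    intro h
    rw [Multiset.map_cons, Multiset.sum_cons, Complex.add_re]
    have := h a (Multiset.mem_cons_self a T)
    have := ih fun s hs => h s (Multiset.mem_cons_of_mem hs)
    linarith

theorem near_zero {F : ℂ → ℂ} (hF : IsFK K F) {δ : ℝ} {k : ℕ} (hδ0 : 0 < δ)
    (hδ : δ ≤ 1 / 4) (hk : 6 ≤ k)
    (hz : ∀ s ∈ Metric.ball (2 : ℂ) (1 + δ), F s = 0 → s.im ≠ 0 ∧ |s.im| * (k + 1) ≤ 1 / 10)
    (herr : (k + 1) * (5760 * qK K / δ) / (1 + δ / 2) ^ k ≤ 1 / 10) :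
    ∀ s ∈ Metric.ball (2 : ℂ) (1 + δ), F s = 0 → 1 / (4 * (k + 1)) ≤ 1 - s.re := by
  intro ρ hρ hρ0
  have hq := qK_ge (K := K)
  have hone : ((1 + 1 : ℝ) : ℂ) = 2 := by push_cast; norm_num
  set B := Real.exp (1440 * qK K) * ‖F 2‖ with hB
  have hgrow : ∀ s ∈ Metric.closedBall (2 : ℂ) (3 / 2), ‖F s‖ ≤ B := by
    have h1 := F_growth hF (R := 1) le_rfl (δ := 1 / 2) le_rfl
    rw [hone] at h1
    have h2 : Metric.closedBall (2 : ℂ) (3 / 2) ⊆ {s | ‖F s‖ ≤ B} := by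
      rw [← closure_ball _ (by norm_num)]
      refine closure_minimal (fun s hs => ?_) (isClosed_le hF.1.continuous.norm continuous_const)
      have := h1 s (by norm_num; simpa using hs)
      simpa using this
    exact h2
  have hF2 : F 2 ≠ 0 := F_ne hF (by simp)
  have hr : 1 + δ < 3 / 2 := by linarith
  obtain ⟨n, hn⟩ := pow_unbounded_of_one_lt (B / ‖F 2‖) (show 1 < (3 / 2) / (1 + δ) by rw [lt_div_iff₀ (by linarith)]; linarith)
  obtain ⟨T, G, g1, g2, g3, g4, g5, g6⟩ := blaschke (by linarith) hr n F hF.1 hgrow hF2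
    (by rwa [div_lt_iff₀ (norm_pos_iff.2 hF2), mul_comm] at hn)
  have h1 := coef_bound (G := G) (c := 2) (r := 1 + δ) (r' := 1 + δ / 2) (A := 1440 * qK K) (by positivity) (by positivity) (by linarith)
    g1.differentiableOn g4 (fun z hz => (g2 z (Metric.ball_subset_closedBall (Metric.ball_subset_ball hr.le hz))).trans
      (by rw [hB]; gcongr)) k
  have h2 := itd_F hF one_pos k
  rw [hone] at h2
  rw [g6, h2] at h1
  have hkf : (0 : ℝ) < k.factorial := by exact_mod_cast k.factorial_pos
  set a := aK K 1 k / k.factorial with ha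
  have ha0 : 0 ≤ a := by
    refine div_nonneg (tsum_nonneg fun m => ?_) hkf.le
    have := lamK_nonneg (K := K) m
    have : 0 ≤ Real.log m := Real.log_natCast_nonneg m
    positivity
  set SS := (T.map (bC 2 (3 / 2) k)).sum with hS
  have e1 : (-1 : ℂ) ^ k * ((k.factorial * (1 ^ (k + 1))⁻¹ - aK K 1 k : ℝ) : ℂ) + (-1) ^ k * k.factorial * SS =
      ((-1) ^ k * (k.factorial : ℝ)) * (1 - a + SS) := by
    have : (aK K 1 k : ℝ) = k.factorial * a := by rw [ha]; field_simp
    rw [this]; push_cast; simp; ring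
  rw [e1, norm_mul, norm_mul, norm_pow, norm_neg, norm_one, one_pow, one_mul, Complex.norm_real, Real.norm_of_nonneg hkf.le] at h1
  have h3 := le_of_mul_le_mul_left h1 hkf
  have e2 : 2 * (1440 * qK K) / (1 + δ - (1 + δ / 2)) = 5760 * qK K / δ := by
    rw [show 1 + δ - (1 + δ / 2) = δ / 2 by ring]; field_simp; norm_num
  rw [e2] at h3
  have h4 := (Complex.abs_re_le_norm _).trans (h3.trans herr)
  rw [Complex.add_re, Complex.sub_re, Complex.one_re, Complex.ofReal_re, abs_le] at h4
  have hterm : ∀ s ∈ T, (bC 2 (3 / 2) k s).re ≤ - (4 / 5 * ((2 - s.re) ^ (k + 1))⁻¹) ∧ s.re ≤ 1 := by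
    intro s hs
    obtain ⟨hs1, hs2⟩ := (g5 s).1 hs
    have hre : s.re ≤ 1 := by
      by_contra h; exact F_ne hF (not_le.1 h) hs2
    refine ⟨bC_re hk hre ?_ (hz s hs1 hs2).2, hre⟩
    rw [Metric.mem_ball, dist_comm, dist_eq_norm] at hs1
    linarith
  have hneg : ∀ s ∈ T, (bC 2 (3 / 2) k s).re ≤ 0 := by
    intro s hs
    obtain ⟨h5, h6⟩ := hterm s hs
    have : 0 < 2 - s.re := by linarith
    have : 0 < ((2 - s.re) ^ (k + 1))⁻¹ := by positivity
    linarith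
  have hρT : ρ ∈ T := (g5 ρ).2 ⟨hρ, hρ0⟩
  have hρc : (starRingEnd ℂ) ρ ∈ T := by
    refine (g5 _).2 ⟨?_, ?_⟩
    · rw [Metric.mem_ball, dist_eq_norm] at hρ ⊢
      rw [← RCLike.norm_conj, map_sub, Complex.conj_conj, map_ofNat]
      exact hρ
    · rw [F_conj hF, hρ0, map_zero]
  have hne : (starRingEnd ℂ) ρ ≠ ρ := by
    intro h
    exact (hz ρ hρ hρ0).1 (Complex.conj_eq_iff_im.1 h)
  obtain ⟨T1, hT1⟩ := Multiset.exists_cons_of_mem hρT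
  have hm2 : (starRingEnd ℂ) ρ ∈ T1 := by
    rw [hT1, Multiset.mem_cons] at hρc
    exact hρc.resolve_left hne
  obtain ⟨T2, hT2⟩ := Multiset.exists_cons_of_mem hm2
  have h7 : (T2.map (bC 2 (3 / 2) k)).sum.re ≤ 0 := multi_re T2 fun s hs => hneg s (by
    rw [hT1, hT2]; exact Multiset.mem_cons_of_mem (Multiset.mem_cons_of_mem hs))
  have h8 : SS.re = (bC 2 (3 / 2) k ρ).re + ((bC 2 (3 / 2) k ((starRingEnd ℂ) ρ)).re + (T2.map (bC 2 (3 / 2) k)).sum.re) := by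
    rw [hS, hT1, hT2, Multiset.map_cons, Multiset.sum_cons, Multiset.map_cons, Multiset.sum_cons, Complex.add_re, Complex.add_re]
  have h9 := (hterm ρ hρT).1
  have h10 := (hterm _ hρc).1
  rw [Complex.conj_re] at h10
  have hre := (hterm ρ hρT).2
  set x := 2 - ρ.re with hx
  have h11 : 8 / 5 * (x ^ (k + 1))⁻¹ ≤ 11 / 10 := by linarith only [h4.1, h8, h9, h10, h7, ha0]
  have hx1 : 1 ≤ x := by rw [hx]; linarith
  have h12 : 16 / 11 ≤ x ^ (k + 1) := by
    rw [← div_eq_mul_inv, div_le_iff₀ (by positivity)] at h11; linarith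
  by_contra hcon
  rw [not_le, lt_div_iff₀ (by positivity)] at hcon
  have h13 : x ^ (k + 1) ≤ Real.exp (1 / 4) := by
    have : x ≤ Real.exp (1 - ρ.re) := by
      have := Real.add_one_le_exp (1 - ρ.re); rw [hx]; linarith
    refine (pow_le_pow_left₀ (by linarith) this _).trans ?_
    rw [← Real.exp_nat_mul]
    apply Real.exp_le_exp.2
    push_cast; linarith
  have h14 : Real.exp (1 / 4) ^ 4 = Real.exp 1 := by rw [← Real.exp_nat_mul]; norm_num
  have h15 := pow_le_pow_left₀ (by norm_num) (h12.trans h13) 4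
  rw [h14] at h15
  have := Real.exp_one_lt_d9
  norm_num at h15
  linarith

noncomputable def MK (K : Type*) [Field K] [NumberField K] : ℝ :=
  Real.log ((Module.finrank ℚ K : ℝ) * Real.log (3 * |(discr K : ℝ)|))

theorem log_four_gt : 1.38 < Real.log 4 := by
  have : Real.log 4 = 2 * Real.log 2 := by
    rw [show (4 : ℝ) = 2 ^ 2 by norm_num, Real.log_pow]; norm_num
  have := Real.log_two_gt_d9
  linarith

theorem discr_ge_three (hn : 1 < Module.finrank ℚ K) : 3 ≤ |(discr K : ℝ)| := by
  have h := abs_discr_gt_two hn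
  have : (3 : ℤ) ≤ |discr K| := h
  exact_mod_cast this

theorem log_three_gt : 1 < Real.log 3 := by
  rw [Real.lt_log_iff_exp_lt (by norm_num)]
  exact Real.exp_one_lt_d9.trans (by norm_num)

theorem MK_exp :
    Real.exp (MK K) = (Module.finrank ℚ K : ℝ) * Real.log (3 * |(discr K : ℝ)|) := by
  have h1 := (log3_ge (discr_ge_one K)).1
  have h2 : (0 : ℝ) < Module.finrank ℚ K := by exact_mod_cast Module.finrank_pos
  rw [MK, Real.exp_log (by positivity)]

theorem MK_ge (hn : 1 < Module.finrank ℚ K) : 1.38 ≤ MK K := by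
  have h1 := discr_ge_three hn
  have h2 : 2 ≤ Real.log (3 * |(discr K : ℝ)|) := by
    rw [Real.log_mul (by norm_num) (by linarith)]
    have := Real.log_le_log (by norm_num) h1
    linarith [log_three_gt]
  have h3 : (2 : ℝ) ≤ Module.finrank ℚ K := by exact_mod_cast hn
  refine log_four_gt.le.trans (Real.log_le_log (by norm_num) ?_)
  nlinarith

theorem MKC_ge (hn : 1 < Module.finrank ℚ K) {C : ℝ} (hC : 4 < C) :
    2 ≤ MK K ^ C ∧ MK K ≤ MK K ^ C := by
  have h := MK_ge hn
  constructor
  · have h1 : MK K ^ (4 : ℝ) ≤ MK K ^ C := Real.rpow_le_rpow_of_exponent_le (by linarith) hC.le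
    have h2 : MK K ^ (4 : ℝ) = MK K ^ (4 : ℕ) := by exact_mod_cast Real.rpow_natCast (MK K) 4
    have h3 : (1.38 : ℝ) ^ 4 ≤ MK K ^ 4 := pow_le_pow_left₀ (by norm_num) h 4
    rw [h2] at h1
    norm_num at h3
    linarith
  · have h1 : MK K ^ (1 : ℝ) ≤ MK K ^ C := Real.rpow_le_rpow_of_exponent_le (by linarith) (by linarith)
    rwa [Real.rpow_one] at h1

theorem qK_le_MK (hn : 1 < Module.finrank ℚ K) :
    qK K ≤ 151 * Real.exp (4 * MK K) := by
  have h1 := (log3_ge (discr_ge_one K)).1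
  have h3 : (2 : ℝ) ≤ Module.finrank ℚ K := by exact_mod_cast hn
  have h4 : Real.exp (4 * MK K) = Real.exp (MK K) ^ 4 := by rw [← Real.exp_nat_mul]; norm_num
  rw [h4, MK_exp, qK]
  set n := (Module.finrank ℚ K : ℝ)
  set l := Real.log (3 * |(discr K : ℝ)|)
  have h5 : (n + 5) ^ 4 ≤ (7 / 2 * n) ^ 4 := pow_le_pow_left₀ (by linarith) (by linarith) 4
  have h6 : l ≤ l ^ 4 := le_self_pow₀ h1 (by norm_num)
  calc (n + 5) ^ 4 * l ≤ (7 / 2 * n) ^ 4 * l ^ 4 := by gcongr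
    _ = (7 / 2) ^ 4 * (n * l) ^ 4 := by ring
    _ ≤ 151 * (n * l) ^ 4 := by
      gcongr; norm_num

theorem zeta_FK {K : Type} [Field K] [NumberField K] {F : ℂ → ℂ} (hF : IsFK K F) :
    IsDedekindZeta K (fun s => F s / (s - 1)) := by
  constructor
  · intro s hs
    have : s - 1 ≠ 0 := sub_ne_zero.2 hs
    exact ((hF.1 s).div ((differentiableAt_id).sub_const 1) this).differentiableWithinAt
  · intro s hs
    have : s - 1 ≠ 0 := sub_ne_zero.2 (by rintro rfl; simp at hs)
    simp only []
    rw [hF.2.1 s hs, mul_div_cancel_left₀ _ this, zK_eq_tsum hs]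

theorem F_re_lt {F : ℂ → ℂ} (hF : IsFK K F) {s : ℂ} (h0 : F s = 0) : s.re < 1 := by
  by_contra h
  rcases lt_or_eq_of_le (not_lt.1 h) with h | h
  · exact F_ne hF h h0
  · exact F_line hF h.symm h0

theorem mdzh_zero {K : Type} [Field K] [NumberField K] {F : ℂ → ℂ} (hF : IsFK K F) {C : ℝ} (hm : MDZH C)
    (hn : 1 < Module.finrank ℚ K) {s : ℂ} (h0 : F s = 0) (hs : 0 < s.re) :
    (s.im = 0 → s.re ≤ 1 - (MK K ^ C)⁻¹) ∧
    ((1 + 4 * Real.log |(discr K : ℝ)|)⁻¹ ≤ |s.im| → s.re < 1 - (MK K ^ C * Real.log (|s.im| + 2))⁻¹) := by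
  have h1 := F_re_lt hF h0
  have h2 := hm K hn _ (zeta_FK hF)
  have hD : (((discr K).natAbs : ℕ) : ℝ) = |(discr K : ℝ)| := by rw [Nat.cast_natAbs]; push_cast; rfl
  rw [hD] at h2
  change _ ∧ ∀ β : ℝ, _ → _ → _ → ¬ (1 - MK K ^ (-C) < β) at h2
  constructor
  · intro hi
    have hs' : ((s.re : ℝ) : ℂ) = s := by apply Complex.ext <;> simp [hi]
    have := h2.2 s.re (by rw [hs', h0, zero_div]) hs h1
    rw [Real.rpow_neg (by linarith [MK_ge hn])] at this
    exact not_lt.1 this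
  · intro hi
    have h3 := h2.1 s (by rw [h0, zero_div]) hs h1
    by_contra hc
    exact h3 ⟨hi, not_lt.1 hc⟩

theorem exp_big : (7e9 : ℝ) ≤ Real.exp 24 := by
  have h := Real.exp_one_gt_d9
  have h1 : (2.7 : ℝ) ^ 24 ≤ Real.exp 1 ^ 24 := pow_le_pow_left₀ (by norm_num) (by linarith) 24
  rw [← Real.exp_nat_mul] at h1
  norm_num at h1 ⊢
  linarith

theorem near_M {K : Type} [Field K] [NumberField K] {F : ℂ → ℂ} (hF : IsFK K F) {C : ℝ} (hC : 4 < C) (hm : MDZH C)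
    (hn : 1 < Module.finrank ℚ K) (hD : 1003 * (MK K ^ C) ^ 2 ≤ Real.log |(discr K : ℝ)|) :
    ∀ s ∈ Metric.ball (2 : ℂ) (1 + 1 / (2 * MK K ^ C)), F s = 0 → 1 / (1604 * (MK K ^ C) ^ 2) ≤ 1 - s.re := by
  obtain ⟨hY2, hMY⟩ := MKC_ge hn hC
  have hq := qK_le_MK hn
  have hq0 := qK_ge (K := K)
  have hMp := MK_ge hn
  have hz0 : ∀ s : ℂ, F s = 0 → 0 < s.re → _ := fun s h0 hs => mdzh_zero hF hm hn h0 hs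
  set Y := MK K ^ C with hY
  set lD := Real.log |(discr K : ℝ)| with hlD
  have hYp : 0 < Y := by linarith
  set N := ⌈400 * Y ^ 2⌉₊ with hN
  have hN1 : 400 * Y ^ 2 ≤ N := Nat.le_ceil _
  have hN2 : (N : ℝ) ≤ 401 * Y ^ 2 := by
    have := (Nat.ceil_lt_add_one (show (0 : ℝ) ≤ 400 * Y ^ 2 by positivity)).le
    have h4 : 1 ≤ Y ^ 2 := by nlinarith only [hY2]
    linarith
  have h4 : 4 ≤ Y ^ 2 := by nlinarith only [hY2]
  have hN3 : 1000 ≤ N := by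
    have : (1000 : ℝ) ≤ N := by linarith
    exact_mod_cast this
  obtain ⟨k, hk⟩ : ∃ k, N = k + 1 := ⟨N - 1, by omega⟩
  have hkN : (k : ℝ) + 1 = N := by rw [hk]; push_cast; ring
  have hδ : 1 / (2 * Y) ≤ 1 / 4 := one_div_le_one_div_of_le (by norm_num) (by linarith)
  have hδ0 : 0 < 1 / (2 * Y) := by positivity
  intro s hs hs0
  have hre0 : ∀ s ∈ Metric.ball (2 : ℂ) (1 + 1 / (2 * Y)), 1 - 1 / (2 * Y) < s.re := by
    intro s hs
    rw [Metric.mem_ball, dist_comm, dist_eq_norm] at hs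
    have := (Complex.abs_re_le_norm (2 - s)).trans_lt hs
    have := (le_abs_self _).trans_lt this
    rw [Complex.sub_re] at this
    norm_num at this
    norm_num
    linarith
  have key := near_zero hF (δ := 1 / (2 * Y)) (k := k) hδ0 hδ (by omega) ?_ ?_ s hs hs0
  · rw [hkN] at key
    refine le_trans (one_div_le_one_div_of_le ?_ ?_) key
    · have : (1000 : ℝ) ≤ N := by exact_mod_cast hN3
      linarith
    · linarith
  · intro s hs hs0
    have hre := hre0 s hs
    have hlt := F_re_lt hF hs0
    have hpos : 0 < s.re := by linarith
    obtain ⟨z1, z2⟩ := hz0 s hs0 hpos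
    have hinv : (2 * Y)⁻¹ < Y⁻¹ := inv_strictAnti₀ hYp (by linarith)
    rw [one_div] at hre
    refine ⟨fun h => ?_, ?_⟩
    · have := z1 h; linarith
    · have him : |s.im| ≤ 1 := by
        rw [Metric.mem_ball, dist_eq_norm] at hs
        have h5 : ‖s - 2‖ ^ 2 = (s.re - 2) ^ 2 + s.im ^ 2 := by
          rw [← Complex.normSq_eq_norm_sq, Complex.normSq_apply]; simp; ring
        have h6 : ‖s - 2‖ ^ 2 ≤ (1 + 1 / 4) ^ 2 := pow_le_pow_left₀ (norm_nonneg _) (by linarith) 2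
        rw [← sq_le_one_iff_abs_le_one]
        nlinarith only [h5, h6, hlt]
      have h7 : |s.im| < (1 + 4 * lD)⁻¹ := by
        by_contra hc
        have h8 := z2 (not_lt.1 hc)
        have h9 : Real.log (|s.im| + 2) ≤ 2 := by
          have := Real.log_le_sub_one_of_pos (show 0 < |s.im| + 2 by positivity)
          linarith
        have h10 : 0 < Real.log (|s.im| + 2) := Real.log_pos (by linarith [abs_nonneg s.im])
        have h11 : (2 * Y)⁻¹ ≤ (Y * Real.log (|s.im| + 2))⁻¹ := inv_anti₀ (by positivity) (by nlinarith only [h9, hYp])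
        linarith
      rw [hkN]
      have hlp : 0 < 1 + 4 * lD := by nlinarith only [hD, h4]
      rw [lt_inv_comm₀ (by
        rcases (abs_nonneg s.im).lt_or_eq with h | h
        · exact h
        · exfalso
          have h12 := z1 (abs_eq_zero.1 h.symm)
          linarith) hlp] at h7
      have h13 : 0 < |s.im| := by
        by_contra hc
        have h12 := z1 (abs_eq_zero.1 (le_antisymm (not_lt.1 hc) (abs_nonneg _)))
        linarith
      have h14 : (N : ℝ) * 10 ≤ |s.im|⁻¹ := by nlinarith only [h7, hN2, hD, h4]
      have := mul_le_mul_of_nonneg_left h14 h13.le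
      rw [mul_inv_cancel₀ h13.ne'] at this
      linarith
  · rw [hkN]
    set y := 1 / (2 * Y) / 2 with hy
    have hy' : y * Y = 1 / 4 := by rw [hy]; field_simp; norm_num
    have hy0 : 0 < y := by positivity
    have hpow : Real.exp (23 * Y) ≤ (1 + y) ^ k := by
      have e1 : Real.exp (y / 2) ≤ 1 + y := by
        have := Real.exp_bound_div_one_sub_of_interval (show 0 ≤ y / 2 by positivity) (by linarith [hδ] : y / 2 < 1)
        refine this.trans ?_
        rw [div_le_iff₀ (by linarith)]
        nlinarith only [hy0, hδ, hy]
      calc Real.exp (23 * Y) ≤ Real.exp (k * (y / 2)) := by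
            rw [Real.exp_le_exp]
            have : 399 * Y ^ 2 ≤ (k : ℝ) := by linarith
            have h6 := mul_le_mul_of_nonneg_right this (show 0 ≤ y / 2 by positivity)
            have h7 : 399 * Y ^ 2 * (y / 2) = 399 / 2 * Y * (y * Y) := by ring
            rw [h7, hy'] at h6
            linarith
        _ = Real.exp (y / 2) ^ k := by rw [Real.exp_nat_mul]
        _ ≤ (1 + y) ^ k := by gcongr
    rw [div_le_iff₀ (by positivity)]
    have hdiv : 5760 * qK K / (1 / (2 * Y)) = 11520 * qK K * Y := by field_simp; ring
    rw [hdiv]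
    have hYe : Y ≤ Real.exp Y := by linarith [Real.add_one_le_exp Y]
    have hqe : qK K ≤ 151 * Real.exp Y ^ 4 := by
      rw [← Real.exp_nat_mul]
      refine hq.trans ?_
      gcongr
      push_cast
      linarith
    have he24 : 7e9 ≤ Real.exp Y ^ 12 := by
      rw [← Real.exp_nat_mul]
      refine exp_big.trans ?_
      gcongr
      push_cast
      linarith
    have hfin : Real.exp (23 * Y) = Real.exp Y ^ 23 := by rw [← Real.exp_nat_mul]; norm_num
    rw [hfin] at hpow
    set e := Real.exp Y
    have he1 : 1 ≤ e := Real.one_le_exp hYp.le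
    calc (N : ℝ) * (11520 * qK K * Y) ≤ (401 * e ^ 2) * (11520 * (151 * e ^ 4) * e) := by
          have : (N : ℝ) ≤ 401 * e ^ 2 := hN2.trans (by gcongr)
          gcongr
      _ = 401 * 11520 * 151 * e ^ 7 := by ring
      _ ≤ 1 / 10 * (e ^ 12 * e ^ 7) := by
        have : 0 < e ^ 7 := by positivity
        have h8 := mul_le_mul_of_nonneg_right he24 this.le
        norm_num at h8 ⊢
        linarith only [h8, this]
      _ ≤ 1 / 10 * e ^ 23 := by
        rw [← pow_add]
        have : e ^ (12 + 7) ≤ e ^ 23 := pow_le_pow_right₀ he1 (by norm_num)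
        exact mul_le_mul_of_nonneg_left this (by norm_num)
      _ ≤ _ := by linarith

theorem deg_le_log (hn : 1 < Module.finrank ℚ K) :
    (Module.finrank ℚ K : ℝ) ≤ 3 * Real.log |(discr K : ℝ)| := by
  have h1 := abs_discr_ge hn
  have h3 := discr_ge_three hn
  have hp : (9 / 4 : ℝ) ≤ 3 * Real.pi / 4 := by linarith [Real.pi_gt_three]
  have h2 : (4 / 9 : ℝ) * (9 / 4) ^ Module.finrank ℚ K ≤ |(discr K : ℝ)| := by
    refine le_trans ?_ (h1.trans (le_of_eq (by push_cast; rfl)))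
    gcongr
  have h4 := Real.log_le_log (by positivity) h2
  rw [Real.log_mul (by norm_num) (by positivity), Real.log_pow] at h4
  have h5 : Real.log (4 / 9) = - Real.log (9 / 4) := by rw [← Real.log_inv]; norm_num
  have h6 : 1 / 2 ≤ Real.log (9 / 4) := by
    have : Real.log (9 / 4) ≥ Real.log 2 := Real.log_le_log (by norm_num) (by norm_num)
    linarith [Real.log_two_gt_d9]
  have h7 : 1 ≤ Real.log |(discr K : ℝ)| := log_three_gt.le.trans (Real.log_le_log (by norm_num) h3)
  rw [h5] at h4
  have h8 : (2 : ℝ) ≤ Module.finrank ℚ K := by exact_mod_cast hn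
  nlinarith only [h4, h6, h7, h8]

theorem MK_le_log (hn : 1 < Module.finrank ℚ K)
    (h6 : 6 ≤ Real.log |(discr K : ℝ)|) : MK K ≤ 3 * Real.log (Real.log |(discr K : ℝ)|) := by
  have h1 := deg_le_log hn
  have h3 := discr_ge_three hn
  have h8 : (2 : ℝ) ≤ Module.finrank ℚ K := by exact_mod_cast hn
  have h2 : Real.log (3 * |(discr K : ℝ)|) ≤ 2 * Real.log |(discr K : ℝ)| := by
    rw [Real.log_mul (by norm_num) (by linarith)]
    have := Real.log_le_log (by norm_num) h3
    linarith
  have h0 := (log3_ge (discr_ge_one K)).1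
  set u := Real.log |(discr K : ℝ)|
  have h9 : 3 * Real.log u = Real.log (u ^ 3) := by rw [Real.log_pow]; norm_num
  rw [h9, MK]
  apply Real.log_le_log (by positivity)
  calc _ ≤ (3 * u) * (2 * u) := by gcongr
    _ ≤ u ^ 3 := by nlinarith only [h6, mul_nonneg (mul_self_nonneg u) (sub_nonneg.2 h6)]

theorem large_disc (C : ℝ) (hC : 4 < C) : ∃ N : ℕ, ∀ (K : Type) [Field K] [NumberField K], 1 < Module.finrank ℚ K →
    (N : ℝ) < |(discr K : ℝ)| → 1003 * (MK K ^ C) ^ 2 ≤ Real.log |(discr K : ℝ)| := by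
  have h1 := (isLittleO_log_rpow_rpow_atTop (2 * C) (s := 1) one_pos).bound (show (0 : ℝ) < (1003 * 3 ^ (2 * C))⁻¹ by positivity)
  have h2 := Real.tendsto_log_atTop.eventually (h1.and (eventually_ge_atTop (6 : ℝ)))
  obtain ⟨a, ha⟩ := eventually_atTop.1 h2
  refine ⟨⌈a⌉₊, ?_⟩
  intro K _ _ hn hd
  obtain ⟨h3, h4⟩ := ha |(discr K : ℝ)| ((Nat.le_ceil a).trans hd.le)
  have h5 := MK_le_log hn h4
  have h6 := MK_ge hn
  set u := Real.log |(discr K : ℝ)|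
  have hu : 0 ≤ Real.log u := Real.log_nonneg (by linarith)
  rw [Real.rpow_one, Real.norm_of_nonneg (by positivity), Real.norm_of_nonneg (by linarith),
    inv_mul_eq_div, le_div_iff₀ (by positivity)] at h3
  have h7 : (MK K ^ C) ^ 2 = MK K ^ (2 * C) := by
    rw [← Real.rpow_natCast, ← Real.rpow_mul (by linarith)]; congr 1; push_cast; ring
  have h8 : MK K ^ (2 * C) ≤ (3 * Real.log u) ^ (2 * C) := Real.rpow_le_rpow (by linarith) h5 (by linarith)
  rw [Real.mul_rpow (by norm_num) hu] at h8
  rw [h7]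
  linarith

noncomputable def FK (K : Type*) [Field K] [NumberField K] : ℂ → ℂ := (exists_F K).choose

theorem FK_is (K : Type*) [Field K] [NumberField K] : IsFK K (FK K) := (exists_F K).choose_spec

theorem small_field {F : ℂ → ℂ} (hF : IsFK K F) :
    ∀ᶠ c in 𝓝[>] (0 : ℝ), ∀ s : ℂ, F s = 0 → |s.im| ≤ 1 → s.re ≤ 1 - c := by
  have hcp : IsCompact ((Set.Icc (0 : ℝ) 1) ×ℂ (Set.Icc (-1 : ℝ) 1)) := isCompact_Icc.reProdIm isCompact_Icc
  have hcp2 : IsCompact (((Set.Icc (0 : ℝ) 1) ×ℂ (Set.Icc (-1 : ℝ) 1)) ∩ F ⁻¹' {0}) :=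
    hcp.inter_right (isClosed_singleton.preimage hF.1.continuous)
  have hex : ∃ c > 0, c ≤ 1 ∧ ∀ s : ℂ, F s = 0 → |s.im| ≤ 1 → s.re ≤ 1 - c := by
    rcases Set.eq_empty_or_nonempty (((Set.Icc (0 : ℝ) 1) ×ℂ (Set.Icc (-1 : ℝ) 1)) ∩ F ⁻¹' {0}) with he | hne
    · refine ⟨1, one_pos, le_rfl, fun s h0 hi => ?_⟩
      by_contra hc
      have : s ∈ (((Set.Icc (0 : ℝ) 1) ×ℂ (Set.Icc (-1 : ℝ) 1)) ∩ F ⁻¹' {0}) :=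
        ⟨⟨⟨by linarith, (F_re_lt hF h0).le⟩, abs_le.1 hi⟩, h0⟩
      rw [he] at this
      exact this
    · obtain ⟨z, hz, hmax⟩ := hcp2.exists_isMaxOn hne Complex.continuous_re.continuousOn
      have hz1 := F_re_lt hF hz.2
      have hz0 : 0 ≤ z.re := hz.1.1.1
      refine ⟨1 - z.re, by linarith, by linarith, fun s h0 hi => ?_⟩
      by_cases hs : 0 ≤ s.re
      · have := hmax (show s ∈ (((Set.Icc (0 : ℝ) 1) ×ℂ (Set.Icc (-1 : ℝ) 1)) ∩ F ⁻¹' {0}) from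
          ⟨⟨⟨hs, (F_re_lt hF h0).le⟩, abs_le.1 hi⟩, h0⟩)
        simp only [Set.mem_ofPred_eq] at this
        linarith
      · linarith
  obtain ⟨c, hc, -, h⟩ := hex
  filter_upwards [Ioo_mem_nhdsGT hc] with c' hc' s h0 hi
  linarith [h s h0 hi, hc'.2]

theorem small_all (N : ℕ) : ∃ c : ℝ, 0 < c ∧ ∀ (K : IntermediateField ℚ ℂ) [NumberField K],
    |(discr K : ℝ)| ≤ N → ∀ s : ℂ, FK K s = 0 → |s.im| ≤ 1 → s.re ≤ 1 - c := by
  have hfin := NumberField.finite_of_discr_bdd ℂ N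
  have h : ∀ᶠ c in 𝓝[>] (0 : ℝ), ∀ K ∈ {K : { F : IntermediateField ℚ ℂ // FiniteDimensional ℚ F} |
      haveI :  NumberField K := @NumberField.mk _ _ inferInstance K.prop
      |discr K| ≤ N }, 
      haveI :  NumberField K := @NumberField.mk _ _ inferInstance K.prop
      ∀ s : ℂ, FK K s = 0 → |s.im| ≤ 1 → s.re ≤ 1 - c := by
    rw [eventually_all_finite hfin]
    intro K _
    haveI :  NumberField K := @NumberField.mk _ _ inferInstance K.prop
    exact small_field (FK_is K)
  obtain ⟨c, h1, h2⟩ := (h.and self_mem_nhdsWithin).exists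
  refine ⟨c, h2, fun K _ hd s h0 hi => ?_⟩
  refine h1 ⟨K, inferInstance⟩ ?_ s h0 hi
  show |discr K| ≤ (N : ℤ)
  exact_mod_cast hd

theorem zero_free (C : ℝ) (hC : 4 < C) (hm : MDZH C) : ∃ c : ℝ, 0 < c ∧ c ≤ 1 / 1604 ∧
    ∀ (K : IntermediateField ℚ ℂ) [NumberField K], 1 < Module.finrank ℚ K → ∀ R δ : ℝ, 1 ≤ R → 0 < δ →
      δ * ((MK K ^ C) ^ 2 * Real.log (4 * R)) ≤ c →
      ∀ z ∈ Metric.ball ((1 + R : ℝ) : ℂ) (R + δ), FK K z ≠ 0 := by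
  obtain ⟨N, hN⟩ := large_disc C hC
  obtain ⟨c1, hc1, hsm⟩ := small_all N
  refine ⟨min c1 (1 / 1604), by positivity, min_le_right _ _, ?_⟩
  intro K _ hn R δ hR hδ0 hδ z hz h0
  have hF := FK_is K
  obtain ⟨hY2, hMY⟩ := MKC_ge hn hC
  have h1 := hδ.trans (min_le_left _ _)
  have h2 := hδ.trans (min_le_right _ _)
  have hlt := F_re_lt hF h0
  have hnear := near_M hF hC hm hn
  have hzz : 0 < z.re → _ := mdzh_zero hF hm hn h0
  have hd3 := discr_ge_three hn
  have hN' := hN K hn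
  set Y := MK K ^ C with hY
  have hl : 1 < Real.log (4 * R) := by
    have : Real.log 4 ≤ Real.log (4 * R) := Real.log_le_log (by norm_num) (by linarith)
    linarith [log_four_gt]
  set l := Real.log (4 * R) with hl'
  have hYl : 1 ≤ Y ^ 2 * l := by nlinarith only [hY2, hl]
  have hδ1 : δ ≤ min c1 (1 / 1604) := by nlinarith only [hδ, hYl, hδ0]
  have hδc : δ ≤ c1 := hδ1.trans (min_le_left _ _)
  have hδh : δ ≤ 1 / 1604 := hδ1.trans (min_le_right _ _)
  have hre : 1 - δ < z.re := by
    rw [Metric.mem_ball, dist_comm, dist_eq_norm] at hz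
    have := (Complex.abs_re_le_norm _).trans_lt hz
    have := (le_abs_self _).trans_lt this
    rw [Complex.sub_re, Complex.ofReal_re] at this
    linarith
  have him : z.im ^ 2 ≤ 2 * R * δ + δ ^ 2 := by
    rw [Metric.mem_ball, dist_eq_norm] at hz
    have h5 : ‖z - ((1 + R : ℝ) : ℂ)‖ ^ 2 = (z.re - (1 + R)) ^ 2 + z.im ^ 2 := by
      rw [← Complex.normSq_eq_norm_sq, Complex.normSq_apply]; simp; ring
    have h6 : ‖z - ((1 + R : ℝ) : ℂ)‖ ^ 2 ≤ (R + δ) ^ 2 := pow_le_pow_left₀ (norm_nonneg _) hz.le 2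
    have h7 : R ^ 2 ≤ (z.re - (1 + R)) ^ 2 := by nlinarith only [hlt, hR]
    linarith
  have him2 : |z.im| ≤ 2 * R := by
    refine abs_le_of_sq_le_sq ?_ (by linarith)
    nlinarith only [him, hδh, hδ0, hR]
  obtain ⟨z1, z2⟩ := hzz (by linarith)
  have hYp : 0 < Y := by linarith
  have hδY : δ * (Y * l) ≤ 1 / 1604 := by
    refine le_trans ?_ h2
    have : Y ≤ Y ^ 2 := by nlinarith only [hY2]
    gcongr
  have hlogi : (1 + 4 * Real.log |(discr K : ℝ)|)⁻¹ ≤ 1 := by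
    apply inv_le_one_of_one_le₀
    have := Real.log_nonneg (show (1 : ℝ) ≤ |(discr K : ℝ)| by linarith)
    linarith
  by_cases hbig : (1 + 4 * Real.log |(discr K : ℝ)|)⁻¹ ≤ |z.im|
  · have h3 := z2 hbig
    have h4 : Real.log (|z.im| + 2) ≤ l := Real.log_le_log (by positivity) (by linarith)
    have h5 : 0 < Real.log (|z.im| + 2) := Real.log_pos (by linarith [abs_nonneg z.im])
    have h6 : (Y * l)⁻¹ ≤ (Y * Real.log (|z.im| + 2))⁻¹ := inv_anti₀ (by positivity) (by gcongr)
    have h7 : δ ≤ (Y * l)⁻¹ := by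
      rw [le_inv_comm₀ hδ0 (by positivity), ← one_div, le_div_iff₀ hδ0]; linarith
    linarith
  rw [not_le] at hbig
  by_cases hd : |(discr K : ℝ)| ≤ N
  · have := hsm K hd z h0 (hbig.le.trans hlogi)
    linarith
  rw [not_le] at hd
  have hD := hN' hd
  have hδY2 : δ * Y ^ 2 ≤ 1 / 1604 := by
    refine le_trans ?_ h2
    have : 0 < δ * Y ^ 2 := by positivity
    nlinarith only [this, hl]
  have hball : z ∈ Metric.ball (2 : ℂ) (1 + 1 / (2 * Y)) := by
    rw [Metric.mem_ball, dist_eq_norm]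
    apply lt_of_pow_lt_pow_left₀ 2 (by positivity)
    have h5 : ‖z - 2‖ ^ 2 = (z.re - 2) ^ 2 + z.im ^ 2 := by
      rw [← Complex.normSq_eq_norm_sq, Complex.normSq_apply]; simp; ring
    have h6 : (z.re - 2) ^ 2 ≤ (1 + δ) ^ 2 := by nlinarith only [hre, hlt]
    have h7 : (1 + δ) ^ 2 ≤ 1 + 3 * δ := by nlinarith only [hδh, hδ0]
    have hYi : Y * (1 / (2 * Y)) = 1 / 2 := by field_simp
    have hY0 : 0 < 1 / (2 * Y) := by positivity
    have h8 : 3 * δ ≤ 1 / (2 * Y) := by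
      rw [le_div_iff₀ (by positivity)]
      nlinarith only [hδY2, hY2, hδ0]
    have h9 : |z.im| ≤ 1 / (2 * Y) := by
      refine hbig.le.trans ?_
      rw [one_div]
      apply inv_anti₀ (by positivity)
      nlinarith only [hD, hY2]
    have h10 : z.im ^ 2 ≤ (1 / (2 * Y)) ^ 2 := by
      rw [← sq_abs]; exact pow_le_pow_left₀ (abs_nonneg _) h9 2
    nlinarith only [h5, h6, h7, h8, h10, hY0]
  have h3 := hnear hD z hball h0
  have h4 : δ ≤ 1 / (1604 * Y ^ 2) := by
    rw [le_div_iff₀ (by positivity)]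
    linarith
  linarith

theorem discr_le_of_basis {ι : Type*} [Fintype ι] [DecidableEq ι]
    (b : Module.Basis ι ℚ K) (hb : ∀ i, IsIntegral ℤ (b i)) :
    |(discr K : ℝ)| ≤ |((Algebra.discr ℚ b : ℚ) : ℝ)| := by
  classical
  set B := integralBasis K with hB
  set b' := b.reindex (b.indexEquiv B) with hb'
  have h1 : Algebra.discr ℚ b = Algebra.discr ℚ b' := by
    rw [hb', Module.Basis.coe_reindex, Algebra.discr_reindex]
  have h2 : Algebra.discr ℚ b' = (B.toMatrix b').det ^ 2 * Algebra.discr ℚ B := by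
    rw [← Algebra.discr_of_matrix_vecMul, Module.Basis.toMatrix_map_vecMul]
  have hb2 : ∀ i, ∃ x : 𝓞 K, algebraMap (𝓞 K) K x = b' i := by
    intro i
    refine ⟨⟨b' i, ?_⟩, rfl⟩
    rw [hb', Module.Basis.reindex_apply]
    exact hb _
  choose x hx using hb2
  set Q : Matrix _ _ ℤ := fun i j => (RingOfIntegers.basis K).repr (x j) i with hQ
  have h3 : B.toMatrix b' = Q.map (algebraMap ℤ ℚ) := by
    ext i j
    rw [Module.Basis.toMatrix_apply, ← hx, hB, integralBasis_repr_apply]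
    rfl
  have h4 : (B.toMatrix b').det = ((Q.det : ℤ) : ℚ) := by
    rw [h3]; exact (RingHom.map_det (algebraMap ℤ ℚ) Q).symm
  have h5 : Algebra.discr ℚ b = ((Q.det ^ 2 * discr K : ℤ) : ℚ) := by
    rw [h1, h2, h4, hB, ← coe_discr]; push_cast; ring
  have h6 : Q.det ≠ 0 := by
    intro h
    rw [h] at h5
    exact Algebra.discr_not_zero_of_basis ℚ b (by rw [h5]; simp)
  rw [h5]
  have h7 : |discr K| ≤ |Q.det ^ 2 * discr K| := by
    rw [abs_mul]
    have : 1 ≤ |Q.det ^ 2| := Int.one_le_abs (pow_ne_zero 2 h6)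
    nlinarith [abs_nonneg (discr K)]
  exact_mod_cast h7

theorem field_data (f : Polynomial ℤ) (σ : ℕ) (hd : 2 ≤ f.natDegree)
    (hq : ∀ q : ℚ, Polynomial.aeval q f ≠ 0) (hc : ∀ i, |f.coeff i| ≤ 2 ^ σ) :
    ∃ (K : IntermediateField ℚ ℂ) (_ : NumberField K), 1 < Module.finrank ℚ K ∧ Module.finrank ℚ K ≤ f.natDegree ∧
      (∀ p : ℕ, p.Prime → ¬ (p : ℤ) ∣ f.leadingCoeff →
        (∃ P : Ideal (𝓞 K), P.IsPrime ∧ Ideal.absNorm P = p) → ∃ a : ZMod p, Polynomial.aeval a f = 0) ∧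
      |(discr K : ℝ)| ≤ (2 ^ (σ + 2)) ^ (2 * f.natDegree ^ 2) := by
  have hf0 : f ≠ 0 := by rintro rfl; simp at hd
  set l := f.leadingCoeff with hl
  have hl0 : l ≠ 0 := Polynomial.leadingCoeff_ne_zero.2 hf0
  obtain ⟨α, hα⟩ : ∃ α : ℂ, Polynomial.aeval α f = 0 := by
    refine IsAlgClosed.exists_aeval_eq_zero ℂ f ?_
    rw [Polynomial.degree_eq_natDegree hf0]
    exact_mod_cast (by omega : f.natDegree ≠ 0)
  set θ : ℂ := (l : ℂ) * α with hθ
  have hθ0 : Polynomial.aeval θ (f.scaleRoots l) = 0 := by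
    have := Polynomial.scaleRoots_aeval_eq_zero (r := l) hα
    simpa [hθ] using this
  have hθi : IsIntegral ℤ θ := by
    have := isIntegral_leadingCoeff_smul f α hα
    rwa [← hl, zsmul_eq_mul] at this
  have hθq : IsIntegral ℚ θ := hθi.tower_top
  set K := IntermediateField.adjoin ℚ {θ} with hK
  have hfd : FiniteDimensional ℚ K := IntermediateField.adjoin.finiteDimensional hθq
  have hnf : NumberField K := { to_charZero := inferInstance, to_finiteDimensional := hfd }
  set g : K := IntermediateField.AdjoinSimple.gen ℚ θ with hg
  have hgθ : algebraMap K ℂ g = θ := IntermediateField.AdjoinSimple.algebraMap_gen ℚ θ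
  have hg0 : Polynomial.aeval g (f.scaleRoots l) = 0 := by
    apply (algebraMap K ℂ).injective
    rw [← Polynomial.aeval_algebraMap_apply, hgθ, hθ0, map_zero]
  have hgi : IsIntegral ℤ g := by
    rw [← isIntegral_algebraMap_iff (algebraMap K ℂ).injective, hgθ]; exact hθi
  have hsn : f.scaleRoots l ≠ 0 := Polynomial.scaleRoots_ne_zero hf0 _
  have hfr : Module.finrank ℚ K = (minpoly ℚ θ).natDegree := IntermediateField.adjoin.finrank hθq
  have hle : Module.finrank ℚ K ≤ f.natDegree := by
    rw [hfr]
    have h1 : minpoly ℚ θ ∣ (f.scaleRoots l).map (algebraMap ℤ ℚ) := by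
      apply minpoly.dvd
      rw [Polynomial.aeval_map_algebraMap, hθ0]
    have h2 := Polynomial.natDegree_le_of_dvd h1 ((Polynomial.map_ne_zero_iff (algebraMap ℤ ℚ).injective_int).2 hsn)
    refine h2.trans (Polynomial.natDegree_map_le.trans ?_)
    rw [Polynomial.natDegree_scaleRoots]
  refine ⟨K, hnf, ?_, hle, ?_, ?_⟩
  · by_contra h
    have h1 : Module.finrank ℚ K = 1 := by
      have : 0 < Module.finrank ℚ K := Module.finrank_pos
      omega
    rw [hK, IntermediateField.finrank_adjoin_simple_eq_one_iff, IntermediateField.mem_bot] at h1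
    obtain ⟨q, hq1⟩ := h1
    apply hq (q / l)
    apply (algebraMap ℚ ℂ).injective
    rw [← Polynomial.aeval_algebraMap_apply, map_zero, map_div₀, hq1, hθ]
    have : (l : ℂ) ≠ 0 := by exact_mod_cast hl0
    have h3 : (l : ℂ) * α / algebraMap ℚ ℂ (l : ℚ) = α := by
      rw [map_intCast, mul_div_cancel_left₀ _ this]
    rw [h3, hα]
  · rintro p hp hpl ⟨P, hP, hPn⟩
    have : Fact p.Prime := ⟨hp⟩
    have hcard : Nat.card (𝓞 K ⧸ P) = p := by
      rw [← hPn, Ideal.absNorm_apply, Submodule.cardQuot_apply]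
    have : Finite (𝓞 K ⧸ P) := Nat.finite_of_card_ne_zero (by rw [hcard]; exact hp.ne_zero)
    have := Fintype.ofFinite (𝓞 K ⧸ P)
    have e := ZMod.ringEquivOfPrime (𝓞 K ⧸ P) hp (by rw [← Nat.card_eq_fintype_card, hcard])
    let φ : 𝓞 K →+* ZMod p := (e.symm : (𝓞 K ⧸ P) →+* ZMod p).comp (Ideal.Quotient.mk P)
    let g' : 𝓞 K := ⟨g, hgi⟩
    have hg' : Polynomial.aeval g' (f.scaleRoots l) = 0 := by
      apply RingOfIntegers.coe_injective
      rw [← Polynomial.aeval_algebraMap_apply, map_zero]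
      exact hg0
    have hφ : Polynomial.eval₂ (Int.castRingHom (ZMod p)) (φ g') (f.scaleRoots l) = 0 := by
      have h1 := congrArg φ hg'
      rw [Polynomial.aeval_def, Polynomial.hom_eval₂, map_zero] at h1
      rwa [Subsingleton.elim (φ.comp (algebraMap ℤ (𝓞 K))) (Int.castRingHom (ZMod p))] at h1
    have hlp : ((l : ℤ) : ZMod p) ≠ 0 := by
      rwa [Ne, ZMod.intCast_zmod_eq_zero_iff_dvd]
    refine ⟨φ g' / (l : ZMod p), ?_⟩
    have h2 := Polynomial.scaleRoots_eval₂_mul (p := f) (Int.castRingHom (ZMod p)) (φ g' / (l : ZMod p)) l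
    rw [eq_intCast, mul_div_cancel₀ _ hlp, hφ] at h2
    rw [Polynomial.aeval_def, Subsingleton.elim (algebraMap ℤ (ZMod p)) (Int.castRingHom (ZMod p))]
    exact (mul_eq_zero.1 h2.symm).resolve_left (pow_ne_zero _ hlp)
  · set pb := IntermediateField.adjoin.powerBasis hθq with hpb
    have hgen : pb.gen = g := rfl
    have hdim : pb.dim = Module.finrank ℚ K := pb.finrank.symm
    refine (discr_le_of_basis pb.basis ?_).trans ?_
    · intro i
      rw [pb.basis_eq_pow, hgen]
      exact hgi.pow _
    obtain ⟨e⟩ : Nonempty (Fin pb.dim ≃ (K →ₐ[ℚ] ℂ)) := by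
      refine Fintype.card_eq.1 ?_
      rw [Fintype.card_fin, AlgHom.card, hdim]
    have hbd : ∀ τ : K →ₐ[ℚ] ℂ, ‖τ g‖ ≤ 2 ^ (σ + 1) := by
      intro τ
      have h1 : Polynomial.eval₂ (Int.castRingHom ℂ) (τ g) (f.scaleRoots l) = 0 := by
        have h1 := congrArg τ hg0
        rw [Polynomial.aeval_def, ← AlgHom.coe_toRingHom, Polynomial.hom_eval₂, map_zero] at h1
        rwa [Subsingleton.elim (((τ : K →+* ℂ)).comp (algebraMap ℤ K)) (Int.castRingHom ℂ)] at h1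
      have hlc : (l : ℂ) ≠ 0 := by exact_mod_cast hl0
      have h2 := Polynomial.scaleRoots_eval₂_mul (p := f) (Int.castRingHom ℂ) (τ g / (l : ℂ)) l
      rw [eq_intCast, mul_div_cancel₀ _ hlc, h1] at h2
      have h3 := (mul_eq_zero.1 h2.symm).resolve_left (pow_ne_zero _ hlc)
      have hinj : Function.Injective (Int.castRingHom ℂ) := (Int.castRingHom ℂ).injective_int
      have h4 : (f.map (Int.castRingHom ℂ)).IsRoot (τ g / (l : ℂ)) := by
        rw [Polynomial.IsRoot, Polynomial.eval_map]; exact h3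
      have h5 := h4.norm_lt_cauchyBound ((Polynomial.map_ne_zero_iff hinj).2 hf0)
      have hlc1 : (f.map (Int.castRingHom ℂ)).leadingCoeff = (l : ℂ) := by
        rw [Polynomial.leadingCoeff_map_of_injective hinj]; rfl
      have h6 : (Polynomial.cauchyBound (f.map (Int.castRingHom ℂ)) : ℝ) ≤ 2 ^ σ / ‖(l : ℂ)‖ + 1 := by
        rw [Polynomial.cauchyBound, hlc1]
        have h7 : (Finset.sup (Finset.range (f.map (Int.castRingHom ℂ)).natDegree)
            (fun x => ‖(f.map (Int.castRingHom ℂ)).coeff x‖₊)) ≤ (2 ^ σ : NNReal) := by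
          apply Finset.sup_le
          intro i _
          rw [← NNReal.coe_le_coe, coe_nnnorm, Polynomial.coeff_map, eq_intCast, Complex.norm_intCast]
          push_cast
          exact_mod_cast hc i
        push_cast
        gcongr
        exact_mod_cast h7
      have hlpos : 0 < ‖(l : ℂ)‖ := norm_pos_iff.2 hlc
      rw [← NNReal.coe_lt_coe, coe_nnnorm, norm_div, div_lt_iff₀ hlpos] at h5
      have h8 : ‖(l : ℂ)‖ ≤ 2 ^ σ := by
        rw [Complex.norm_intCast]
        exact_mod_cast hc f.natDegree
      calc ‖τ g‖ ≤ (2 ^ σ / ‖(l : ℂ)‖ + 1) * ‖(l : ℂ)‖ := h5.le.trans (by gcongr)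
        _ = 2 ^ σ + ‖(l : ℂ)‖ := by field_simp
        _ ≤ 2 ^ (σ + 1) := by rw [pow_succ]; linarith
    have h1 := Algebra.discr_powerBasis_eq_prod ℚ ℂ pb e
    have h2 : |((Algebra.discr ℚ pb.basis : ℚ) : ℝ)| = ‖algebraMap ℚ ℂ (Algebra.discr ℚ pb.basis)‖ := by
      rw [eq_ratCast, Complex.norm_ratCast]
    have h1' : ‖algebraMap ℚ ℂ (Algebra.discr ℚ pb.basis)‖ =
        ‖∏ i : Fin pb.dim, ∏ j ∈ Finset.Ioi i, (e j pb.gen - e i pb.gen) ^ 2‖ := by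
      convert! congrArg norm h1
    rw [h2, h1', norm_prod]
    have hone : (1 : ℝ) ≤ 2 ^ (σ + 2) := one_le_pow₀ (by norm_num)
    have h3 : ∀ i : Fin pb.dim, ‖∏ j ∈ Finset.Ioi i, (e j pb.gen - e i pb.gen) ^ 2‖ ≤ ((2 ^ (σ + 2) : ℝ) ^ 2) ^ pb.dim := by
      intro i
      rw [norm_prod]
      calc _ ≤ ∏ j ∈ Finset.Ioi i, (2 ^ (σ + 2) : ℝ) ^ 2 := by
            apply Finset.prod_le_prod
            · intros; positivity
            · intro j _
              rw [norm_pow]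
              refine pow_le_pow_left₀ (norm_nonneg _) ?_ 2
              refine (norm_sub_le _ _).trans ?_
              have ha := hbd (e j); have hb := hbd (e i)
              rw [hgen, pow_succ _ (σ + 1)]
              linarith
        _ = ((2 ^ (σ + 2) : ℝ) ^ 2) ^ (Finset.Ioi i).card := Finset.prod_const _
        _ ≤ _ := by
          refine pow_le_pow_right₀ (one_le_pow₀ hone) ?_
          exact (Finset.card_le_univ _).trans (by rw [Fintype.card_fin])
    calc _ ≤ ∏ i : Fin pb.dim, ((2 ^ (σ + 2) : ℝ) ^ 2) ^ pb.dim :=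
          Finset.prod_le_prod (fun _ _ => norm_nonneg _) fun i _ => h3 i
      _ = (2 ^ (σ + 2) : ℝ) ^ (2 * pb.dim ^ 2) := by
        rw [Finset.prod_const, Finset.card_univ, Fintype.card_fin, ← pow_mul, ← pow_mul]; congr 1; ring
      _ ≤ _ := by
        refine pow_le_pow_right₀ hone ?_
        rw [hdim]
        gcongr

theorem MK_le_L (hn : 1 < Module.finrank ℚ K) {d σ : ℕ} (hd : 2 ≤ d)
    (hσ : 0 < σ) (hnd : Module.finrank ℚ K ≤ d) (hD : |(discr K : ℝ)| ≤ (2 ^ (σ + 2)) ^ (2 * d ^ 2)) :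
    MK K ≤ 2 * Real.log ((d : ℝ) ^ 2 * σ + (d : ℝ) ^ 3) := by
  have h0 := (log3_ge (discr_ge_one K)).1
  have h1 := discr_ge_one K
  have hn0 : (0 : ℝ) < Module.finrank ℚ K := by exact_mod_cast (by omega : 0 < Module.finrank ℚ K)
  have hnd' : (Module.finrank ℚ K : ℝ) ≤ d := by exact_mod_cast hnd
  have hd' : (2 : ℝ) ≤ d := by exact_mod_cast hd
  have hσ' : (1 : ℝ) ≤ σ := by exact_mod_cast hσ
  have h2 : Real.log (3 * |(discr K : ℝ)|) ≤ 2 + 3 / 2 * d ^ 2 * (σ + 2) := by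
    rw [Real.log_mul (by norm_num) (by linarith)]
    have h3 : Real.log 3 ≤ 2 := by linarith [Real.log_le_sub_one_of_pos (show (0 : ℝ) < 3 by norm_num)]
    have h4 := Real.log_le_log (by linarith) hD
    rw [Real.log_pow, Real.log_pow] at h4
    push_cast at h4
    have h5 := Real.log_two_lt_d9
    have h6 : 2 * (d : ℝ) ^ 2 * ((σ + 2) * Real.log 2) ≤ 2 * d ^ 2 * ((σ + 2) * (3 / 4)) := by gcongr; linarith
    nlinarith only [h3, h4, h6]
  have h7 : 2 * Real.log ((d : ℝ) ^ 2 * σ + (d : ℝ) ^ 3) = Real.log (((d : ℝ) ^ 2 * σ + (d : ℝ) ^ 3) ^ 2) := by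
    rw [Real.log_pow]; norm_num
  rw [h7, MK]
  apply Real.log_le_log (by positivity)
  calc _ ≤ (d : ℝ) * (2 + 3 / 2 * d ^ 2 * (σ + 2)) := by gcongr
    _ ≤ 5 * d ^ 3 * σ := by
      have h8 : (d : ℝ) * 4 ≤ d * d ^ 2 := by gcongr; nlinarith only [hd']
      have h9 : (d : ℝ) ^ 3 ≤ d ^ 3 * σ := le_mul_of_one_le_right (by positivity) hσ'
      nlinarith only [h8, h9]
    _ ≤ 8 * (d ^ 3 * σ) := by
      have : 0 ≤ (d : ℝ) ^ 3 * σ := by positivity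
      linarith
    _ ≤ (2 * d ^ 2) * (d ^ 3 * σ) := by gcongr; nlinarith only [hd']
    _ ≤ _ := by nlinarith only [sq_nonneg ((d : ℝ) ^ 2 * σ), sq_nonneg ((d : ℝ) ^ 3)]

theorem count_le (f : Polynomial ℤ) (σ : ℕ) (hf : f ≠ 0)
    (hnd : Module.finrank ℚ K ≤ f.natDegree) (hc : ∀ i, |f.coeff i| ≤ 2 ^ σ)
    (hroot : ∀ p : ℕ, p.Prime → ¬ (p : ℤ) ∣ f.leadingCoeff →
        (∃ P : Ideal (𝓞 K), P.IsPrime ∧ Ideal.absNorm P = p) → ∃ a : ZMod p, Polynomial.aeval a f = 0)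
    {x : ℝ} (hx : 1 ≤ x) :
    ∑ m ∈ Finset.range (⌊x⌋₊ + 1), lamK K m ≤
      f.natDegree * Real.log x * piPoly f x + f.natDegree * (2 * √x * Real.log x) + f.natDegree * σ := by
  classical
  set d : ℝ := (f.natDegree : ℝ) with hd
  have hX : 0 ≤ Real.log x := Real.log_nonneg hx
  have hd0 : 0 ≤ d := Nat.cast_nonneg _
  have hn' : (Module.finrank ℚ K : ℝ) ≤ d := by rw [hd]; exact_mod_cast hnd
  have hlam : ∀ m, lamK K m ≤ d * ArithmeticFunction.vonMangoldt m := fun m =>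
    (lamK_le m).trans (mul_le_mul_of_nonneg_right hn' ArithmeticFunction.vonMangoldt_nonneg)
  have key : ∀ m ∈ Finset.range (⌊x⌋₊ + 1), lamK K m ≤
      (if (m.Prime ∧ ∃ a : ZMod m, Polynomial.aeval a f = 0) then d * Real.log x else 0) +
      (d * (if ¬ m.Prime then ArithmeticFunction.vonMangoldt m else 0) +
       d * (if m ∈ f.leadingCoeff.natAbs.primeFactors then Real.log m else 0)) := by
    intro m hm
    have hlm : 0 ≤ (if m ∈ f.leadingCoeff.natAbs.primeFactors then Real.log m else 0) := by
      split_ifs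
      · exact Real.log_natCast_nonneg m
      · exact le_rfl
    have h1 : 0 ≤ (if (m.Prime ∧ ∃ a : ZMod m, Polynomial.aeval a f = 0) then d * Real.log x else 0) := by
      split_ifs
      · positivity
      · exact le_rfl
    by_cases hp : m.Prime
    · rw [if_neg (not_not.2 hp), mul_zero, zero_add]
      by_cases hl0 : m ∈ f.leadingCoeff.natAbs.primeFactors
      · rw [if_pos hl0]
        have := hlam m
        rw [ArithmeticFunction.vonMangoldt_apply_prime hp] at this
        linarith
      · have hndvd : ¬ (m : ℤ) ∣ f.leadingCoeff := by
          intro h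
          apply hl0
          rw [Nat.mem_primeFactors]
          refine ⟨hp, Int.natCast_dvd.1 h, ?_⟩
          rw [Ne, Int.natAbs_eq_zero]
          exact Polynomial.leadingCoeff_ne_zero.2 hf
        by_cases hz : lamK K m = 0
        · rw [hz]; positivity
        · have hr := hroot m hp hndvd (lamK_prime hp hz)
          rw [if_pos ⟨hp, hr⟩]
          have := hlam m
          rw [ArithmeticFunction.vonMangoldt_apply_prime hp] at this
          have h3 : Real.log m ≤ Real.log x := by
            apply Real.log_le_log (by exact_mod_cast hp.pos)
            have : m ≤ ⌊x⌋₊ := by rw [Finset.mem_range] at hm; omega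
            exact (Nat.le_floor_iff (by linarith)).1 this
          have h4 := mul_le_mul_of_nonneg_left h3 hd0
          have h5 := mul_nonneg hd0 hlm
          linarith
    · rw [if_pos hp]
      have := hlam m
      have h5 := mul_nonneg hd0 hlm
      linarith
  refine (Finset.sum_le_sum key).trans ?_
  rw [Finset.sum_add_distrib, Finset.sum_add_distrib, ← Finset.mul_sum, ← Finset.mul_sum, add_assoc]
  have hpi : ∑ m ∈ Finset.range (⌊x⌋₊ + 1),
      (if (m.Prime ∧ ∃ a : ZMod m, Polynomial.aeval a f = 0) then d * Real.log x else 0) =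
      d * Real.log x * piPoly f x := by
    rw [← Finset.sum_filter, Finset.sum_const, nsmul_eq_mul, piPoly, mul_comm]
  have hpsi : ∑ m ∈ Finset.range (⌊x⌋₊ + 1), (if ¬ m.Prime then ArithmeticFunction.vonMangoldt m else 0) ≤
      2 * √x * Real.log x := by
    refine le_trans (le_of_eq ?_) ((le_abs_self _).trans (Chebyshev.abs_psi_sub_theta_le_sqrt_mul_log hx))
    rw [Chebyshev.psi_sub_theta_eq_sum_not_prime, Finset.sum_filter, Finset.range_eq_Ico,
      Finset.sum_eq_sum_Ico_succ_bot (by omega)]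
    simp only [ArithmeticFunction.map_zero, ite_self, zero_add]
    rfl
  have hlead : ∑ m ∈ Finset.range (⌊x⌋₊ + 1), (if m ∈ f.leadingCoeff.natAbs.primeFactors then Real.log m else 0) ≤ σ := by
    calc _ ≤ ∑ m ∈ f.leadingCoeff.natAbs.primeFactors, Real.log m := by
          rw [← Finset.sum_filter]
          apply Finset.sum_le_sum_of_subset_of_nonneg
          · intro m hm; exact (Finset.mem_filter.1 hm).2
          · intro m _ _; exact Real.log_natCast_nonneg m
      _ = Real.log (((∏ m ∈ f.leadingCoeff.natAbs.primeFactors, m : ℕ)) : ℝ) := by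
          push_cast
          rw [Real.log_prod]
          intro m hm
          exact_mod_cast (Nat.prime_of_mem_primeFactors hm).ne_zero
      _ ≤ Real.log (2 ^ σ) := by
          have hl0 : f.leadingCoeff.natAbs ≠ 0 := by
            rw [Ne, Int.natAbs_eq_zero]; exact Polynomial.leadingCoeff_ne_zero.2 hf
          have hle := Nat.le_of_dvd (Nat.pos_of_ne_zero hl0) (Nat.prod_primeFactors_dvd f.leadingCoeff.natAbs)
          apply Real.log_le_log
          · exact_mod_cast Finset.prod_pos fun m hm => (Nat.prime_of_mem_primeFactors hm).pos
          · have h2 : f.leadingCoeff.natAbs ≤ 2 ^ σ := by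
              have := hc f.natDegree
              zify
              exact_mod_cast this
            exact_mod_cast hle.trans h2
      _ ≤ σ := by
          rw [Real.log_pow]
          have := Real.log_two_lt_d9
          have h3 : (0 : ℝ) ≤ σ := Nat.cast_nonneg _
          nlinarith only [this, h3]
  rw [hpi]
  gcongr

theorem X_lower {C L E : ℝ} (hC : 4 < C) (hL : 1 ≤ L) (hE : 1 ≤ E) :
    E ^ 4 * ((L ^ C) ^ 2 * L) ≤ E ^ C * L ^ (C * C) := by
  have h1 : E ^ 4 ≤ E ^ C := by
    rw [← Real.rpow_natCast]; exact Real.rpow_le_rpow_of_exponent_le hE (by push_cast; linarith)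
  have h2 : (L ^ C) ^ 2 * L ≤ L ^ (C * C) := by
    have : (L ^ C) ^ 2 * L = L ^ (C * 2 + 1) := by
      rw [Real.rpow_add (by linarith), Real.rpow_one, Real.rpow_mul (by linarith)]
      congr 1
      exact (Real.rpow_natCast _ 2).symm
    rw [this]
    exact Real.rpow_le_rpow_of_exponent_le hL (by nlinarith only [hC])
  exact mul_le_mul h1 h2 (by positivity) (by positivity)

theorem err_main {C c0 : ℝ} (hC : 4 < C) (h0 : 0 < c0) (h1 : c0 ≤ 1 / 1604) :
    ∃ E0 : ℝ, 100 ≤ E0 ∧ ∀ L E X δ : ℝ, 1 ≤ L → E0 ≤ E → X = E ^ C * L ^ (C * C) → X ≤ Real.exp E →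
      δ = c0 / (((2 * L) ^ C) ^ 2 * (10 * E)) →
      Real.exp (32 * E) * X ^ 2 * (5760 * (151 * Real.exp (8 * L)) / δ) * Real.exp (-(X * δ / 2)) ≤ Real.exp (-E) := by
  set A0 := 5760 * 151 * 10 / c0 with hA0
  have hA1 : 1 ≤ A0 := by
    rw [hA0, le_div_iff₀ h0]; linarith
  set K0 := Real.log A0 with hK0
  have hK : 0 ≤ K0 := Real.log_nonneg hA1
  have hAe : A0 = Real.exp K0 := (Real.exp_log (by linarith)).symm
  set κ := c0 / (20 * ((2 : ℝ) ^ C) ^ 2) with hκ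
  have hκ0 : 0 < κ := by positivity
  refine ⟨100 + (44 + K0 + 4 * C) / κ, ?_, ?_⟩
  · have : 0 ≤ (44 + K0 + 4 * C) / κ := by positivity
    linarith
  intro L E X δ hL hE hX hXE hδ
  have hq : 0 ≤ (44 + K0 + 4 * C) / κ := by positivity
  have hE1 : 100 ≤ E := by linarith
  have hX1 := X_lower hC hL (show 1 ≤ E by linarith)
  rw [← hX] at hX1
  have hL0 : 0 < L := by linarith
  have hE0 : 0 < E := by linarith
  have hLC : 0 < L ^ C := by positivity
  have h2C : (0 : ℝ) < 2 ^ C := by positivity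
  have hmul : (2 * L) ^ C = 2 ^ C * L ^ C := Real.mul_rpow (by norm_num) hL0.le
  have hδ0 : 0 < δ := by rw [hδ]; positivity
  have hX0 : 0 < X := by rw [hX]; positivity
  have h2 : κ * E ^ 3 * L ≤ X * δ / 2 := by
    have h3 : κ * E ^ 3 * L = E ^ 4 * ((L ^ C) ^ 2 * L) * δ / 2 := by
      rw [hδ, hκ, hmul]; field_simp; ring
    rw [h3]
    gcongr
  have h4 : (44 + K0 + 4 * C) * (E * L) ≤ κ * E ^ 3 * L := by
    have h5 : (44 + K0 + 4 * C) / κ ≤ E ^ 2 := by nlinarith only [hE, hE1, hq]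
    rw [div_le_iff₀ hκ0] at h5
    calc (44 + K0 + 4 * C) * (E * L) ≤ (E ^ 2 * κ) * (E * L) := by gcongr
      _ = _ := by ring
  have hEL1 : E ≤ E * L := by nlinarith only [hE0, hL]
  have hEL2 : L ≤ E * L := by nlinarith only [hE1, hL]
  have hEL3 : 1 ≤ E * L := by linarith
  have h6 : 36 * E + K0 + 8 * L + 4 * C * L ≤ X * δ / 2 := by
    have ha := mul_le_mul_of_nonneg_left hEL3 hK
    have hb := mul_le_mul_of_nonneg_left hEL2 (show 0 ≤ 4 * C by linarith)
    linarith
  have e1 : (2 * L) ^ C ≤ Real.exp (2 * L * C) := by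
    rw [Real.exp_mul]
    exact Real.rpow_le_rpow (by linarith) (by linarith [Real.add_one_le_exp (2 * L)]) (by linarith)
  have e2 : E ≤ Real.exp E := by linarith [Real.add_one_le_exp E]
  have h7 : 5760 * (151 * Real.exp (8 * L)) / δ = Real.exp K0 * Real.exp (8 * L) * ((2 * L) ^ C) ^ 2 * E := by
    rw [← hAe, hA0, hδ]; field_simp
  rw [h7]
  calc _ ≤ Real.exp (32 * E) * Real.exp E ^ 2 * (Real.exp K0 * Real.exp (8 * L) * Real.exp (2 * L * C) ^ 2 * Real.exp E) *
        Real.exp (-(X * δ / 2)) := by gcongr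
    _ = Real.exp (32 * E + 2 * E + (K0 + 8 * L + 2 * (2 * L * C) + E) + (-(X * δ / 2))) := by
      rw [Real.exp_add, Real.exp_add, Real.exp_add, Real.exp_add, Real.exp_add, Real.exp_add]
      rw [← Real.exp_nat_mul, ← Real.exp_nat_mul]; push_cast; rfl
    _ ≤ _ := by
      rw [Real.exp_le_exp]; linarith

theorem sum_small {d L X E σ n T η w P : ℝ} (hd : 2 ≤ d) (hn : n ≤ d) (hσ : d * σ ≤ Real.exp L)
    (hE : 100 ≤ E) (hEX : 4 * E ≤ X) (hLX : 4 * L ≤ X) (hnt : d * X ≤ Real.exp E) (hw : w = Real.exp X) (hη : η = Real.exp (-(2 * E)))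
    (hT : T ≤ w * Real.exp (-E))
    (hS : w * (1 - η - (X + 1) / Real.exp (8 * E)) - 1 - T - 2 * n * Real.exp (4 * X - Real.exp (8 * E) * η ^ 2 / (8 * X)) ≤
      d * X * P + d * (2 * Real.exp (X / 2) * X) + d * σ) :
    w * (1 / (d * X) - Real.exp (-E)) ≤ P := by
  set u := Real.exp (-E) with hu
  have hu0 : 0 < u := Real.exp_pos _
  have hu1 : u ≤ 1 := Real.exp_le_one_iff.2 (by linarith)
  have hX : 400 ≤ X := by linarith
  have hw0 : 0 < w := by rw [hw]; exact Real.exp_pos _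
  have hwu : w * u = Real.exp (X - E) := by rw [hw, hu, ← Real.exp_add]; rfl
  have heu : Real.exp E * u = 1 := by rw [hu, ← Real.exp_add]; simp
  have hdX : 0 < d * X := by positivity
  have ha : w * η ≤ w * u := by
    gcongr; rw [hη, hu, Real.exp_le_exp]; linarith
  have hb : w * ((X + 1) / Real.exp (8 * E)) ≤ w * u := by
    gcongr
    rw [div_le_iff₀ (Real.exp_pos _), hu, ← Real.exp_add]
    calc X + 1 ≤ d * X := by nlinarith only [hd, hX]
      _ ≤ Real.exp E := hnt
      _ ≤ _ := by rw [Real.exp_le_exp]; linarith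
  have hc1 : 1 ≤ w * u := by rw [hwu]; exact Real.one_le_exp (by linarith)
  have he : 2 * n * Real.exp (4 * X - Real.exp (8 * E) * η ^ 2 / (8 * X)) ≤ w * u := by
    have h1 : Real.exp (8 * E) * η ^ 2 = Real.exp E ^ 4 := by
      rw [hη, ← Real.exp_nat_mul, ← Real.exp_nat_mul, ← Real.exp_add]; congr 1; push_cast; ring
    have h2 : (d * X) ^ 4 ≤ Real.exp E ^ 4 := pow_le_pow_left₀ hdX.le hnt 4
    have h3 : 4 * X ≤ Real.exp (8 * E) * η ^ 2 / (8 * X) := by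
      rw [h1, le_div_iff₀ (by positivity)]
      refine le_trans ?_ h2
      have h5 : (32 : ℝ) ≤ d * X * (d * X) := by
        have : 6 ≤ d * X := by nlinarith only [hd, hX]
        nlinarith only [this]
      have h6 : X * X ≤ d * X * (d * X) := by
        have : X ≤ d * X := by nlinarith only [hd, hX]
        gcongr
      calc 4 * X * (8 * X) = 32 * (X * X) := by ring
        _ ≤ (d * X * (d * X)) * (d * X * (d * X)) := by gcongr
        _ = _ := by ring
    have h4 : Real.exp (4 * X - Real.exp (8 * E) * η ^ 2 / (8 * X)) ≤ 1 := Real.exp_le_one_iff.2 (by linarith)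
    calc _ ≤ 2 * d * 1 := by gcongr
      _ ≤ d * X := by nlinarith only [hd, hX]
      _ ≤ Real.exp E := hnt
      _ ≤ w * u := by rw [hwu, Real.exp_le_exp]; linarith
  have hf : d * (2 * Real.exp (X / 2) * X) ≤ 2 * (w * u) := by
    calc d * (2 * Real.exp (X / 2) * X) = 2 * ((d * X) * Real.exp (X / 2)) := by ring
      _ ≤ 2 * (Real.exp E * Real.exp (X / 2)) := by gcongr
      _ ≤ 2 * (w * u) := by
        rw [hwu, ← Real.exp_add]; gcongr; linarith
  have hg : d * σ ≤ w * u := hσ.trans (by rw [hwu, Real.exp_le_exp]; linarith)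
  have htot : w - 8 * (w * u) ≤ d * X * P := by
    have : w * (1 - η - (X + 1) / Real.exp (8 * E)) = w - w * η - w * ((X + 1) / Real.exp (8 * E)) := by ring
    rw [this] at hS
    linarith only [hS, ha, hb, hc1, he, hf, hg, hT]
  have hwu0 : 0 < w * u := by positivity
  have hfin : w - d * X * (w * u) ≤ d * X * P := by
    have : 8 ≤ d * X := by nlinarith only [hd, hX]
    nlinarith only [htot, this, hwu0]
  have : w * (1 / (d * X) - u) = (w - d * X * (w * u)) / (d * X) := by field_simp
  rw [this, div_le_iff₀ hdX]
  linarith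

end

section

open MeasureTheory NumberField nonZeroDivisors Filter Topology
open scoped ENNReal

theorem mdzh_implies_mrh_squarefree (C : ℝ) (hC : 4 < C) (hmdzh : MDZH C) :
    ∃ c : ℝ, 0 < c ∧
      ∀ (f : Polynomial ℤ) (d σ : ℕ), Squarefree f → f.natDegree = d → 2 ≤ d →
        (∀ q : ℚ, Polynomial.aeval q f ≠ 0) → 0 < σ →
        (∀ i, |f.coeff i| ≤ 2 ^ σ) →
        ∀ x : ℝ,
          Real.exp (c * Real.log ((d : ℝ) ^ 2 * σ + (d : ℝ) ^ 3) ^ (2 + C ^ 2)) ≤ x →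
          (piPoly f x : ℝ) ≥
            x * (1 / (d * Real.log x) -
              Real.exp (-(Real.log x) ^ (1 / C) /
                Real.log ((d : ℝ) ^ 2 * σ + (d : ℝ) ^ 3) ^ C)) := by
  obtain ⟨c0, hc0, hc1, hzf⟩ := zero_free C hC hmdzh
  obtain ⟨E0, hE0, herr⟩ := err_main hC hc0 hc1
  have hE00 : 0 < E0 := by linarith
  refine ⟨E0 ^ C, by positivity, ?_⟩
  intro f d σ _ hfd hd hq hσ hc x hx
  have hd' : (2 : ℝ) ≤ d := by exact_mod_cast hd
  have hσ' : (1 : ℝ) ≤ σ := by exact_mod_cast hσ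
  set A : ℝ := (d : ℝ) ^ 2 * σ + (d : ℝ) ^ 3 with hA
  have hA12 : 12 ≤ A := by
    have h1 : (2 : ℝ) ^ 2 * 1 ≤ (d : ℝ) ^ 2 * σ := by gcongr
    have h2 : (2 : ℝ) ^ 3 ≤ (d : ℝ) ^ 3 := by gcongr
    rw [hA]; linarith
  set L := Real.log A with hL
  have hL1 : 1 ≤ L := by
    have : Real.log 4 ≤ L := Real.log_le_log (by norm_num) (by linarith)
    linarith [log_four_gt]
  have hLp : 0 < L := by linarith
  have hx0 : 0 < x := (Real.exp_pos _).trans_le hx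
  set X := Real.log x with hX
  have hxe : x = Real.exp X := (Real.exp_log hx0).symm
  have hX1 : E0 ^ C * L ^ (C * C) ≤ X := by
    have h1 : E0 ^ C * L ^ (2 + C ^ 2) ≤ X := by
      rw [hxe, Real.exp_le_exp] at hx; exact hx
    refine le_trans ?_ h1
    gcongr
    nlinarith only
  have hE0C : 1 ≤ E0 ^ C := Real.one_le_rpow (by linarith) (by linarith)
  have hX0 : 0 < X := lt_of_lt_of_le (by positivity) hX1
  set E := X ^ (1 / C) / L ^ C with hE
  have hC0 : C ≠ 0 := by linarith
  have hneg : -X ^ (1 / C) / L ^ C = -E := by rw [hE, neg_div]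
  rw [hneg]
  have hXE : X = E ^ C * L ^ (C * C) := by
    rw [hE, Real.div_rpow (by positivity) (by positivity), ← Real.rpow_mul hX0.le, one_div, inv_mul_cancel₀ hC0,
      Real.rpow_one, ← Real.rpow_mul hLp.le]
    field_simp
  have hEE : E0 ≤ E := by
    have h1 : E0 ^ C ≤ E ^ C := by
      rw [hXE] at hX1
      exact le_of_mul_le_mul_right hX1 (by positivity)
    exact (Real.rpow_le_rpow_iff hE00.le (by positivity) (by linarith)).1 h1
  have hE100 : 100 ≤ E := by linarith
  have hEp : 0 < E := by linarith
  by_cases hnt : Real.exp E < d * X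
  · have h1 : 1 / (d * X) - Real.exp (-E) ≤ 0 := by
      rw [Real.exp_neg, ← one_div, sub_nonpos]
      exact one_div_le_one_div_of_le (Real.exp_pos _) hnt.le
    have h2 : x * (1 / (d * X) - Real.exp (-E)) ≤ 0 := mul_nonpos_of_nonneg_of_nonpos hx0.le h1
    exact h2.trans (Nat.cast_nonneg _)
  rw [not_lt] at hnt
  have hXeE : X ≤ Real.exp E := le_trans (by nlinarith only [hX0, hd']) hnt
  have hXlow := X_lower hC hL1 (show 1 ≤ E by linarith)
  rw [← hXE] at hXlow
  have hLC1 : 1 ≤ (L ^ C) ^ 2 := one_le_pow₀ (Real.one_le_rpow hL1 (by linarith))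
  have hXL : E ^ 4 * L ≤ X := by
    refine le_trans ?_ hXlow
    gcongr
    nlinarith only [hLC1, hLp]
  have hE4 : 4 ≤ E ^ 3 := by
    have : (100 : ℝ) ^ 3 ≤ E ^ 3 := by gcongr
    linarith
  have hEX : 4 * E ≤ X := by
    refine le_trans ?_ hXL
    calc 4 * E ≤ E ^ 3 * E := by gcongr
      _ = E ^ 4 * 1 := by ring
      _ ≤ _ := by gcongr
  have hLX : 4 * L ≤ X := by
    refine le_trans ?_ hXL
    have : 4 ≤ E ^ 4 := by
      have := mul_le_mul hE4 (show 1 ≤ E by linarith) (by norm_num) (by positivity)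
      nlinarith only [this]
    gcongr
  have hf0 : f ≠ 0 := by rintro rfl; simp at hfd; omega
  subst hfd
  obtain ⟨K, hnf, hn1, hnd, hroot, hdisc⟩ := field_data f σ hd hq hc
  have hM := MK_le_L hn1 hd hσ hnd hdisc
  have hM0 := MK_ge hn1
  have hQ := qK_le_MK hn1
  have hQ0 := qK_ge (K := K)
  have hF := FK_is K
  have hx1 : 1 ≤ x := by rw [hxe]; exact Real.one_le_exp hX0.le
  have hcount := count_le (K := K) f σ hf0 hnd hc hroot hx1
  set δ := c0 / (((2 * L) ^ C) ^ 2 * (10 * E)) with hδ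
  have hδ0 : 0 < δ := by positivity
  have h2L1 : 1 ≤ ((2 * L) ^ C) ^ 2 := one_le_pow₀ (Real.one_le_rpow (by linarith) (by linarith))
  have hδh : δ ≤ 1 / 2 := by
    rw [hδ, div_le_iff₀ (by positivity)]
    nlinarith only [h2L1, hE100, hc1]
  have herr' := herr L E X δ hL1 hEE hXE hXeE hδ
  set R := Real.exp (8 * E) with hR
  set η := Real.exp (-(2 * E)) with hη
  have hR1 : 1 ≤ R := Real.one_le_exp (by linarith)
  have hfree : ∀ z ∈ Metric.ball ((1 + R : ℝ) : ℂ) (R + δ), FK K z ≠ 0 := by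
    refine hzf K hn1 R δ hR1 hδ0 ?_
    have h1 : (MK K ^ C) ^ 2 ≤ ((2 * L) ^ C) ^ 2 := by
      gcongr
    have h2 : Real.log (4 * R) ≤ 10 * E := by
      rw [Real.log_mul (by norm_num) (by positivity), hR, Real.log_exp]
      have := Real.log_le_sub_one_of_pos (show (0 : ℝ) < 4 by norm_num)
      linarith
    calc _ ≤ δ * (((2 * L) ^ C) ^ 2 * (10 * E)) := by
          have : 0 ≤ Real.log (4 * R) := Real.log_nonneg (by linarith)
          gcongr
      _ = c0 := by rw [hδ]; field_simp
      _ ≤ c0 := le_rfl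
  have hS := main_S hF (R := R) (δ := δ) (X := X) (η := η) hR1 hδ0 hδh (by linarith) (Real.exp_pos _)
    (Real.exp_le_one_iff.2 (by linarith)) ?_ hfree
  · rw [← hxe] at hS
    have hS2 := hS.trans hcount
    have hsqrt : √x = Real.exp (X / 2) := by
      rw [hxe, Real.sqrt_eq_rpow, ← Real.exp_mul]; congr 1; ring
    rw [hsqrt] at hS2
    refine sum_small (σ := σ) (n := Module.finrank ℚ K) (L := L) (T := (R * X) ^ 2 * (5760 * qK K * R ^ 2 / δ) * Real.exp (X * (1 - δ / 2)))
      hd' (by exact_mod_cast hnd) ?_ hE100 hEX hLX hnt hxe hη ?_ hS2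
    · rw [hL, Real.exp_log (by linarith), hA]
      have h1 : (f.natDegree : ℝ) * σ ≤ (f.natDegree : ℝ) ^ 2 * σ := by
        gcongr; nlinarith only [hd']
      have : 0 ≤ (f.natDegree : ℝ) ^ 3 := by positivity
      linarith
    · have h3 : Real.exp (X * (1 - δ / 2)) = x * Real.exp (-(X * δ / 2)) := by
        rw [hxe, ← Real.exp_add]; congr 1; ring
      have h4 : R ^ 4 = Real.exp (32 * E) := by
        rw [hR, ← Real.exp_nat_mul]; congr 1; push_cast; ring
      have hQL : qK K ≤ 151 * Real.exp (8 * L) := by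
        have h5 : Real.exp (4 * MK K) ≤ Real.exp (8 * L) := Real.exp_le_exp.2 (by linarith)
        linarith
      rw [h3]
      calc _ = x * (R ^ 4 * X ^ 2 * (5760 * qK K / δ) * Real.exp (-(X * δ / 2))) := by ring
        _ ≤ x * (Real.exp (32 * E) * X ^ 2 * (5760 * (151 * Real.exp (8 * L)) / δ) * Real.exp (-(X * δ / 2))) := by
          rw [h4]; gcongr
        _ ≤ _ := by gcongr
  · have h1 : Real.exp E ^ 6 ≤ (R + 1) * η := by
      have : Real.exp E ^ 6 = R * η := by
        rw [hR, hη, ← Real.exp_nat_mul, ← Real.exp_add]; congr 1; push_cast; ring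
      rw [this]
      have hη0 : 0 < η := Real.exp_pos _
      nlinarith only [hη0]
    have h2 : X ^ 2 ≤ Real.exp E ^ 6 := by
      have h5 : X ^ 2 ≤ Real.exp E ^ 2 := by gcongr
      refine h5.trans (pow_le_pow_right₀ (Real.one_le_exp hEp.le) (by norm_num))
    rw [← mul_div_assoc, le_div_iff₀ (by positivity)]
    nlinarith only [h1, h2, hEX, hE100]

end
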